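/- arXiv:1612.08918 — 5 statements merged into one kernel-verified Lean document; each statement's English description precedes it below -/
import Mathlib

section
/- Every three-dimensional lattice polytope with exactly two interior lattice points contains either a three-dimensional lattice polytope with exactly one interior lattice point, or a tetrahedron with exactly two interior lattice points, as a subpolytope (a lattice polytope all of whose vertices are lattice points of P). -/
open Set MeasureTheory

noncomputable section

/-- The canonical embedding of lattice points `ℤ^d` into `ℝ^d`. -/
def castPt {d : ℕ} (v : Fin d → ℤ) : Fin d → ℝ := fun i => (v i : ℝ)

/-- A lattice polytope: the convex hull of a nonempty finite set of lattice points. -/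
def IsLatticePolytope {d : ℕ} (P : Set (Fin d → ℝ)) : Prop :=
  ∃ V : Finset (Fin d → ℤ), V.Nonempty ∧
    P = convexHull ℝ (castPt '' (V : Set (Fin d → ℤ)))

/-- The interior lattice points of a full-dimensional polytope `P`. -/
def intLatPts {d : ℕ} (P : Set (Fin d → ℝ)) : Set (Fin d → ℤ) :=
  {x | castPt x ∈ interior P}

/-- Unimodular equivalence: an affine lattice automorphism in `GL_d(ℤ) ⋉ ℤ^d` maps `P` onto `Q`. -/
def UnimodEquiv {d : ℕ} (P Q : Set (Fin d → ℝ)) : Prop :=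
  ∃ (A : Matrix (Fin d) (Fin d) ℤ) (b : Fin d → ℤ), IsUnit A.det ∧
    (fun x : Fin d → ℝ => (A.map (Int.cast : ℤ → ℝ)).mulVec x + castPt b) '' P = Q

/-- A three-dimensional lattice polytope with exactly `k` interior lattice points. -/
def IsKPoint3Polytope (k : ℕ) (P : Set (Fin 3 → ℝ)) : Prop :=
  IsLatticePolytope P ∧ affineSpan ℝ P = ⊤ ∧ (intLatPts P).ncard = k

/-- The polytopes satisfying `Q` form exactly `n` unimodular equivalence classes: there are
`n` representatives and every polytope satisfying `Q` is equivalent to exactly one of them. -/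
def HasNClassesUpToEquiv (Q : Set (Fin 3 → ℝ) → Prop) (n : ℕ) : Prop :=
  ∃ S : Finset (Set (Fin 3 → ℝ)), S.card = n ∧ (∀ P ∈ S, Q P) ∧
    ∀ P, Q P → ∃! R, R ∈ S ∧ UnimodEquiv P R

/-- A point is interior to a convex set if no nonzero functional is maximal there. -/
theorem mem_interior_of_functionals {C : Set (Fin 3 → ℝ)} (hC : Convex ℝ C) (a : Fin 3 → ℝ)
    (h : ∀ f : (Fin 3 → ℝ) →ₗ[ℝ] ℝ, f ≠ 0 → ∃ x ∈ C, f a < f x) : a ∈ interior C := by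
  by_contra ha
  by_cases hne : (interior C).Nonempty
  · obtain ⟨f, hf⟩ := geometric_hahn_banach_open_point hC.interior isOpen_interior ha
    have hf0 : (f : (Fin 3 → ℝ) →ₗ[ℝ] ℝ) ≠ 0 := by
      intro h0
      obtain ⟨y, hy⟩ := hne
      have h1 := hf y hy
      have e : ∀ z, f z = 0 := fun z => by
        have := LinearMap.congr_fun h0 z
        simpa using this
      rw [e, e] at h1
      exact lt_irrefl _ h1
    obtain ⟨x, hx, hlt⟩ := h _ hf0
    have hcl : x ∈ closure (interior C) := by
      rw [hC.closure_interior_eq_closure_of_nonempty_interior hne]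
      exact subset_closure hx
    have hsub : closure (interior C) ⊆ {z | f z ≤ f a} :=
      closure_minimal (fun z hz => (hf z hz).le) (isClosed_le f.continuous continuous_const)
    have h2 : f x ≤ f a := hsub hcl
    have h3 : f a < f x := hlt
    linarith
  · have hsp : affineSpan ℝ C ≠ ⊤ := fun e => hne (hC.interior_nonempty_iff_affineSpan_eq_top.2 e)
    have hp0 : (LinearMap.proj 0 : (Fin 3 → ℝ) →ₗ[ℝ] ℝ) ≠ 0 := by
      intro e
      have := LinearMap.congr_fun e (fun _ => 1)
      simp at this
    obtain ⟨x0, hx0, -⟩ := h _ hp0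
    have hdir : vectorSpan ℝ C < ⊤ := by
      rw [lt_top_iff_ne_top]
      intro e
      apply hsp
      rw [← direction_affineSpan] at e
      exact (AffineSubspace.direction_eq_top_iff_of_nonempty
        ⟨x0, subset_affineSpan ℝ C hx0⟩).1 e
    obtain ⟨f, hf0, hker⟩ := Submodule.exists_le_ker_of_lt_top _ hdir
    have hconst : ∀ x ∈ C, f x = f x0 := by
      intro x hx
      have h1 : x -ᵥ x0 ∈ f.ker := hker (vsub_mem_vectorSpan ℝ hx hx0)
      rw [LinearMap.mem_ker] at h1
      simp only [vsub_eq_sub, map_sub] at h1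
      linarith
    obtain ⟨x, hx, h1⟩ := h f hf0
    obtain ⟨y, hy, h2⟩ := h (-f) (neg_ne_zero.2 hf0)
    simp only [LinearMap.neg_apply] at h2
    rw [hconst x hx] at h1
    rw [hconst y hy] at h2
    linarith

/-- Dual description of interior points of a convex hull. -/
theorem mem_interior_hull_iff {S : Set (Fin 3 → ℝ)} (a : Fin 3 → ℝ) :
    a ∈ interior (convexHull ℝ S) ↔
      ∀ f : (Fin 3 → ℝ) →ₗ[ℝ] ℝ, f ≠ 0 → ∃ x ∈ S, f a < f x := by
  constructor
  · intro ha f hf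
    by_contra hcon
    push Not at hcon
    have hsub : convexHull ℝ S ⊆ {z | f z ≤ f a} :=
      convexHull_min (fun z hz => hcon z hz) (convex_halfSpace_le f.isLinear _)
    obtain ⟨d, hd⟩ : ∃ d, f d ≠ 0 := by
      by_contra hc
      push Not at hc
      exact hf (LinearMap.ext hc)
    have hcont : Filter.Tendsto (fun t : ℝ => a + t • (f d • d)) (nhdsWithin 0 (Set.Ioi 0))
        (nhds a) := by
      have : Continuous (fun t : ℝ => a + t • (f d • d)) := by fun_prop
      have h1 := this.tendsto 0
      simp only [zero_smul, add_zero] at h1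
      exact h1.mono_left nhdsWithin_le_nhds
    have hev := hcont.eventually_mem (mem_interior_iff_mem_nhds.1 ha)
    have hev2 : ∀ᶠ t : ℝ in nhdsWithin 0 (Set.Ioi 0), 0 < t := self_mem_nhdsWithin
    obtain ⟨t, ht1, ht2⟩ := (Filter.Eventually.and hev hev2).exists
    have h3 : f (a + t • (f d • d)) ≤ f a := hsub ht1
    simp only [map_add, map_smul, smul_eq_mul] at h3
    have : 0 < t * (f d * f d) := mul_pos ht2 (mul_self_pos.2 hd)
    linarith
  · intro h
    refine mem_interior_of_functionals (convex_convexHull ℝ S) a fun f hf => ?_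
    obtain ⟨x, hx, hlt⟩ := h f hf
    exact ⟨x, subset_convexHull ℝ S hx, hlt⟩

/-- The vectors `φ i`, `i ∈ X`, positively span the quotient by `U`. -/
def PosSpan {ι : Type} (φ : ι → Fin 3 → ℝ) (U : Submodule ℝ (Fin 3 → ℝ)) (X : Finset ι) : Prop :=
  ∀ f : (Fin 3 → ℝ) →ₗ[ℝ] ℝ, f ≠ 0 → (∀ u ∈ U, f u = 0) → ∃ i ∈ X, 0 < f (φ i)

theorem PosSpan.exists_combination {ι : Type} {φ : ι → Fin 3 → ℝ}
    {U : Submodule ℝ (Fin 3 → ℝ)} {X : Finset ι} (h : PosSpan φ U X) (hU : U ≠ ⊤)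
    (v : Fin 3 → ℝ) :
    ∃ c : ι → ℝ, (∀ i ∈ X, 0 ≤ c i) ∧ ∑ i ∈ X, c i • φ i + v ∈ U := by
  classical
  have hXne : ∃ i, i ∈ X := by
    obtain ⟨f, hf0, hker⟩ := Submodule.exists_le_ker_of_lt_top U (lt_top_iff_ne_top.2 hU)
    obtain ⟨i, hi, -⟩ := h f hf0 (fun u hu => hker hu)
    exact ⟨i, hi⟩
  set C : Set (Fin 3 → ℝ) :=
    {z | ∃ c : ι → ℝ, (∀ i ∈ X, 0 ≤ c i) ∧ z - ∑ i ∈ X, c i • φ i ∈ U} with hCdef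
  have hC : Convex ℝ C := by
    rintro x ⟨c, hc, hx⟩ y ⟨d, hd, hy⟩ s t hs ht -
    refine ⟨fun i => s * c i + t * d i, fun i hi => ?_, ?_⟩
    · have := hc i hi
      have := hd i hi
      positivity
    · have e : s • x + t • y - ∑ i ∈ X, (s * c i + t * d i) • φ i =
          s • (x - ∑ i ∈ X, c i • φ i) + t • (y - ∑ i ∈ X, d i • φ i) := by
        simp only [add_smul, Finset.sum_add_distrib, mul_smul, smul_sub, Finset.smul_sum]
        abel
      rw [e]
      exact U.add_mem (U.smul_mem _ hx) (U.smul_mem _ hy)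
  have h0 : (0 : Fin 3 → ℝ) ∈ interior C := by
    refine mem_interior_of_functionals hC 0 fun f hf => ?_
    by_cases hfU : ∀ u ∈ U, f u = 0
    · obtain ⟨i, hi, hpos⟩ := h f hf hfU
      refine ⟨φ i, ⟨fun j => if j = i then 1 else 0, fun j _ => ?_, ?_⟩, by simpa using hpos⟩
      · dsimp only
        split_ifs <;> norm_num
      · simp [hi]
    · push Not at hfU
      obtain ⟨u, hu, hne⟩ := hfU
      refine ⟨f u • u, ⟨fun _ => 0, fun _ _ => le_rfl, ?_⟩, ?_⟩
      · simpa using U.smul_mem _ hu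
      · simp only [map_zero, map_smul, smul_eq_mul]
        exact mul_self_pos.2 hne
  have hcont : Filter.Tendsto (fun t : ℝ => t • (-v)) (nhdsWithin 0 (Set.Ioi 0)) (nhds 0) := by
    have : Continuous (fun t : ℝ => t • (-v)) := by fun_prop
    have h1 := this.tendsto 0
    simp only [zero_smul] at h1
    exact h1.mono_left nhdsWithin_le_nhds
  have hev := hcont.eventually_mem (mem_interior_iff_mem_nhds.1 h0)
  have hev2 : ∀ᶠ t : ℝ in nhdsWithin 0 (Set.Ioi 0), 0 < t := self_mem_nhdsWithin
  obtain ⟨t, ht1, ht2⟩ := (Filter.Eventually.and hev hev2).exists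
  obtain ⟨c, hc, hm⟩ := ht1
  refine ⟨fun i => t⁻¹ * c i, fun i hi => ?_, ?_⟩
  · have := hc i hi
    positivity
  · have e : ∑ i ∈ X, (t⁻¹ * c i) • φ i + v =
        (-t⁻¹) • (t • (-v) - ∑ i ∈ X, c i • φ i) := by
      have e1 : ∑ i ∈ X, (t⁻¹ * c i) • φ i = t⁻¹ • ∑ i ∈ X, c i • φ i := by
        simp only [mul_smul, Finset.smul_sum]
      rw [e1, smul_sub, smul_smul, neg_mul, inv_mul_cancel₀ ht2.ne', neg_smul, neg_smul, one_smul]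
      abel
    rw [e]
    exact U.smul_mem _ hm

/-- Conic Carathéodory theorem modulo a subspace. -/
theorem PosSpan.exists_independent {ι : Type} {φ : ι → Fin 3 → ℝ}
    {U : Submodule ℝ (Fin 3 → ℝ)} {X : Finset ι} (h : PosSpan φ U X) (hU : U ≠ ⊤)
    (v : Fin 3 → ℝ) :
    ∃ G ⊆ X, ∃ c : ι → ℝ, (∀ i ∈ G, 0 < c i) ∧ ∑ i ∈ G, c i • φ i + v ∈ U ∧
      Module.finrank ℝ ↥(U ⊔ Submodule.span ℝ (φ '' (G : Set ι))) =
        Module.finrank ℝ U + G.card := by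
  classical
  have hex : ∃ n, ∃ G ⊆ X, G.card = n ∧ ∃ c : ι → ℝ, (∀ i ∈ G, 0 ≤ c i) ∧
      ∑ i ∈ G, c i • φ i + v ∈ U := by
    obtain ⟨c, hc, hm⟩ := h.exists_combination hU v
    exact ⟨_, X, subset_rfl, rfl, c, hc, hm⟩
  obtain ⟨G, hGX, hcard, c, hc, hm⟩ := Nat.find_spec hex
  have hmin : ∀ c : ι → ℝ, (∀ i ∈ G, 0 ≤ c i) → ∑ i ∈ G, c i • φ i + v ∈ U →
      ∀ i ∈ G, 0 < c i := by
    intro c hc hm i hi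
    rcases (hc i hi).lt_or_eq with h1 | h1
    · exact h1
    exfalso
    have hlt : (G.erase i).card < Nat.find hex := by
      rw [← hcard]
      exact Finset.card_erase_lt_of_mem hi
    refine Nat.find_min hex hlt ⟨G.erase i, (Finset.erase_subset _ _).trans hGX, rfl, c,
      fun j hj => hc j (Finset.mem_of_mem_erase hj), ?_⟩
    rw [← Finset.add_sum_erase G _ hi, ← h1, zero_smul, zero_add] at hm
    exact hm
  have key : ∀ d : ι → ℝ, ∑ i ∈ G, d i • φ i ∈ U → ∀ i ∈ G, d i ≤ 0 := by
    intro d hd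
    by_contra hcon
    push Not at hcon
    have hne : (G.filter (fun i => 0 < d i)).Nonempty := by
      obtain ⟨i, hi, hpos⟩ := hcon
      exact ⟨i, Finset.mem_filter.2 ⟨hi, hpos⟩⟩
    obtain ⟨j, hj, hjmin⟩ := Finset.exists_min_image _ (fun i => c i / d i) hne
    obtain ⟨hjG, hdj⟩ := Finset.mem_filter.1 hj
    have hcj : 0 ≤ c j / d j := div_nonneg (hc j hjG) hdj.le
    have := hmin (fun i => c i - (c j / d j) * d i) ?_ ?_ j hjG
    · rw [div_mul_cancel₀ _ hdj.ne'] at this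
      linarith
    · intro i hi
      by_cases hdi : 0 < d i
      · have h2 := hjmin i (Finset.mem_filter.2 ⟨hi, hdi⟩)
        rw [le_div_iff₀ hdi] at h2
        linarith
      · have h3 := mul_nonneg hcj (sub_nonneg.2 (not_lt.1 hdi))
        have h4 := hc i hi
        linarith
    · have e : ∑ i ∈ G, (c i - (c j / d j) * d i) • φ i + v =
          (∑ i ∈ G, c i • φ i + v) - (c j / d j) • ∑ i ∈ G, d i • φ i := by
        simp only [sub_smul, Finset.sum_sub_distrib, mul_smul, Finset.smul_sum]
        abel
      rw [e]
      exact U.sub_mem hm (U.smul_mem _ hd)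
  have key0 : ∀ d : ι → ℝ, ∑ i ∈ G, d i • φ i ∈ U → ∀ i ∈ G, d i = 0 := by
    intro d hd i hi
    have h1 := key d hd i hi
    have h2 := key (fun i => - d i) (by simpa using hd) i hi
    linarith
  refine ⟨G, hGX, c, hmin c hc hm, hm, ?_⟩
  have hli : LinearIndepOn ℝ φ (G : Set ι) := by
    rw [linearIndepOn_finset_iff]
    intro d hd
    exact key0 d (hd ▸ U.zero_mem)
  have hfr : Module.finrank ℝ ↥(Submodule.span ℝ (φ '' (G : Set ι))) = G.card := by
    have h1 := finrank_span_eq_card hli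
    rw [← Set.image_eq_range] at h1
    simpa using h1
  have hinf : U ⊓ Submodule.span ℝ (φ '' (G : Set ι)) = ⊥ := by
    rw [eq_bot_iff]
    rintro z ⟨hzU, hz⟩
    obtain ⟨d, rfl⟩ := (Submodule.mem_span_image_finset_iff_exists_fun ℝ).1 hz
    have e : ∑ i : G, d i • φ i = ∑ i ∈ G, (if hi : i ∈ G then d ⟨i, hi⟩ else 0) • φ i := by
      rw [← Finset.sum_coe_sort G]
      exact Finset.sum_congr rfl fun i _ => by simp
    rw [e] at hzU ⊢
    have := key0 _ hzU
    rw [Submodule.mem_bot]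
    exact Finset.sum_eq_zero fun i hi => by rw [this i hi, zero_smul]
  have hh := Submodule.finrank_sup_add_finrank_inf_eq U (Submodule.span ℝ (φ '' (G : Set ι)))
  rw [hinf, finrank_bot, hfr] at hh
  simpa using hh

/-- If a positive combination of `G` and `v` vanishes modulo `U`, a functional that kills `U` and
not all of `G` is positive on `v` or on a member of `G`. -/
theorem pos_on_combination {ι : Type} {φ : ι → Fin 3 → ℝ} {U : Submodule ℝ (Fin 3 → ℝ)}
    {G : Finset ι} {c : ι → ℝ} {v : Fin 3 → ℝ} (hc : ∀ i ∈ G, 0 < c i)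
    (hm : ∑ i ∈ G, c i • φ i + v ∈ U) (f : (Fin 3 → ℝ) →ₗ[ℝ] ℝ) (hfU : ∀ u ∈ U, f u = 0)
    (hne : ∃ i ∈ G, f (φ i) ≠ 0) : 0 < f v ∨ ∃ i ∈ G, 0 < f (φ i) := by
  by_contra hcon
  push Not at hcon
  obtain ⟨hv, hG⟩ := hcon
  obtain ⟨j, hj, hj0⟩ := hne
  have h0 := hfU _ hm
  simp only [map_add, map_sum, map_smul, smul_eq_mul] at h0
  have hlt : ∑ i ∈ G, c i * f (φ i) < 0 := by
    refine Finset.sum_neg' (fun i hi => mul_nonpos_of_nonneg_of_nonpos (hc i hi).le (hG i hi))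
      ⟨j, hj, mul_neg_of_pos_of_neg (hc j hj) (lt_of_le_of_ne (hG j hj) hj0)⟩
  linarith

theorem kills_sup {ι : Type} {φ : ι → Fin 3 → ℝ} {U : Submodule ℝ (Fin 3 → ℝ)}
    {G : Finset ι} (f : (Fin 3 → ℝ) →ₗ[ℝ] ℝ) (hfU : ∀ u ∈ U, f u = 0)
    (hG : ∀ i ∈ G, f (φ i) = 0) :
    ∀ u ∈ U ⊔ Submodule.span ℝ (φ '' (G : Set ι)), f u = 0 := by
  have h1 : U ⊔ Submodule.span ℝ (φ '' (G : Set ι)) ≤ f.ker := by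
    refine sup_le (fun u hu => hfU u hu) (Submodule.span_le.2 ?_)
    rintro _ ⟨i, hi, rfl⟩
    exact hG i hi
  exact fun u hu => h1 hu

theorem PosSpan.mono_sub {ι : Type} {φ : ι → Fin 3 → ℝ} {U U' : Submodule ℝ (Fin 3 → ℝ)}
    {X : Finset ι} (h : PosSpan φ U X) (hU : U ≤ U') : PosSpan φ U' X :=
  fun f hf hfU => h f hf fun u hu => hfU u (hU hu)

/-- Steinitz's theorem modulo a subspace. -/
theorem PosSpan.steinitz {ι : Type} [DecidableEq ι] {φ : ι → Fin 3 → ℝ} {X : Finset ι} (n : ℕ) :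
    ∀ (U : Submodule ℝ (Fin 3 → ℝ)), 3 ≤ Module.finrank ℝ U + n → PosSpan φ U X →
      ∃ Y ⊆ X, Y.card ≤ 2 * n ∧ PosSpan φ U Y := by
  induction n using Nat.strong_induction_on with
  | _ n ih =>
  intro U hn h
  by_cases hU : U = ⊤
  · refine ⟨∅, Finset.empty_subset _, by simp, fun f hf hfU => ?_⟩
    exact absurd (LinearMap.ext fun z => hfU z (hU ▸ Submodule.mem_top)) hf
  obtain ⟨f, hf0, hker⟩ := Submodule.exists_le_ker_of_lt_top U (lt_top_iff_ne_top.2 hU)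
  obtain ⟨j, hj, hpos⟩ := h f hf0 (fun u hu => hker hu)
  obtain ⟨G, hGX, c, hc, hm, hfr⟩ := h.exists_independent hU (φ j)
  have hG1 : 1 ≤ G.card := by
    rw [Nat.one_le_iff_ne_zero]
    intro h0
    rw [Finset.card_eq_zero] at h0
    subst h0
    have h2 : f _ = 0 := hker hm
    simp at h2
    linarith
  set U' := U ⊔ Submodule.span ℝ (φ '' (G : Set ι)) with hU'
  have hle : Module.finrank ℝ U' ≤ 3 := by
    simpa using Submodule.finrank_le U'
  have hUlt : Module.finrank ℝ U < 3 := by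
    simpa using Submodule.finrank_lt hU
  obtain ⟨Y, hYX, hYc, hY⟩ := ih (n - G.card) (by omega) U' (by omega) (h.mono_sub le_sup_left)
  refine ⟨insert j (G ∪ Y), ?_, ?_, ?_⟩
  · exact Finset.insert_subset hj (Finset.union_subset hGX hYX)
  · have h1 := Finset.card_insert_le j (G ∪ Y)
    have h2 := Finset.card_union_le G Y
    omega
  · intro f hf hfU
    by_cases hne : ∃ i ∈ G, f (φ i) ≠ 0
    · rcases pos_on_combination hc hm f hfU hne with h1 | ⟨i, hi, h1⟩
      · exact ⟨j, by simp, h1⟩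
      · exact ⟨i, by simp [hi], h1⟩
    · push Not at hne
      obtain ⟨i, hi, h1⟩ := hY f hf (kills_sup f hfU hne)
      exact ⟨i, by simp [hi], h1⟩

/-- The conclusion of the main theorem. -/
def HasSeed (P : Set (Fin 3 → ℝ)) : Prop :=
    (∃ V : Finset (Fin 3 → ℤ), (V : Set (Fin 3 → ℤ)) ⊆ {x | castPt x ∈ P} ∧
      affineSpan ℝ (castPt '' (V : Set (Fin 3 → ℤ))) = ⊤ ∧
      (intLatPts (convexHull ℝ (castPt '' (V : Set (Fin 3 → ℤ))))).ncard = 1) ∨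
    (∃ v : Fin 4 → Fin 3 → ℤ, (∀ i, castPt (v i) ∈ P) ∧
      AffineIndependent ℝ (fun i => castPt (v i)) ∧
      (intLatPts (convexHull ℝ (Set.range fun i => castPt (v i)))).ncard = 2)

/-- If `a` is interior to the hull of `W ∪ {b}` while `b` is not interior to the hull of `W`, then
the hull of `W ∪ {b}` has exactly one interior lattice point. -/
theorem seed_of_not_interior {P : Set (Fin 3 → ℝ)} (hP : Convex ℝ P) {a b : Fin 3 → ℤ}
    (hab : intLatPts P = {a, b}) (W : Finset (Fin 3 → ℤ)) (hW : ∀ w ∈ W, castPt w ∈ P)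
    (ha : castPt a ∈ interior (convexHull ℝ (castPt '' (insert b (W : Set (Fin 3 → ℤ))))))
    (hb : castPt b ∉ interior (convexHull ℝ (castPt '' (W : Set (Fin 3 → ℤ))))) :
    HasSeed P := by
  classical
  have hbP : castPt b ∈ P := by
    have : b ∈ intLatPts P := by rw [hab]; simp
    exact interior_subset this
  left
  refine ⟨insert b W, ?_, ?_, ?_⟩
  · intro x hx
    rcases Finset.mem_insert.1 (Finset.mem_coe.1 hx) with rfl | hx
    · exact hbP
    · exact hW x hx
  · rw [Finset.coe_insert]
    exact interior_convexHull_nonempty_iff_affineSpan_eq_top.1 ⟨_, ha⟩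
  · rw [Finset.coe_insert, Set.ncard_eq_one]
    refine ⟨a, Set.eq_singleton_iff_unique_mem.2 ⟨ha, fun x hx => ?_⟩⟩
    have hsub : convexHull ℝ (castPt '' (insert b (W : Set (Fin 3 → ℤ)))) ⊆ P := by
      refine convexHull_min ?_ hP
      rintro _ ⟨y, rfl | hy, rfl⟩
      · exact hbP
      · exact hW y hy
    have hx' : x ∈ intLatPts P := interior_mono hsub hx
    rw [hab] at hx'
    rcases hx' with h1 | h1
    · exact h1
    · exfalso
      have h1 : x = b := h1
      subst h1
      apply hb
      rw [mem_interior_hull_iff]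
      intro f hf
      obtain ⟨z, ⟨y, hy, rfl⟩, hlt⟩ := (mem_interior_hull_iff _).1 hx f hf
      rcases hy with rfl | hy
      · exact absurd hlt (lt_irrefl _)
      · exact ⟨_, ⟨y, hy, rfl⟩, hlt⟩

theorem seed_of_card_le {P : Set (Fin 3 → ℝ)} (hP : Convex ℝ P) {a b : Fin 3 → ℤ} (hne : a ≠ b)
    (hab : intLatPts P = {a, b}) (W : Finset (Fin 3 → ℤ)) (hW : ∀ w ∈ W, castPt w ∈ P)
    (ha : castPt a ∈ interior (convexHull ℝ (castPt '' (insert b (W : Set (Fin 3 → ℤ))))))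
    (hcard : W.card ≤ 4) : HasSeed P := by
  classical
  by_cases hb : castPt b ∈ interior (convexHull ℝ (castPt '' (W : Set (Fin 3 → ℤ))))
  swap
  · exact seed_of_not_interior hP hab W hW ha hb
  right
  have ha' : castPt a ∈ interior (convexHull ℝ (castPt '' (W : Set (Fin 3 → ℤ)))) := by
    refine interior_mono (convexHull_min ?_ (convex_convexHull ℝ _)) ha
    rintro _ ⟨y, rfl | hy, rfl⟩
    · exact interior_subset hb
    · exact subset_convexHull ℝ _ ⟨y, hy, rfl⟩
  have hspan := interior_convexHull_nonempty_iff_affineSpan_eq_top.1 ⟨_, ha'⟩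
  have hvs := AffineSubspace.vectorSpan_eq_top_of_affineSpan_eq_top ℝ _ _ hspan
  have hWne : W.Nonempty := by
    rw [Finset.nonempty_iff_ne_empty]
    rintro rfl
    simp at ha'
  have hc4 : W.card = 4 := by
    refine le_antisymm hcard ?_
    obtain ⟨m, hm⟩ := Nat.exists_eq_succ_of_ne_zero hWne.card_pos.ne'
    have h1 := finrank_vectorSpan_range_le ℝ (fun w : W => castPt (w : Fin 3 → ℤ)) (n := m)
      (by simpa using hm)
    have h2 : Set.range (fun w : W => castPt (w : Fin 3 → ℤ)) =
        castPt '' (W : Set (Fin 3 → ℤ)) := by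
      rw [Set.image_eq_range]
      rfl
    rw [h2, hvs] at h1
    simp at h1
    omega
  let e := W.equivFinOfCardEq hc4
  have hrange : (Set.range fun i : Fin 4 => castPt ((e.symm i : W) : Fin 3 → ℤ)) =
      castPt '' (W : Set (Fin 3 → ℤ)) := by
    ext z
    constructor
    · rintro ⟨i, rfl⟩
      exact ⟨_, (e.symm i).2, rfl⟩
    · rintro ⟨w, hw, rfl⟩
      exact ⟨e ⟨w, hw⟩, by simp⟩
  refine ⟨fun i => (e.symm i : W), fun i => hW _ (e.symm i).2, ?_, ?_⟩
  · rw [affineIndependent_iff_finrank_vectorSpan_eq ℝ _ (n := 3) (by simp), hrange, hvs]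
    simp
  · rw [hrange, Set.ncard_eq_two]
    refine ⟨a, b, hne, Set.Subset.antisymm (fun x hx => ?_) ?_⟩
    · have hsub : convexHull ℝ (castPt '' (W : Set (Fin 3 → ℤ))) ⊆ P := by
        refine convexHull_min ?_ hP
        rintro _ ⟨y, hy, rfl⟩
        exact hW y hy
      have hx' : x ∈ intLatPts P := interior_mono hsub hx
      rwa [hab] at hx'
    · rintro x (rfl | rfl)
      · exact ha'
      · exact hb

theorem hasSeed_of_two {P : Set (Fin 3 → ℝ)} (hP : IsKPoint3Polytope 2 P) : HasSeed P := by
  classical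
  obtain ⟨⟨V, -, hV⟩, -, h2⟩ := hP
  have hconv : Convex ℝ P := hV ▸ convex_convexHull ℝ _
  have hVP : ∀ w ∈ V, castPt w ∈ P := fun w hw => by
    rw [hV]
    exact subset_convexHull ℝ _ ⟨w, hw, rfl⟩
  obtain ⟨a, b, hne, hab⟩ := Set.ncard_eq_two.1 h2
  have haP : castPt a ∈ interior P := by
    have : a ∈ intLatPts P := by rw [hab]; simp
    exact this
  set φ : (Fin 3 → ℤ) → Fin 3 → ℝ := fun w => castPt w - castPt a with hφ
  have hβ : φ b ≠ 0 := by
    intro h0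
    apply hne
    funext i
    have := congrFun (sub_eq_zero.1 h0) i
    simp only [castPt, Int.cast_inj] at this
    exact this.symm
  have hX : PosSpan φ ⊥ V := by
    intro f hf _
    rw [hV, mem_interior_hull_iff] at haP
    obtain ⟨_, ⟨w, hw, rfl⟩, hlt⟩ := haP f hf
    exact ⟨w, hw, by simp only [hφ, map_sub]; linarith⟩
  obtain ⟨G, hGV, c, hc, hm, hfr⟩ := hX.exists_independent bot_ne_top (φ b)
  have hG1 : 1 ≤ G.card := by
    rw [Nat.one_le_iff_ne_zero]
    intro h0
    rw [Finset.card_eq_zero] at h0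
    subst h0
    apply hβ
    simpa using hm
  rw [finrank_bot, zero_add] at hfr
  have hG3 : G.card ≤ 3 := by
    rw [← hfr]
    simpa using Submodule.finrank_le (⊥ ⊔ Submodule.span ℝ (φ '' (G : Set (Fin 3 → ℤ))))
  obtain ⟨Y, hYV, hYc, hY⟩ := PosSpan.steinitz (3 - G.card) _ (by omega) (hX.mono_sub
    (bot_le : ⊥ ≤ ⊥ ⊔ Submodule.span ℝ (φ '' (G : Set (Fin 3 → ℤ)))))
  have hWP : ∀ w ∈ G ∪ Y, castPt w ∈ P := fun w hw =>
    hVP w ((Finset.union_subset hGV hYV) hw)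
  have haW : castPt a ∈ interior (convexHull ℝ
      (castPt '' (insert b ((G ∪ Y : Finset (Fin 3 → ℤ)) : Set (Fin 3 → ℤ))))) := by
    rw [mem_interior_hull_iff]
    intro f hf
    have hgoal : ∃ w, (w = b ∨ w ∈ G ∪ Y) ∧ 0 < f (φ w) := by
      by_cases hnz : ∃ i ∈ G, f (φ i) ≠ 0
      · rcases pos_on_combination hc hm f (by simp) hnz with h1 | ⟨i, hi, h1⟩
        · exact ⟨b, by simp, h1⟩
        · exact ⟨i, by simp [hi], h1⟩
      · push Not at hnz
        obtain ⟨i, hi, h1⟩ := hY f hf (kills_sup f (by simp) hnz)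
        exact ⟨i, by simp [hi], h1⟩
    obtain ⟨w, hw, hlt⟩ := hgoal
    refine ⟨castPt w, ⟨w, hw, rfl⟩, ?_⟩
    simp only [hφ, map_sub] at hlt
    linarith
  by_cases hG2 : 2 ≤ G.card
  · refine seed_of_card_le hconv hne hab (G ∪ Y) hWP haW ?_
    have := Finset.card_union_le G Y
    omega
  by_cases hb : castPt b ∈ interior (convexHull ℝ
      (castPt '' ((G ∪ Y : Finset (Fin 3 → ℤ)) : Set (Fin 3 → ℤ))))
  swap
  · exact seed_of_not_interior hconv hab _ hWP haW hb
  obtain ⟨g, rfl⟩ := Finset.card_eq_one.1 (show G.card = 1 by omega)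
  refine seed_of_card_le hconv hne.symm (hab.trans (Set.pair_comm a b)) Y
    (fun w hw => hVP w (hYV hw)) ?_ (by omega)
  rw [mem_interior_hull_iff]
  intro f hf
  obtain ⟨_, ⟨w, hw, rfl⟩, hlt⟩ := (mem_interior_hull_iff _).1 hb f hf
  by_cases hfa : f (castPt b) < f (castPt a)
  · exact ⟨_, ⟨a, by simp, rfl⟩, hfa⟩
  rcases Finset.mem_union.1 (Finset.mem_coe.1 hw) with h1 | h1
  · exfalso
    have h1 : w = g := by simpa using h1
    subst h1
    have hcw := hc w (by simp)
    have h0 : c w • φ w + φ b = 0 := by simpa using hm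
    have h3 := congrArg f h0
    simp only [hφ, map_add, map_smul, map_sub, map_zero, smul_eq_mul] at h3
    have h4 : 0 < c w * (f (castPt w) - f (castPt a)) := mul_pos hcw (by linarith)
    linarith
  · exact ⟨_, ⟨w, Set.mem_insert_of_mem _ h1, rfl⟩, hlt⟩

/-- Every three-dimensional lattice polytope with exactly two interior lattice points
contains, as a subpolytope spanned by lattice points of `P`, either a three-dimensional
lattice polytope with exactly one interior lattice point, or a tetrahedron with exactly
two interior lattice points. -/
theorem two_point_three_polytope_contains_seed (P : Set (Fin 3 → ℝ))
    (hP : IsKPoint3Polytope 2 P) :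
    (∃ V : Finset (Fin 3 → ℤ), (V : Set (Fin 3 → ℤ)) ⊆ {x | castPt x ∈ P} ∧
      affineSpan ℝ (castPt '' (V : Set (Fin 3 → ℤ))) = ⊤ ∧
      (intLatPts (convexHull ℝ (castPt '' (V : Set (Fin 3 → ℤ))))).ncard = 1) ∨
    (∃ v : Fin 4 → Fin 3 → ℤ, (∀ i, castPt (v i) ∈ P) ∧
      AffineIndependent ℝ (fun i => castPt (v i)) ∧
      (intLatPts (convexHull ℝ (Set.range fun i => castPt (v i)))).ncard = 2) := by
  exact hasSeed_of_two hP
end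
end

section
/- Let K be a positive integer and let P be a d-dimensional lattice polytope in ℤ^d with 1 ≤ |int(P) ∩ ℤ^d| ≤ K. Then the set S = {v ∈ ℤ^d : |int(conv(P ∪ {v})) ∩ ℤ^d| ≤ K} is finite. -/
open Set MeasureTheory

noncomputable section

theorem finite_of_bdd {d : ℕ} (S : Set (Fin d → ℤ)) (p : Fin d → ℝ) (C : ℝ)
    (h : ∀ v ∈ S, ‖castPt v - p‖ ≤ C) : S.Finite := by
  refine (Set.finite_Icc (fun i => ⌊p i - C⌋) (fun i => ⌈p i + C⌉)).subset ?_
  intro v hv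
  have h' : ∀ i, |(v i : ℝ) - p i| ≤ C := fun i =>
    (norm_le_pi_norm (castPt v - p) i).trans (h v hv)
  constructor
  · intro i
    have := (abs_le.1 (h' i)).1
    have h3 : ((⌊p i - C⌋ : ℤ) : ℝ) ≤ v i := (Int.floor_le _).trans (by linarith)
    exact_mod_cast h3
  · intro i
    have := (abs_le.1 (h' i)).2
    have h3 : (v i : ℝ) ≤ ((⌈p i + C⌉ : ℤ) : ℝ) := le_trans (by linarith) (Int.le_ceil _)
    exact_mod_cast h3

/-- Simultaneous Dirichlet approximation by pigeonhole. -/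
theorem dirichlet {d : ℕ} (Q : ℕ) (hQ : 0 < Q) (s : Fin d → ℝ) :
    ∃ (q : ℕ) (z : Fin d → ℤ), 0 < q ∧ q ≤ Q ^ d ∧ ∀ i, |(z i : ℝ) - q * s i| ≤ 1 / Q := by
  have hQ' : (0 : ℝ) < Q := by exact_mod_cast hQ
  have hlt : ∀ x : ℝ, ⌊Q * Int.fract x⌋₊ < Q := fun x => by
    rw [Nat.floor_lt (mul_nonneg hQ'.le (Int.fract_nonneg x))]
    nlinarith [Int.fract_lt_one x]
  let f : Fin (Q ^ d + 1) → (Fin d → Fin Q) := fun j i =>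
    ⟨⌊Q * Int.fract ((j : ℕ) * s i)⌋₊, hlt _⟩
  have key : ∃ j k, j ≠ k ∧ f j = f k := Fintype.exists_ne_map_eq_of_card_lt f (by simp)
  have key2 : ∃ j k, j < k ∧ f j = f k := by
    obtain ⟨j, k, hne, he⟩ := key
    rcases lt_or_gt_of_ne hne with h | h
    · exact ⟨j, k, h, he⟩
    · exact ⟨k, j, h, he.symm⟩
  obtain ⟨j, k, hjk, he⟩ := key2
  have hjk' : (j : ℕ) < k := hjk
  refine ⟨(k : ℕ) - j, fun i => ⌊(k : ℕ) * s i⌋ - ⌊(j : ℕ) * s i⌋, by omega, by omega, ?_⟩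
  intro i
  have h1 : ⌊Q * Int.fract ((j : ℕ) * s i)⌋₊ = ⌊Q * Int.fract ((k : ℕ) * s i)⌋₊ := by
    have := congrFun he i
    simpa [f] using this
  have a0 := Nat.floor_le (mul_nonneg hQ'.le (Int.fract_nonneg ((j : ℕ) * s i)))
  have a1 := Nat.lt_floor_add_one (Q * Int.fract ((j : ℕ) * s i))
  have b0 := Nat.floor_le (mul_nonneg hQ'.le (Int.fract_nonneg ((k : ℕ) * s i)))
  have b1 := Nat.lt_floor_add_one (Q * Int.fract ((k : ℕ) * s i))
  rw [h1] at a0 a1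
  have e1 := Int.floor_add_fract ((j : ℕ) * s i)
  have e2 := Int.floor_add_fract ((k : ℕ) * s i)
  rw [le_div_iff₀ hQ', ← abs_of_pos hQ', ← abs_mul]
  push_cast [Nat.cast_sub hjk'.le]
  have e3 : ((⌊(k : ℕ) * s i⌋ : ℝ) - ⌊(j : ℕ) * s i⌋ - ((k : ℕ) - (j : ℕ)) * s i)
      = Int.fract ((j : ℕ) * s i) - Int.fract ((k : ℕ) * s i) := by linarith
  rw [e3, abs_le]
  constructor <;> linarith

theorem many_points {d : ℕ} (K : ℕ) (hK : 0 < K) (P : Set (Fin d → ℝ)) (p : Fin d → ℤ) (r : ℝ)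
    (hr : 0 < r) (hball : Metric.ball (castPt p) r ⊆ interior P) (Q : ℕ) (hQ : 0 < Q)
    (hQr : (K : ℝ) / Q < r / 2) (v : Fin d → ℤ)
    (hv : 4 * K * (Q : ℝ) ^ d < ‖castPt v - castPt p‖)
    (hfin : (intLatPts (convexHull ℝ (P ∪ {castPt v}))).Finite) :
    K < (intLatPts (convexHull ℝ (P ∪ {castPt v}))).ncard := by
  set n := ‖castPt v - castPt p‖ with hn
  have hn0 : 0 < n := lt_of_le_of_lt (by positivity) hv
  have hQ' : (0 : ℝ) < Q := by exact_mod_cast hQ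
  have hQ1 : (1 : ℝ) ≤ Q := by exact_mod_cast hQ
  obtain ⟨q, z, hq0, hqQ, hz⟩ := dirichlet Q hQ ((2 / n) • (castPt v - castPt p))
  have hq0' : (1 : ℝ) ≤ q := by exact_mod_cast hq0
  have hqQ' : (q : ℝ) ≤ (Q : ℝ) ^ d := by exact_mod_cast hqQ
  have hz0 : z ≠ 0 := by
    rintro rfl
    have : ‖(2 / n) • (castPt v - castPt p)‖ ≤ 1 := by
      rw [pi_norm_le_iff_of_nonneg zero_le_one]
      intro i
      have h := hz i
      simp only [Pi.zero_apply, Int.cast_zero, zero_sub, abs_neg, abs_mul, Nat.abs_cast] at h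
      have h1 : 1 / (Q : ℝ) ≤ 1 := by rw [div_le_one hQ']; exact hQ1
      rw [Real.norm_eq_abs]
      nlinarith [abs_nonneg (((2 / n) • (castPt v - castPt p)) i)]
    rw [norm_smul, ← hn, Real.norm_eq_abs, abs_of_pos (by positivity),
      div_mul_cancel₀ _ hn0.ne'] at this
    linarith
  have hinj : Function.Injective (fun m : ℕ => p + (m : ℤ) • z) := by
    intro a b hab
    obtain ⟨i, hi⟩ := Function.ne_iff.1 hz0
    have := congrFun hab i
    simp at this hi
    tauto
  have hsub : ((Finset.range (K + 1)).image (fun m : ℕ => p + (m : ℤ) • z) : Set (Fin d → ℤ)) ⊆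
      intLatPts (convexHull ℝ (P ∪ {castPt v})) := by
    intro x hx
    simp only [Finset.coe_image, Finset.coe_range, Set.mem_image, Set.mem_Iio] at hx
    obtain ⟨m, hm, rfl⟩ := hx
    have hm' : (m : ℝ) ≤ K := by exact_mod_cast Nat.lt_succ_iff.1 hm
    have hm0 : (0 : ℝ) ≤ m := Nat.cast_nonneg m
    set t : ℝ := m * q * (2 / n) with ht
    have ht0 : 0 ≤ t := by positivity
    have ht1 : t ≤ 1 / 2 := by
      have : (m : ℝ) * q ≤ K * (Q : ℝ) ^ d := by gcongr
      rw [ht, ← mul_div_assoc, div_le_iff₀ hn0]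
      linarith
    have h1t : 0 < 1 - t := by linarith
    set y : Fin d → ℝ := castPt p + (1 - t)⁻¹ • ((m : ℝ) • castPt z - t • (castPt v - castPt p))
      with hy
    have hyb : y ∈ Metric.ball (castPt p) r := by
      rw [mem_ball_iff_norm, hy, add_sub_cancel_left, norm_smul, norm_inv, Real.norm_eq_abs,
        abs_of_pos h1t, inv_mul_lt_iff₀ h1t]
      have : ‖(m : ℝ) • castPt z - t • (castPt v - castPt p)‖ ≤ K / Q := by
        rw [pi_norm_le_iff_of_nonneg (by positivity)]
        intro i
        have h := hz i
        have e : ((m : ℝ) • castPt z - t • (castPt v - castPt p)) i =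
            m * ((z i : ℝ) - q * ((2 / n) • (castPt v - castPt p)) i) := by
          simp [castPt, ht]; ring
        rw [e, Real.norm_eq_abs, abs_mul, Nat.abs_cast, div_eq_mul_one_div (K : ℝ)]
        gcongr
      nlinarith
    have hyi : y ∈ interior (convexHull ℝ (P ∪ {castPt v})) :=
      interior_mono (subset_union_left.trans (subset_convexHull ℝ _)) (hball hyb)
    have hvi : castPt v ∈ convexHull ℝ (P ∪ {castPt v}) :=
      subset_convexHull ℝ _ (by simp)
    have := (convex_convexHull ℝ (P ∪ {castPt v})).combo_interior_self_mem_interior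
      hyi hvi h1t ht0 (by ring)
    show castPt _ ∈ interior _
    convert this using 1
    rw [hy, smul_add, smul_inv_smul₀ h1t.ne']
    ext i
    simp [castPt]; ring
  have := Set.ncard_le_ncard hsub hfin
  rw [Set.ncard_coe_finset, Finset.card_image_of_injective _ hinj, Finset.card_range] at this
  omega

theorem finite_intLatPts {d : ℕ} (P : Set (Fin d → ℝ)) (h : Bornology.IsBounded P) :
    (intLatPts P).Finite := by
  obtain ⟨C, hC⟩ := h.exists_norm_le
  refine finite_of_bdd _ 0 C ?_
  intro v hv
  rw [sub_zero]
  exact hC _ (interior_subset hv)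

/-- Let `K ≥ 1` and let `P` be a `d`-dimensional lattice polytope with at least one and at
most `K` interior lattice points. Then the set of lattice points `v` such that
`conv(P ∪ {v})` has at most `K` interior lattice points is finite. -/
theorem finitely_many_growths {d : ℕ} (K : ℕ) (hK : 0 < K) (P : Set (Fin d → ℝ))
    (hP : IsLatticePolytope P) (hdim : affineSpan ℝ P = ⊤)
    (h1 : 1 ≤ (intLatPts P).ncard) (h2 : (intLatPts P).ncard ≤ K) :
    {v : Fin d → ℤ |
      (intLatPts (convexHull ℝ (P ∪ {castPt v}))).ncard ≤ K}.Finite := by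
  obtain ⟨p, hp⟩ : (intLatPts P).Nonempty := by
    apply Set.nonempty_of_ncard_ne_zero
    omega
  obtain ⟨r, hr, hball⟩ := Metric.isOpen_iff.1 isOpen_interior _ hp
  obtain ⟨Q, hQ⟩ := exists_nat_gt ((K : ℝ) / (r / 2))
  have hQ' : (0 : ℝ) < Q := lt_of_le_of_lt (by positivity) hQ
  have hbP : Bornology.IsBounded P := by
    obtain ⟨V, -, rfl⟩ := hP
    exact (isBounded_convexHull).2 (V.finite_toSet.image _).isBounded
  refine finite_of_bdd _ (castPt p) (4 * K * (Q : ℝ) ^ d) ?_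
  intro v hv
  by_contra! hcon
  have := many_points K hK P p r hr hball Q (by exact_mod_cast hQ')
    (by rw [div_lt_iff₀ (by positivity)] at hQ ⊢; linarith) v hcon
    (finite_intLatPts _ (isBounded_convexHull.2 (hbP.union Bornology.isBounded_singleton)))
  exact absurd hv (not_le.2 this)
end
end

section
/- Up to unimodular equivalence there are exactly five minimal tetrahedra with exactly two interior lattice points, namely conv{(0,0,0),(1,0,0),(0,1,0),(5,5,8)}, conv{(0,0,0),(1,0,0),(0,1,0),(6,9,10)}, conv{(0,0,0),(1,0,0),(0,1,0),(5,7,24)}, conv{(0,0,0),(1,0,0),(0,2,0),(5,2,6)}, and conv{(0,0,0),(1,0,0),(0,2,0),(5,2,12)}. -/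
open Set MeasureTheory

noncomputable section

/-- The lattice points of `P`. -/
def latticePts {d : ℕ} (P : Set (Fin d → ℝ)) : Set (Fin d → ℤ) :=
  {x | castPt x ∈ P}

/-- The lattice points in the relative interior of `P`. -/
def relIntLatPts {d : ℕ} (P : Set (Fin d → ℝ)) : Set (Fin d → ℤ) :=
  {x | castPt x ∈ intrinsicInterior ℝ P}

/-- `P` is a minimal lattice polytope: `P` is not hollow, and for every vertex `v` of `P`
the polytope `conv((P ∩ ℤ^d) \ {v})` is hollow. -/
def IsMinimalPolytope {d : ℕ} (P : Set (Fin d → ℝ)) : Prop :=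
  (relIntLatPts P).Nonempty ∧
  ∀ v : Fin d → ℤ, castPt v ∈ Set.extremePoints ℝ P →
    relIntLatPts (convexHull ℝ (castPt '' (latticePts P \ {v}))) = ∅

/-- A lattice tetrahedron: the convex hull of four affinely independent lattice points. -/
def IsLatticeTetrahedron (P : Set (Fin 3 → ℝ)) : Prop :=
  ∃ v : Fin 4 → Fin 3 → ℤ, AffineIndependent ℝ (fun i => castPt (v i)) ∧
    P = convexHull ℝ (Set.range fun i => castPt (v i))

/-- The five minimal tetrahedra with exactly two interior lattice points. -/
def minimalTwoPointTetrahedra : Fin 5 → Set (Fin 3 → ℝ) :=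
  ![convexHull ℝ {![0,0,0], ![1,0,0], ![0,1,0], ![5,5,8]},
    convexHull ℝ {![0,0,0], ![1,0,0], ![0,1,0], ![6,9,10]},
    convexHull ℝ {![0,0,0], ![1,0,0], ![0,1,0], ![5,7,24]},
    convexHull ℝ {![0,0,0], ![1,0,0], ![0,2,0], ![5,2,6]},
    convexHull ℝ {![0,0,0], ![1,0,0], ![0,2,0], ![5,2,12]}]

/-- `c` is a barycentric representation of the lattice point `x` with respect to `v`. -/
def BRep (v : Fin 4 → Fin 3 → ℤ) (c : Fin 4 → ℝ) (x : Fin 3 → ℤ) : Prop :=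
  ∑ i, c i = 1 ∧ ∀ k, ∑ i, c i * (v i k : ℝ) = (x k : ℝ)

/-- Algebraic form of: `v` spans a minimal tetrahedron whose interior lattice points are `p, q`. -/
structure GoodTet (v : Fin 4 → Fin 3 → ℤ) (p q : Fin 3 → ℤ) : Prop where
  ind : ∀ c : Fin 4 → ℝ, ∑ i, c i = 0 → (∀ k, ∑ i, c i * (v i k : ℝ) = 0) → c = 0
  ne : p ≠ q
  hp : ∃ c, BRep v c p ∧ ∀ i, 0 < c i
  hq : ∃ c, BRep v c q ∧ ∀ i, 0 < c i
  int : ∀ x c, BRep v c x → (∀ i, 0 < c i) → x = p ∨ x = q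
  min : ∀ i m x μ ξ, BRep v μ m → BRep v ξ x → (∀ j, 0 ≤ μ j) → 0 < μ i →
    (∃ j, j ≠ i ∧ 0 < μ j) → 0 < ξ i → (∀ j, j ≠ i → ξ i * μ j < ξ j * μ i) → False

theorem castPt_inj {d : ℕ} {x y : Fin d → ℤ} (h : castPt x = castPt y) : x = y := by
  funext i
  have := congrFun h i
  simpa [castPt] using this

/-- the affine basis attached to an affinely independent quadruple -/
def mkBasis (v : Fin 4 → Fin 3 → ℝ) (hv : AffineIndependent ℝ v) :
    AffineBasis (Fin 4) ℝ (Fin 3 → ℝ) :=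
  ⟨v, hv, by
    rw [hv.affineSpan_eq_top_iff_card_eq_finrank_add_one]; simp⟩

theorem mkBasis_coe (v : Fin 4 → Fin 3 → ℝ) (hv : AffineIndependent ℝ v) :
    ⇑(mkBasis v hv) = v := rfl

theorem coord_of_comb (b : AffineBasis (Fin 4) ℝ (Fin 3 → ℝ)) (c : Fin 4 → ℝ)
    (x : Fin 3 → ℝ) (hc : ∑ i, c i = 1) (hx : ∀ k, ∑ i, c i * b i k = x k) (i : Fin 4) :
    b.coord i x = c i := by
  have h := b.coord_apply_combination_of_mem (Finset.mem_univ i) hc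
  rw [Finset.affineCombination_eq_linear_combination _ _ _ hc] at h
  rw [← h]
  congr 1
  funext k
  rw [← hx k]
  simp [Finset.sum_apply]

theorem comb_of_coord (b : AffineBasis (Fin 4) ℝ (Fin 3 → ℝ)) (x : Fin 3 → ℝ) (k : Fin 3) :
    ∑ i, b.coord i x * b i k = x k := by
  have := congrFun (b.linear_combination_coord_eq_self x) k
  simpa [Finset.sum_apply] using this

theorem ind_of_affineIndependent (v : Fin 4 → Fin 3 → ℝ) (hv : AffineIndependent ℝ v)
    (c : Fin 4 → ℝ) (hc : ∑ i, c i = 0) (hx : ∀ k, ∑ i, c i * v i k = 0) : c = 0 := by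
  have h := affineIndependent_iff.1 hv Finset.univ c hc (by
    funext k; simpa [Finset.sum_apply] using hx k)
  funext i; exact h i (Finset.mem_univ i)

theorem affineIndependent_of_ind (v : Fin 4 → Fin 3 → ℝ)
    (h : ∀ c : Fin 4 → ℝ, ∑ i, c i = 0 → (∀ k, ∑ i, c i * v i k = 0) → c = 0) :
    AffineIndependent ℝ v := by
  rw [affineIndependent_iff_of_fintype]
  intro w hw hs i
  rw [Finset.weightedVSub_eq_linear_combination _ hw] at hs
  have := h w hw (fun k => by
    have := congrFun hs k
    simpa [Finset.sum_apply] using this)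
  rw [this]; rfl

theorem mem_hull_iff (b : AffineBasis (Fin 4) ℝ (Fin 3 → ℝ)) (x : Fin 3 → ℝ) :
    x ∈ convexHull ℝ (Set.range b) ↔ ∀ i, 0 ≤ b.coord i x := by
  rw [b.convexHull_eq_nonneg_coord]; rfl

theorem mem_interior_iff (b : AffineBasis (Fin 4) ℝ (Fin 3 → ℝ)) (x : Fin 3 → ℝ) :
    x ∈ interior (convexHull ℝ (Set.range b)) ↔ ∀ i, 0 < b.coord i x := by
  rw [b.interior_convexHull]; rfl

theorem vertex_extreme (b : AffineBasis (Fin 4) ℝ (Fin 3 → ℝ)) (i : Fin 4) :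
    b i ∈ Set.extremePoints ℝ (convexHull ℝ (Set.range b)) := by
  rw [mem_extremePoints]
  refine ⟨subset_convexHull ℝ _ ⟨i, rfl⟩, ?_⟩
  intro x hx y hy hxy
  rw [mem_hull_iff] at hx hy
  obtain ⟨s, t, hs, ht, hst, h⟩ := hxy
  have key : ∀ j, s * b.coord j x + t * b.coord j y = b.coord j (b i) := by
    intro j
    rw [← h]
    have := Convex.combo_affine_apply (f := b.coord j) (x := x) (y := y) hst
    rw [this]; simp
  have hz : ∀ j, j ≠ i → b.coord j x = 0 ∧ b.coord j y = 0 := by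
    intro j hj
    have h1 := key j
    rw [b.coord_apply_ne hj] at h1
    have h2 := mul_nonneg hs.le (hx j)
    have h3 := mul_nonneg ht.le (hy j)
    have h4 : s * b.coord j x = 0 := by linarith
    have h5 : t * b.coord j y = 0 := by linarith
    exact ⟨(mul_eq_zero.1 h4).resolve_left hs.ne', (mul_eq_zero.1 h5).resolve_left ht.ne'⟩
  have h1 : ∀ z, (∀ j, j ≠ i → b.coord j z = 0) → z = b i := by
    intro z hzz
    apply b.ext_elem
    intro j
    by_cases hj : j = i
    · subst hj
      have := b.sum_coord_apply_eq_one z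
      rw [Finset.sum_eq_single j (fun k _ hk => hzz k hk) (by simp)] at this
      rw [this, b.coord_apply_eq]
    · rw [hzz j hj, b.coord_apply_ne hj]
  exact ⟨h1 x fun j hj => (hz j hj).1, h1 y fun j hj => (hz j hj).2⟩

/-- replacing the vertex `i` by `m`: a sufficient criterion for interior points -/
theorem interior_replace (b : AffineBasis (Fin 4) ℝ (Fin 3 → ℝ)) (i : Fin 4)
    (m x : Fin 3 → ℝ) (Q : Set (Fin 3 → ℝ)) (hQ : Convex ℝ Q) (hm : m ∈ Q)
    (hb : ∀ j, j ≠ i → b j ∈ Q) (hmi : 0 < b.coord i m) (hxi : 0 < b.coord i x)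
    (hj : ∀ j, j ≠ i → b.coord i x * b.coord j m < b.coord j x * b.coord i m) :
    x ∈ interior Q := by
  rw [mem_interior]
  refine ⟨{y | 0 < b.coord i y ∧ ∀ j, j ≠ i →
    b.coord i y * b.coord j m < b.coord j y * b.coord i m}, ?_, ?_, ⟨hxi, hj⟩⟩
  · rintro y ⟨hy, hyj⟩
    set t := b.coord i y / b.coord i m with ht
    have ht0 : 0 < t := div_pos hy hmi
    have hti : t * b.coord i m = b.coord i y := by rw [ht]; field_simp
    let w : Fin 4 → ℝ := fun j => if j = i then t else b.coord j y - t * b.coord j m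
    let z : Fin 4 → Fin 3 → ℝ := fun j => if j = i then m else b j
    have hw0 : ∀ j, 0 ≤ w j := by
      intro j
      by_cases h : j = i
      · simp [w, h, ht0.le]
      · simp only [w, h, if_false]
        have := hyj j h
        rw [← hti] at this
        have h2 : (t * b.coord j m) * b.coord i m < b.coord j y * b.coord i m := by linarith
        have := lt_of_mul_lt_mul_right h2 hmi.le
        linarith
    have hwe : ∀ j, w j = b.coord j y - t * b.coord j m + (if j = i then t else 0) := by
      intro j
      by_cases h : j = i
      · subst h; simp [w, hti]
      · simp [w, h]
    have hw1 : ∑ j, w j = 1 := by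
      simp only [hwe, Finset.sum_add_distrib, Finset.sum_sub_distrib, ← Finset.mul_sum,
        b.sum_coord_apply_eq_one]
      simp
    have hz : ∀ j, z j ∈ Q := by
      intro j
      by_cases h : j = i
      · simp [z, h, hm]
      · simp [z, h, hb j h]
    have hsum : ∑ j, w j • z j = y := by
      funext k
      have e : ∀ j, w j * z j k = b.coord j y * b j k - t * (b.coord j m * b j k)
          + (if j = i then t * m k else 0) := by
        intro j
        by_cases h : j = i
        · subst h; simp [w, z]; rw [← hti]; ring
        · simp [w, z, h]; ring
      simp only [Finset.sum_apply, Pi.smul_apply, smul_eq_mul, e, Finset.sum_add_distrib,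
        Finset.sum_sub_distrib, ← Finset.mul_sum, comb_of_coord]
      simp
    rw [← hsum]
    exact hQ.sum_mem (fun j _ => hw0 j) hw1 (fun j _ => hz j)
  · have hc : ∀ j, Continuous (b.coord j) := fun j => continuous_barycentric_coord b j
    have : {y | 0 < b.coord i y ∧ ∀ j, j ≠ i →
      b.coord i y * b.coord j m < b.coord j y * b.coord i m} =
      {y | 0 < b.coord i y} ∩ ⋂ j, {y | j ≠ i →
      b.coord i y * b.coord j m < b.coord j y * b.coord i m} := by
      ext y; simp
    rw [this]
    refine (isOpen_lt continuous_const (hc i)).inter (isOpen_iInter_of_finite fun j => ?_)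
    by_cases h : j = i
    · simp [h]
    · simp only [ne_eq, h, not_false_eq_true, forall_true_left]
      exact isOpen_lt ((hc i).mul continuous_const) ((hc j).mul continuous_const)

theorem good_of_minimal (v : Fin 4 → Fin 3 → ℤ)
    (hv : AffineIndependent ℝ (fun i => castPt (v i)))
    (hmin : IsMinimalPolytope (convexHull ℝ (Set.range fun i => castPt (v i))))
    (hn : (intLatPts (convexHull ℝ (Set.range fun i => castPt (v i)))).ncard = 2) :
    ∃ p q, GoodTet v p q := by
  obtain ⟨p, q, hpq, hI⟩ := Set.ncard_eq_two.1 hn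
  set b := mkBasis _ hv with hb
  have hbv : ∀ i, b i = castPt (v i) := fun i => rfl
  have hr : (Set.range fun i => castPt (v i)) = Set.range b := rfl
  rw [hr] at hmin hI
  have rep_coord : ∀ c x, BRep v c x → ∀ i, b.coord i (castPt x) = c i := by
    intro c x h i
    exact coord_of_comb b c _ h.1 h.2 i
  have coord_rep : ∀ x, BRep v (fun i => b.coord i (castPt x)) x := by
    intro x
    exact ⟨b.sum_coord_apply_eq_one _, fun k => comb_of_coord b (castPt x) k⟩
  have hmem : ∀ x, x ∈ ({p, q} : Set (Fin 3 → ℤ)) ↔ ∀ i, 0 < b.coord i (castPt x) := by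
    intro x
    rw [← hI, ← mem_interior_iff]; rfl
  refine ⟨p, q, ⟨fun c h1 h2 => ind_of_affineIndependent _ hv c h1 h2, hpq,
    ⟨_, coord_rep p, (hmem p).1 (by simp)⟩, ⟨_, coord_rep q, (hmem q).1 (by simp)⟩, ?_, ?_⟩⟩
  · intro x c hc h0
    have := (hmem x).2 (fun i => by rw [rep_coord c x hc]; exact h0 i)
    simpa using this
  · intro i m x μ ξ hμ hξ hμ0 hμi ⟨j, hji, hj⟩ hξi hlt
    have hemp := hmin.2 (v i) (vertex_extreme b i)
    have hne : ∀ k, 0 < b.coord j (castPt k) → k ≠ v i := by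
      rintro k hk rfl
      rw [← hbv, b.coord_apply_ne hji] at hk
      exact lt_irrefl _ hk
    have : x ∈ relIntLatPts (convexHull ℝ (castPt '' (latticePts (convexHull ℝ (Set.range b)) \ {v i}))) := by
      apply interior_subset_intrinsicInterior
      apply interior_replace b i (castPt m) (castPt x) _ (convex_convexHull ℝ _)
      · apply subset_convexHull
        refine ⟨m, ⟨?_, ?_⟩, rfl⟩
        · change castPt m ∈ convexHull ℝ (Set.range b)
          rw [mem_hull_iff]; intro k; rw [rep_coord μ m hμ]; exact hμ0 k
        · exact hne m (by rw [rep_coord μ m hμ]; exact hj)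
      · intro k hk
        apply subset_convexHull
        refine ⟨v k, ⟨subset_convexHull ℝ _ ⟨k, rfl⟩, ?_⟩, rfl⟩
        intro h
        exact hk (b.ind.injective (by rw [hbv, hbv, h]))
      · rw [rep_coord μ m hμ]; exact hμi
      · rw [rep_coord ξ x hξ]; exact hξi
      · intro k hk; rw [rep_coord μ m hμ, rep_coord ξ x hξ, rep_coord μ m hμ, rep_coord ξ x hξ]
        exact hlt k hk
    rw [hemp] at this
    exact this

theorem GoodTet.symm {v p q} (h : GoodTet v p q) : GoodTet v q p :=
  ⟨h.ind, h.ne.symm, h.hq, h.hp, fun x c h1 h2 => (h.int x c h1 h2).symm, h.min⟩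

theorem BRep.perm {v c x} (σ : Equiv.Perm (Fin 4)) (h : BRep v c x) :
    BRep (v ∘ σ) (c ∘ σ) x := by
  refine ⟨?_, fun k => ?_⟩
  · rw [← h.1]; exact Equiv.sum_comp σ c
  · rw [← h.2 k]; exact Equiv.sum_comp σ (fun i => c i * (v i k : ℝ))

theorem BRep.unperm {v c x} (σ : Equiv.Perm (Fin 4)) (h : BRep (v ∘ σ) c x) :
    BRep v (c ∘ σ.symm) x := by
  have := h.perm σ.symm
  have e : (v ∘ σ) ∘ σ.symm = v := by funext i; simp
  rwa [e] at this

theorem GoodTet.perm {v p q} (h : GoodTet v p q) (σ : Equiv.Perm (Fin 4)) :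
    GoodTet (v ∘ σ) p q := by
  refine ⟨?_, h.ne, ?_, ?_, ?_, ?_⟩
  · intro c h1 h2
    have := h.ind (c ∘ σ.symm) (by rw [← h1]; exact Equiv.sum_comp σ.symm c) (fun k => by
      rw [← h2 k]
      rw [← Equiv.sum_comp σ.symm (fun i => c i * (((v ∘ σ) i k : ℤ) : ℝ))]
      simp)
    funext i
    have := congrFun this (σ i)
    simpa using this
  · obtain ⟨c, hc, h0⟩ := h.hp
    exact ⟨_, hc.perm σ, fun i => h0 _⟩
  · obtain ⟨c, hc, h0⟩ := h.hq
    exact ⟨_, hc.perm σ, fun i => h0 _⟩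
  · intro x c hc h0
    exact h.int x _ (hc.unperm σ) (fun i => h0 _)
  · intro i m x μ ξ hμ hξ hμ0 hμi ⟨j, hji, hj⟩ hξi hlt
    refine h.min (σ i) m x _ _ (hμ.unperm σ) (hξ.unperm σ) (fun i => hμ0 _) (by simpa using hμi)
      ⟨σ j, by simpa using hji, by simpa using hj⟩ (by simpa using hξi) ?_
    intro k hk
    have := hlt (σ.symm k) (by rintro rfl; simp at hk)
    simpa using this

theorem BRep.unique {v p q x c d} (h : GoodTet v p q) (hc : BRep v c x) (hd : BRep v d x)
    (i : Fin 4) : c i = d i := by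
  have := h.ind (fun i => c i - d i) (by rw [Finset.sum_sub_distrib, hc.1, hd.1, sub_self])
    (fun k => by simp only [sub_mul, Finset.sum_sub_distrib, hc.2 k, hd.2 k, sub_self])
  have := congrFun this i
  simp at this; linarith

theorem GoodTet.pattern {v p q} (h : GoodTet v p q) : ∃ σ : Equiv.Perm (Fin 4),
    ∃ α β : Fin 4 → ℝ, BRep (v ∘ σ) α p ∧ BRep (v ∘ σ) β q ∧ (∀ i, 0 < α i) ∧ (∀ i, 0 < β i) ∧
    ∃ r R : ℝ, r < R ∧ α 0 = r * β 0 ∧ α 1 = r * β 1 ∧ α 2 = R * β 2 ∧ α 3 = R * β 3 := by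
  obtain ⟨α, hα, hα0⟩ := h.hp
  obtain ⟨β, hβ, hβ0⟩ := h.hq
  let ρ : Fin 4 → ℝ := fun i => α i / β i
  have hρ : ∀ i, α i = ρ i * β i := fun i => by simp only [ρ]; field_simp [(hβ0 i).ne']
  have hex : ∀ i : Fin 4, ∃ j, j ≠ i := by decide
  obtain ⟨i, hi⟩ := Finite.exists_min ρ
  obtain ⟨k, hk⟩ := Finite.exists_max ρ
  have hj : ∃ j, j ≠ i ∧ ρ j = ρ i := by
    by_contra hcon
    push Not at hcon
    obtain ⟨j0, hj0⟩ := hex i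
    refine h.min i q p β α hβ hα (fun j => (hβ0 j).le) (hβ0 i) ⟨j0, hj0, hβ0 _⟩ (hα0 i) ?_
    intro j hji
    have h1 : ρ i < ρ j := lt_of_le_of_ne (hi j) (fun e => hcon j hji e.symm)
    rw [hρ i, hρ j]
    have := mul_lt_mul_of_pos_right h1 (mul_pos (hβ0 i) (hβ0 j))
    linarith
  have hl : ∃ l, l ≠ k ∧ ρ l = ρ k := by
    by_contra hcon
    push Not at hcon
    obtain ⟨j0, hj0⟩ := hex k
    refine h.min k p q α β hα hβ (fun j => (hα0 j).le) (hα0 k) ⟨j0, hj0, hα0 _⟩ (hβ0 k) ?_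
    intro j hjk
    have h1 : ρ j < ρ k := lt_of_le_of_ne (hk j) (hcon j hjk)
    rw [hρ k, hρ j]
    have := mul_lt_mul_of_pos_right h1 (mul_pos (hβ0 k) (hβ0 j))
    linarith
  obtain ⟨j, hji, hj⟩ := hj
  obtain ⟨l, hlk, hl⟩ := hl
  have hlt : ρ i < ρ k := by
    rcases lt_or_eq_of_le (hi k) with h1 | h1
    · exact h1
    · exfalso
      have hall : ∀ t, ρ t = ρ i := fun t => le_antisymm ((hk t).trans h1.symm.le) (hi t)
      have hs : ρ i = 1 := by
        have e := hα.1
        simp only [hρ, hall, ← Finset.mul_sum, hβ.1] at e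
        linarith
      apply h.ne
      funext t
      have e1 := hα.2 t
      have e2 := hβ.2 t
      have : ∀ i, α i = β i := fun t => by rw [hρ t, hall t, hs, one_mul]
      simp only [this] at e1
      exact_mod_cast e1.symm.trans e2
  have hinj : Function.Injective (![i, j, k, l] : Fin 4 → Fin 4) := by
    have a1 : i ≠ k := fun e => by rw [e] at hlt; exact lt_irrefl _ hlt
    have a2 : i ≠ l := fun e => by rw [e, hl] at hlt; exact lt_irrefl _ hlt
    have a3 : j ≠ k := fun e => by rw [← hj, e] at hlt; exact lt_irrefl _ hlt
    have a4 : j ≠ l := fun e => by rw [← hj, e, hl] at hlt; exact lt_irrefl _ hlt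
    intro x y hxy
    fin_cases x <;> fin_cases y <;> simp at hxy ⊢ <;> first | exact absurd hxy ‹_› | exact absurd hxy.symm ‹_›
  refine ⟨Equiv.ofBijective _ (Finite.injective_iff_bijective.1 hinj), _, _, hα.perm _, hβ.perm _,
    fun i => hα0 _, fun i => hβ0 _, ρ i, ρ k, hlt, hρ i, ?_, hρ k, ?_⟩
  · have := hρ j; rw [hj] at this; exact this
  · have := hρ l; rw [hl] at this; exact this

theorem triangle_arith (s t : ℝ) (hs : 0 < s) (ht : 0 < t) (hst : s + t < 1)
    (H : ∀ k a b : ℤ, 0 ≤ k * s - a → 0 ≤ k * t - b → (k * s - a) + (k * t - b) < 1 →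
      (k * s - a = 0 ∧ k * t - b = 0) ∨ (k * s - a = s ∧ k * t - b = t)) :
    (s = 1/3 ∧ t = 1/3) ∨ (s = 1/4 ∧ t = 1/4) := by
  have h1 : 1/2 ≤ s + t := by
    by_contra hc
    have := H 2 0 0 (by push_cast; linarith) (by push_cast; linarith) (by push_cast; linarith)
    push_cast at this
    rcases this with h | h <;> linarith [h.1]
  have h2 : s < 1/2 := by
    by_contra hc
    have := H 2 1 0 (by push_cast; linarith) (by push_cast; linarith) (by push_cast; linarith)
    push_cast at this
    rcases this with h | h <;> linarith [h.2]
  have h3 : t < 1/2 := by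
    by_contra hc
    have := H 2 0 1 (by push_cast; linarith) (by push_cast; linarith) (by push_cast; linarith)
    push_cast at this
    rcases this with h | h <;> linarith [h.1]
  rcases lt_or_eq_of_le h1 with h4 | h4
  · have := H (-2) (-1) (-1) (by push_cast; linarith) (by push_cast; linarith) (by push_cast; linarith)
    push_cast at this
    rcases this with h | h
    · linarith [h.1]
    · left; constructor <;> linarith [h.1, h.2]
  · have h5 : s < 1/3 := by
      by_contra hc
      have := H 3 1 0 (by push_cast; linarith) (by push_cast; linarith) (by push_cast; linarith)
      push_cast at this
      rcases this with h | h <;> linarith [h.2]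
    have h6 : t < 1/3 := by
      by_contra hc
      have := H 3 0 1 (by push_cast; linarith) (by push_cast; linarith) (by push_cast; linarith)
      push_cast at this
      rcases this with h | h <;> linarith [h.1]
    have := H (-3) (-1) (-1) (by push_cast; linarith) (by push_cast; linarith) (by push_cast; linarith)
    push_cast at this
    rcases this with h | h
    · linarith [h.1]
    · right; constructor <;> linarith [h.1, h.2]

theorem GoodTet.triangle {v p q α β} (h : GoodTet v p q) (hα : BRep v α p) (hβ : BRep v β q)
    (hα0 : ∀ i, 0 < α i) (hβ0 : ∀ i, 0 < β i) (r R : ℝ) (hrR : r < R)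
    (e0 : α 0 = r * β 0) (e1 : α 1 = r * β 1) (e2 : α 2 = R * β 2) (e3 : α 3 = R * β 3) :
    ∃ c : ℤ, (c = 3 ∨ c = 4) ∧ ∀ k, v 1 k - p k = c * (q k - p k) - (v 0 k - p k) := by
  have hR : 0 < R := by
    have := hα0 2; rw [e2] at this; exact pos_of_mul_pos_left this (hβ0 2).le
  set s := β 0 * (1 - r / R) with hs
  set t := β 1 * (1 - r / R) with ht
  have hfac : 0 < 1 - r / R := by
    rw [sub_pos, div_lt_one hR]; exact hrR
  have hs0 : 0 < s := mul_pos (hβ0 0) hfac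
  have ht0 : 0 < t := mul_pos (hβ0 1) hfac
  have hsα : s = β 0 - α 0 / R := by rw [hs, e0]; ring
  have htα : t = β 1 - α 1 / R := by rw [ht, e1]; ring
  have h2α : β 2 - α 2 / R = 0 := by rw [e2]; field_simp; ring
  have h3α : β 3 - α 3 / R = 0 := by rw [e3]; field_simp; ring
  have sα := hα.1
  have sβ := hβ.1
  rw [Fin.sum_univ_four] at sα sβ
  have hst : s + t = 1 - 1 / R := by
    have : (α 0 + α 1 + α 2 + α 3) / R = 1 / R := by rw [sα]
    rw [hsα, htα]
    have e : (α 0 + α 1 + α 2 + α 3) / R = α 0 / R + α 1 / R + α 2 / R + α 3 / R := by ring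
    linarith
  have hRi : 0 < 1 / R := by positivity
  -- the key vector identity
  have hq : ∀ k, (q k : ℝ) = (1 - s - t) * p k + s * v 0 k + t * v 1 k := by
    intro k
    have e1 := hα.2 k
    have e2 := hβ.2 k
    rw [Fin.sum_univ_four] at e1 e2
    rw [← e1, ← e2]
    have c0 : β 0 = s + α 0 / R := by linarith
    have c1 : β 1 = t + α 1 / R := by linarith
    have c2 : β 2 = α 2 / R := by linarith
    have c3 : β 3 = α 3 / R := by linarith
    have c4 : 1 - s - t = 1 / R := by linarith
    rw [c0, c1, c2, c3, c4]; ring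
  have H : ∀ k a b : ℤ, 0 ≤ k * s - a → 0 ≤ k * t - b → (k * s - a) + (k * t - b) < 1 →
      (k * s - a = 0 ∧ k * t - b = 0) ∨ (k * s - a = s ∧ k * t - b = t) := by
    intro k a b ha hb hab
    set A := k * s - a with hA
    set B := k * t - b with hB
    let x : Fin 3 → ℤ := fun j => p j + k * (q j - p j) - a * (v 0 j - p j) - b * (v 1 j - p j)
    let ξ : Fin 4 → ℝ := ![(1 - A - B) * α 0 + A, (1 - A - B) * α 1 + B,
      (1 - A - B) * α 2, (1 - A - B) * α 3]
    have hpos : 0 < 1 - A - B := by linarith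
    have hx : BRep v ξ x := by
      constructor
      · rw [Fin.sum_univ_four]; simp [ξ]; linear_combination (1 - A - B) * sα
      · intro j
        have e1 := hα.2 j
        rw [Fin.sum_univ_four] at e1 ⊢
        simp only [ξ, x, Matrix.cons_val]
        push_cast
        rw [hq j]
        linear_combination (1 - A - B) * e1
    have hξ0 : ∀ i, 0 < ξ i := by
      intro i
      fin_cases i <;> simp [ξ]
      · have := mul_pos hpos (hα0 0); linarith
      · have := mul_pos hpos (hα0 1); linarith
      · exact mul_pos hpos (hα0 2)
      · exact mul_pos hpos (hα0 3)
    rcases h.int x ξ hx hξ0 with hxp | hxq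
    · left
      rw [hxp] at hx
      have := hx.unique h hα 2
      simp [ξ] at this
      have : (A + B) * α 2 = 0 := by linarith
      have := (mul_eq_zero.1 this).resolve_right (hα0 2).ne'
      constructor <;> linarith
    · right
      rw [hxq] at hx
      have u2 := hx.unique h hβ 2
      have u0 := hx.unique h hβ 0
      have u1 := hx.unique h hβ 1
      simp only [ξ, Matrix.cons_val] at u0 u1 u2
      have c2 : β 2 = 1 / R * α 2 := by linarith [show α 2 / R = 1 / R * α 2 by ring]
      rw [c2] at u2
      have u3 := mul_right_cancel₀ (hα0 2).ne' u2
      rw [u3] at u0 u1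
      constructor
      · rw [hsα]; linarith [show α 0 / R = 1 / R * α 0 by ring]
      · rw [htα]; linarith [show α 1 / R = 1 / R * α 1 by ring]
  rcases triangle_arith s t hs0 ht0 (by linarith) H with ⟨a, b⟩ | ⟨a, b⟩
  · refine ⟨3, Or.inl rfl, fun k => ?_⟩
    have := hq k
    rw [a, b] at this
    have : (v 1 k - p k : ℝ) = 3 * (q k - p k) - (v 0 k - p k) := by linarith
    exact_mod_cast this
  · refine ⟨4, Or.inr rfl, fun k => ?_⟩
    have := hq k
    rw [a, b] at this
    have : (v 1 k - p k : ℝ) = 4 * (q k - p k) - (v 0 k - p k) := by linarith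
    exact_mod_cast this

theorem GoodTet.relations {v p q} (h : GoodTet v p q) : ∃ σ : Equiv.Perm (Fin 4),
    ∃ c c' : ℤ, (c = 3 ∨ c = 4) ∧ (c' = 1 ∨ c' = 2) ∧
    (∀ k, v (σ 1) k - p k = c * (q k - p k) - (v (σ 0) k - p k)) ∧
    (∀ k, v (σ 3) k - p k = -c' * (q k - p k) - (v (σ 2) k - p k)) := by
  obtain ⟨σ, α, β, hα, hβ, hα0, hβ0, r, R, hrR, e0, e1, e2, e3⟩ := h.pattern
  obtain ⟨c, hc, hc1⟩ := (h.perm σ).triangle hα hβ hα0 hβ0 r R hrR e0 e1 e2 e3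
  have hr : 0 < r := by
    have := hα0 0; rw [e0] at this; exact pos_of_mul_pos_left this (hβ0 0).le
  have hR : 0 < R := hr.trans hrR
  let τ : Equiv.Perm (Fin 4) := Equiv.addRight 2
  obtain ⟨d, hd, hd1⟩ := ((h.perm σ).perm τ).symm.triangle (hβ.perm τ) (hα.perm τ)
    (fun i => hβ0 _) (fun i => hα0 _) R⁻¹ r⁻¹ (inv_strictAnti₀ hr hrR)
    (by change β 2 = _ * α 2; rw [e2]; field_simp) (by change β 3 = _ * α 3; rw [e3]; field_simp)
    (by change β 0 = _ * α 0; rw [e0]; field_simp) (by change β 1 = _ * α 1; rw [e1]; field_simp)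
  refine ⟨σ, c, d - 2, hc, ?_, hc1, ?_⟩
  · omega
  · intro k
    have := hd1 k
    change v (σ 3) k - q k = d * (p k - q k) - (v (σ 2) k - q k) at this
    linarith

theorem comb_map (A : Matrix (Fin 3) (Fin 3) ℤ) (b : Fin 3 → ℤ) (v : Fin 4 → Fin 3 → ℤ)
    (c : Fin 4 → ℝ) (k : Fin 3) :
    ∑ i, c i * (((A.mulVec (v i) + b) k : ℤ) : ℝ) =
      ∑ l, (A k l : ℝ) * ∑ i, c i * (v i l : ℝ) + (∑ i, c i) * (b k : ℝ) := by
  simp only [Matrix.mulVec, dotProduct, Pi.add_apply, Fin.sum_univ_three, Fin.sum_univ_four]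
  push_cast
  ring

theorem BRep.map {v c x} (A : Matrix (Fin 3) (Fin 3) ℤ) (b : Fin 3 → ℤ) (h : BRep v c x) :
    BRep (fun i => A.mulVec (v i) + b) c (A.mulVec x + b) := by
  refine ⟨h.1, fun k => ?_⟩
  rw [comb_map, h.1]
  simp only [h.2]
  simp [Matrix.mulVec, dotProduct]

theorem unmap_pt (A : Matrix (Fin 3) (Fin 3) ℤ) (hA : IsUnit A.det) (b x : Fin 3 → ℤ) :
    A⁻¹.mulVec (A.mulVec x + b) + (- A⁻¹.mulVec b) = x := by
  rw [Matrix.mulVec_add, Matrix.mulVec_mulVec, Matrix.nonsing_inv_mul _ hA, Matrix.one_mulVec]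
  abel

theorem map_unmap_pt (A : Matrix (Fin 3) (Fin 3) ℤ) (hA : IsUnit A.det) (b x : Fin 3 → ℤ) :
    A.mulVec (A⁻¹.mulVec x + (- A⁻¹.mulVec b)) + b = x := by
  rw [Matrix.mulVec_add, Matrix.mulVec_neg, Matrix.mulVec_mulVec, Matrix.mulVec_mulVec,
    Matrix.mul_nonsing_inv _ hA, Matrix.one_mulVec, Matrix.one_mulVec]
  abel

theorem BRep.unmap {v c x} (A : Matrix (Fin 3) (Fin 3) ℤ) (hA : IsUnit A.det) (b : Fin 3 → ℤ)
    (h : BRep (fun i => A.mulVec (v i) + b) c x) :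
    BRep v c (A⁻¹.mulVec x + (- A⁻¹.mulVec b)) := by
  have := h.map A⁻¹ (- A⁻¹.mulVec b)
  simpa only [unmap_pt A hA] using this

theorem GoodTet.map {v p q} (h : GoodTet v p q) (A : Matrix (Fin 3) (Fin 3) ℤ)
    (hA : IsUnit A.det) (b : Fin 3 → ℤ) :
    GoodTet (fun i => A.mulVec (v i) + b) (A.mulVec p + b) (A.mulVec q + b) := by
  refine ⟨?_, ?_, ?_, ?_, ?_, ?_⟩
  · intro c h1 h2
    apply h.ind c h1
    intro k
    have e := comb_map A⁻¹ (- A⁻¹.mulVec b) (fun i => A.mulVec (v i) + b) c k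
    simp only [unmap_pt A hA] at e
    rw [e]
    simp only [h2, h1]
    simp
  · intro e
    apply h.ne
    rw [← unmap_pt A hA b p, e, unmap_pt A hA b q]
  · obtain ⟨c, hc, h0⟩ := h.hp
    exact ⟨c, hc.map A b, h0⟩
  · obtain ⟨c, hc, h0⟩ := h.hq
    exact ⟨c, hc.map A b, h0⟩
  · intro x c hc h0
    rcases h.int _ c (hc.unmap A hA) h0 with e | e
    · left; rw [← e, map_unmap_pt A hA]
    · right; rw [← e, map_unmap_pt A hA]
  · intro i m x μ ξ hμ hξ
    exact h.min i _ _ μ ξ (hμ.unmap A hA) (hξ.unmap A hA)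

/-- left multiplication by unimodular matrices -/
def Reach (M N : Matrix (Fin 3) (Fin 3) ℤ) : Prop := ∃ A : Matrix (Fin 3) (Fin 3) ℤ,
  IsUnit A.det ∧ A * M = N

theorem Reach.trans {M N K} (h1 : Reach M N) (h2 : Reach N K) : Reach M K := by
  obtain ⟨A, hA, e1⟩ := h1
  obtain ⟨B, hB, e2⟩ := h2
  exact ⟨B * A, by rw [Matrix.det_mul]; exact hB.mul hA, by rw [Matrix.mul_assoc, e1, e2]⟩

theorem gcd_block (x y : ℤ) : ∃ r s t w : ℤ, r * w - s * t = 1 ∧ t * x + w * y = 0 ∧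
    0 ≤ r * x + s * y := by
  by_cases hg : Int.gcd x y = 0
  · rw [Int.gcd_eq_zero_iff] at hg
    exact ⟨1, 0, 0, 1, by ring, by simp [hg.1, hg.2], by simp [hg.1, hg.2]⟩
  · have hb := Int.gcd_eq_gcd_ab x y
    obtain ⟨x', hx⟩ := Int.gcd_dvd_left x y
    obtain ⟨y', hy⟩ := Int.gcd_dvd_right x y
    have hg' : (Int.gcd x y : ℤ) ≠ 0 := by exact_mod_cast hg
    refine ⟨Int.gcdA x y, Int.gcdB x y, -y', x', ?_, ?_, ?_⟩
    · apply mul_left_cancel₀ hg'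
      linear_combination (-1 : ℤ) * hb - Int.gcdA x y * hx - Int.gcdB x y * hy
    · linear_combination (-y') * hx + x' * hy
    · rw [mul_comm _ x, mul_comm _ y, ← hb]; positivity

theorem reach_block12 (M : Matrix (Fin 3) (Fin 3) ℤ) (r s t w : ℤ) (h : r * w - s * t = 1) :
    Reach M !![M 0 0, M 0 1, M 0 2;
      r * M 1 0 + s * M 2 0, r * M 1 1 + s * M 2 1, r * M 1 2 + s * M 2 2;
      t * M 1 0 + w * M 2 0, t * M 1 1 + w * M 2 1, t * M 1 2 + w * M 2 2] := by
  refine ⟨!![1, 0, 0; 0, r, s; 0, t, w], ?_, ?_⟩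
  · rw [Matrix.det_fin_three]; simp [h]
  · ext i j
    fin_cases i <;> fin_cases j <;> simp [Matrix.mul_apply, Fin.sum_univ_three]

theorem reach_block01 (M : Matrix (Fin 3) (Fin 3) ℤ) (r s t w : ℤ) (h : r * w - s * t = 1) :
    Reach M !![r * M 0 0 + s * M 1 0, r * M 0 1 + s * M 1 1, r * M 0 2 + s * M 1 2;
      t * M 0 0 + w * M 1 0, t * M 0 1 + w * M 1 1, t * M 0 2 + w * M 1 2;
      M 2 0, M 2 1, M 2 2] := by
  refine ⟨!![r, s, 0; t, w, 0; 0, 0, 1], ?_, ?_⟩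
  · rw [Matrix.det_fin_three]; simp [h]
  · ext i j
    fin_cases i <;> fin_cases j <;> simp [Matrix.mul_apply, Fin.sum_univ_three]

theorem reach_upper (d1 n d2 a b D ε k l m : ℤ) (hε : ε * ε = 1) :
    Reach !![d1, n, a; 0, d2, b; 0, 0, D]
      !![d1, n + k * d2, a + k * b + l * D; 0, d2, b + m * D; 0, 0, ε * D] := by
  refine ⟨!![1, k, l; 0, 1, m; 0, 0, ε], ?_, ?_⟩
  · rw [Matrix.det_fin_three]; simp; exact IsUnit.of_mul_eq_one ε hε
  · ext i j
    fin_cases i <;> fin_cases j <;> simp [Matrix.mul_apply, Fin.sum_univ_three]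

theorem hnf (M : Matrix (Fin 3) (Fin 3) ℤ) (hM : M.det ≠ 0) :
    ∃ d1 n d2 a b D : ℤ, Reach M !![d1, n, a; 0, d2, b; 0, 0, D] ∧ 0 < d1 ∧ 0 < d2 ∧ 0 < D ∧
      0 ≤ n ∧ n < d2 ∧ 0 ≤ a ∧ a < D ∧ 0 ≤ b ∧ b < D := by
  obtain ⟨r, s, t, w, h1, h2, -⟩ := gcd_block (M 1 0) (M 2 0)
  have R1 := reach_block12 M r s t w h1
  rw [h2] at R1
  generalize t * M 1 1 + w * M 2 1 = z1 at R1
  generalize t * M 1 2 + w * M 2 2 = z2 at R1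
  generalize r * M 1 0 + s * M 2 0 = y0 at R1
  generalize r * M 1 1 + s * M 2 1 = y1 at R1
  generalize r * M 1 2 + s * M 2 2 = y2 at R1
  obtain ⟨r, s, t, w, h1, h2, h3⟩ := gcd_block (M 0 0) y0
  have R2 := R1.trans (reach_block01 _ r s t w h1)
  simp only [Matrix.of_apply, Matrix.cons_val] at R2
  rw [h2] at R2
  generalize r * M 0 0 + s * y0 = d1 at R2 h3
  generalize r * M 0 1 + s * y1 = n at R2
  generalize r * M 0 2 + s * y2 = a at R2
  generalize t * M 0 1 + w * y1 = y1 at R2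
  generalize t * M 0 2 + w * y2 = y2 at R2
  obtain ⟨r, s, t, w, h1, h2, h4⟩ := gcd_block y1 z1
  have R3 := R2.trans (reach_block12 _ r s t w h1)
  simp only [Matrix.of_apply, Matrix.cons_val] at R3
  rw [h2] at R3
  generalize r * y1 + s * z1 = d2 at R3 h4
  generalize r * y2 + s * z2 = b at R3
  generalize t * y2 + w * z2 = D at R3
  simp only [mul_zero, add_zero] at R3
  have hdet : d1 * d2 * D ≠ 0 := by
    obtain ⟨A, hA, e⟩ := R3
    have := congrArg Matrix.det e
    rw [Matrix.det_mul] at this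
    rw [Matrix.det_fin_three !![d1, n, a; 0, d2, b; 0, 0, D]] at this
    simp at this
    rw [← this]
    exact mul_ne_zero hA.ne_zero hM
  have hd1 : 0 < d1 := lt_of_le_of_ne h3 (by rintro rfl; simp at hdet)
  have hd2 : 0 < d2 := lt_of_le_of_ne h4 (by rintro rfl; simp at hdet)
  have hD : D ≠ 0 := by rintro rfl; simp at hdet
  obtain ⟨ε, hε, hεD⟩ : ∃ ε : ℤ, ε * ε = 1 ∧ 0 < ε * D := by
    rcases lt_or_gt_of_ne hD with h | h
    · exact ⟨-1, by ring, by linarith⟩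
    · exact ⟨1, by ring, by linarith⟩
  have R4 := R3.trans (reach_upper d1 n d2 a b D ε (-(n / d2)) 0 0 hε)
  have R5 := R4.trans (reach_upper d1 _ d2 _ _ _ 1 0
    (-((a + -(n / d2) * b + 0 * D) / (ε * D))) (-((b + 0 * D) / (ε * D))) (by ring))
  refine ⟨_, _, _, _, _, _, R5, hd1, hd2, by linarith, ?_, ?_, ?_, ?_, ?_, ?_⟩
  · have := Int.emod_nonneg n hd2.ne'
    rw [Int.emod_def] at this; linarith
  · have := Int.emod_lt_of_pos n hd2
    rw [Int.emod_def] at this; linarith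
  · have := Int.emod_nonneg (a + -(n / d2) * b + 0 * D) hεD.ne'
    rw [Int.emod_def] at this; linarith
  · have := Int.emod_lt_of_pos (a + -(n / d2) * b + 0 * D) hεD
    rw [Int.emod_def] at this; linarith
  · have := Int.emod_nonneg (b + 0 * D) hεD.ne'
    rw [Int.emod_def] at this; linarith
  · have := Int.emod_lt_of_pos (b + 0 * D) hεD
    rw [Int.emod_def] at this; linarith

/-- the normal form of the vertices -/
def nf (c c' D a b : ℤ) : Fin 4 → Fin 3 → ℤ :=
  ![![0, 1, 0], ![c, -1, 0], ![a, b, D], ![-c' - a, -b, -D]]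

theorem GoodTet.normal {v p q} (h : GoodTet v p q) : ∃ σ : Equiv.Perm (Fin 4),
    ∃ (A : Matrix (Fin 3) (Fin 3) ℤ) (t : Fin 3 → ℤ), IsUnit A.det ∧
    ∃ c c' D a b : ℤ, (c = 3 ∨ c = 4) ∧ (c' = 1 ∨ c' = 2) ∧ 0 < D ∧ 0 ≤ a ∧ a < D ∧ 0 ≤ b ∧ b < D ∧
      (∀ i, A.mulVec (v (σ i)) + t = nf c c' D a b i) ∧
      GoodTet (nf c c' D a b) ![0, 0, 0] ![1, 0, 0] := by
  obtain ⟨σ, c, c', hc, hc', h1, h3⟩ := h.relations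
  have hcp : 0 < c := by omega
  have hcp' : 0 < c' := by omega
  let M : Matrix (Fin 3) (Fin 3) ℤ := Matrix.of fun k j =>
    ![q k - p k, v (σ 0) k - p k, v (σ 2) k - p k] j
  have hM : M.det ≠ 0 := by
    intro h0
    obtain ⟨x, hx, hx0⟩ := Matrix.exists_mulVec_eq_zero_iff.2 h0
    apply hx
    have hk : ∀ k, (q k - p k) * x 0 + (v (σ 0) k - p k) * x 1 + (v (σ 2) k - p k) * x 2 = 0 := by
      intro k
      have := congrFun hx0 k
      simpa [M, Matrix.mulVec, dotProduct, Fin.sum_univ_three] using this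
    have := (h.perm σ).ind ![2 * x 0 - c' * (x 1 + x 2) + 2 * (c + c') * x 1,
      2 * x 0 - c' * (x 1 + x 2), - 2 * x 0 - c * (x 1 + x 2) + 2 * (c + c') * x 2,
      - 2 * x 0 - c * (x 1 + x 2)] (by
        rw [Fin.sum_univ_four]; simp only [Matrix.cons_val]; ring) (by
        intro k
        have a1 : (v (σ 1) k : ℝ) - p k = c * (q k - p k) - (v (σ 0) k - p k) := by
          exact_mod_cast h1 k
        have a3 : (v (σ 3) k : ℝ) - p k = -c' * (q k - p k) - (v (σ 2) k - p k) := by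
          exact_mod_cast h3 k
        have ak : ((q k : ℝ) - p k) * x 0 + (v (σ 0) k - p k) * x 1 + (v (σ 2) k - p k) * x 2 = 0 := by
          exact_mod_cast hk k
        rw [Fin.sum_univ_four]; simp only [Matrix.cons_val, Function.comp]
        linear_combination (2 * x 0 - c' * (x 1 + x 2)) * a1 + (-2 * x 0 - c * (x 1 + x 2)) * a3 +
          2 * (c + c') * ak)
    have e0 := congrFun this 0
    have e1 := congrFun this 1
    have e2 := congrFun this 2
    have e3 := congrFun this 3
    simp only [Matrix.cons_val, Pi.zero_apply] at e0 e1 e2 e3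
    norm_cast at e0 e1 e2 e3
    have hs : (c + c') * (x 1 + x 2) = 0 := by push_cast at *; linarith
    have hs2 := (mul_eq_zero.1 hs).resolve_left (by omega)
    rw [hs2] at e0 e1 e2 e3
    have x0 : x 0 = 0 := by linarith
    have hs3 : (c + c') * x 1 = 0 := by linarith
    have x1 := (mul_eq_zero.1 hs3).resolve_left (by omega)
    have x2 : x 2 = 0 := by linarith
    funext i
    fin_cases i <;> simp [x0, x1, x2]
  obtain ⟨d1, n, d2, a, b, D, ⟨A, hA, hAM⟩, hd1, hd2, hD, hn0, hn1, ha0, ha1, hb0, hb1⟩ := hnf M hM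
  have hcol : ∀ k j, ∑ l, A k l * M l j = !![d1, n, a; 0, d2, b; 0, 0, D] k j := by
    intro k j; rw [← hAM, Matrix.mul_apply]
  have hG := (h.perm σ).map A hA (- A.mulVec p)
  -- images
  have im : ∀ x : Fin 3 → ℤ, ∀ k, (A.mulVec x + - A.mulVec p) k = ∑ l, A k l * (x l - p l) := by
    intro x k
    simp only [Matrix.mulVec, dotProduct, Pi.add_apply, Pi.neg_apply, Fin.sum_univ_three]; ring
  have iq : ∀ k, ∑ l, A k l * (q l - p l) = ![d1, 0, 0] k := by
    intro k; have := hcol k 0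
    simp only [M, Matrix.of_apply, Matrix.cons_val] at this; rw [this]
    fin_cases k <;> simp
  have i0 : ∀ k, ∑ l, A k l * (v (σ 0) l - p l) = ![n, d2, 0] k := by
    intro k; have := hcol k 1
    simp only [M, Matrix.of_apply, Matrix.cons_val] at this; rw [this]
    fin_cases k <;> simp
  have i2 : ∀ k, ∑ l, A k l * (v (σ 2) l - p l) = ![a, b, D] k := by
    intro k; have := hcol k 2
    simp only [M, Matrix.of_apply, Matrix.cons_val] at this; rw [this]
    fin_cases k <;> simp
  have i1 : ∀ k, ∑ l, A k l * (v (σ 1) l - p l) = c * ![d1, 0, 0] k - ![n, d2, 0] k := by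
    intro k; rw [← iq, ← i0]; simp only [h1, Fin.sum_univ_three]; ring
  have i3 : ∀ k, ∑ l, A k l * (v (σ 3) l - p l) = -c' * ![d1, 0, 0] k - ![a, b, D] k := by
    intro k; rw [← iq, ← i2]; simp only [h3, Fin.sum_univ_three]; ring
  have hV : (fun i => A.mulVec ((v ∘ σ) i) + - A.mulVec p) =
      ![![n, d2, 0], ![c * d1 - n, - d2, 0], ![a, b, D], ![- c' * d1 - a, -b, -D]] := by
    funext i k
    rw [im]
    fin_cases i
    · exact i0 k
    · change ∑ l, A k l * (v (σ 1) l - p l) = _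
      rw [i1 k]; fin_cases k <;> simp
    · exact i2 k
    · change ∑ l, A k l * (v (σ 3) l - p l) = _
      rw [i3 k]; fin_cases k <;> simp
  have hP : A.mulVec p + - A.mulVec p = ![0, 0, 0] := by
    funext k; fin_cases k <;> simp
  have hQ : A.mulVec q + - A.mulVec p = ![d1, 0, 0] := by
    funext k; rw [im, iq]
  have hVi := fun i => congrFun hV i
  rw [hV, hP, hQ] at hG
  obtain ⟨α, hα, hα0⟩ := hG.hp
  obtain ⟨β, hβ, hβ0⟩ := hG.hq
  have hd1' : d1 = 1 := by
    by_contra hne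
    have hd : 2 ≤ d1 := by omega
    have hdr : (2 : ℝ) ≤ d1 := by exact_mod_cast hd
    have : BRep ![![n, d2, 0], ![c * d1 - n, - d2, 0], ![a, b, D], ![- c' * d1 - a, -b, -D]]
        (fun i => (1 / d1) * β i + (1 - 1 / d1) * α i) ![1, 0, 0] := by
      constructor
      · simp only [Finset.sum_add_distrib, ← Finset.mul_sum, hα.1, hβ.1]; ring
      · intro k
        simp only [add_mul, mul_assoc, Finset.sum_add_distrib, ← Finset.mul_sum, hα.2 k, hβ.2 k]
        fin_cases k <;> simp
        have : (d1 : ℝ) ≠ 0 := by linarith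
        field_simp
    have := hG.int _ _ this (fun i => by
      have h1 : (0:ℝ) < 1 / d1 := by positivity
      have h2 : (1:ℝ) / d1 < 1 := by rw [div_lt_one] <;> linarith
      have := mul_pos h1 (hβ0 i)
      have := mul_pos (sub_pos.2 h2) (hα0 i)
      linarith)
    rcases this with e | e
    · simpa using congrFun e 0
    · have := congrFun e 0; simp at this; omega
  subst hd1'
  have hd2' : d2 = 1 := by
    by_contra hne
    have hd : 2 ≤ d2 := by omega
    have hdr : (2 : ℝ) ≤ d2 := by exact_mod_cast hd
    have hcr : (3 : ℝ) ≤ c := by rcases hc with rfl | rfl <;> norm_num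
    have hc0 : (c : ℝ) ≠ 0 := by linarith
    have hd0 : (d2 : ℝ) ≠ 0 := by linarith
    have hnr : (n : ℝ) ≤ d2 := by exact_mod_cast hn1.le
    obtain ⟨κ, hκ1, hκ2⟩ : ∃ κ : ℤ, n ≤ κ * d2 ∧ 2 * (κ * d2 - n) < c * (d2 - 1) := by
      by_cases hn : n = 0
      · refine ⟨0, by omega, ?_⟩
        rw [hn]; have : 0 < c * (d2 - 1) := mul_pos hcp (by omega)
        linarith
      · refine ⟨1, by omega, ?_⟩
        have : 3 * (d2 - 1) ≤ c * (d2 - 1) := mul_le_mul_of_nonneg_right (by omega) (by omega)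
        omega
    have hκ1r : (n : ℝ) ≤ κ * d2 := by exact_mod_cast hκ1
    have hκ2r : 2 * ((κ : ℝ) * d2 - n) < c * (d2 - 1) := by exact_mod_cast hκ2
    set c1 : ℝ := (κ * d2 - n) / (c * d2) with hc1
    set c0 : ℝ := c1 + 1 / d2 with hc0'
    have hcd : 0 < (c : ℝ) * d2 := by positivity
    have p1 : 0 ≤ c1 := div_nonneg (by linarith) hcd.le
    have p0 : 0 ≤ c0 := by positivity
    have ps : 0 < 1 - c0 - c1 := by
      have e : 1 - c0 - c1 = (c * (d2 - 1) - 2 * (κ * d2 - n)) / (c * d2) := by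
        rw [hc0', hc1]; field_simp; ring
      rw [e]; exact div_pos (by linarith) hcd
    have sα := hα.1
    rw [Fin.sum_univ_four] at sα
    have : BRep ![![n, d2, 0], ![c * 1 - n, - d2, 0], ![a, b, D], ![- c' * 1 - a, -b, -D]]
        ![(1 - c0 - c1) * α 0 + c0, (1 - c0 - c1) * α 1 + c1, (1 - c0 - c1) * α 2,
          (1 - c0 - c1) * α 3] ![κ, 1, 0] := by
      constructor
      · rw [Fin.sum_univ_four]; simp only [Matrix.cons_val]
        linear_combination (1 - c0 - c1) * sα
      · intro k
        have hk := hα.2 k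
        rw [Fin.sum_univ_four] at hk ⊢
        have e1 : c1 * (c * d2) = κ * d2 - n := by rw [hc1]; field_simp
        have e2 : (c0 - c1) * d2 = 1 := by rw [hc0']; field_simp; ring
        fin_cases k <;> simp only [Matrix.cons_val, Fin.zero_eta, Fin.mk_one, Fin.reduceFinMk] at hk ⊢ <;>
          push_cast at hk ⊢
        · have e3 : c0 * n + c1 * (c - n) = κ := by
            apply mul_right_cancel₀ hd0
            linear_combination e1 + (n:ℝ) * e2
          linear_combination (1 - c0 - c1) * hk + e3
        · linear_combination (1 - c0 - c1) * hk + e2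
        · linear_combination (1 - c0 - c1) * hk
    have := hG.int _ _ this (fun i => by
      have := mul_pos ps (hα0 i)
      fin_cases i <;> simp only [Matrix.cons_val, Fin.zero_eta, Fin.mk_one, Fin.reduceFinMk] at this ⊢ <;>
        linarith)
    rcases this with e | e
    · simpa using congrFun e 1
    · simpa using congrFun e 1
  subst hd2'
  have hn : n = 0 := by omega
  subst hn
  refine ⟨σ, A, - A.mulVec p, hA, c, c', D, a, b, hc, hc', hD, ha0, ha1, hb0, hb1, ?_, ?_⟩
  · intro i
    have := hVi i
    simp only [Function.comp] at this
    rw [this]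
    simp [nf]
  · have e : nf c c' D a b = ![![0, 1, 0], ![c * 1 - 0, - 1, 0], ![a, b, D],
      ![- c' * 1 - a, -b, -D]] := by simp [nf]
    rw [e]; exact hG

/-- numerators of the barycentric coordinates of `(x, y, z)` with respect to `nf c c' D a b`;
the common denominator is `2 * D * (c + c')` -/
def num (c c' D a b x y z : ℤ) : Fin 4 → ℤ :=
  ![(2 * x * D - 2 * a * z + c * (y * D - b * z) + c' * (D - z)) + (y * D - b * z) * (c + c'),
    (2 * x * D - 2 * a * z + c * (y * D - b * z) + c' * (D - z)) - (y * D - b * z) * (c + c'),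
    D * (c + c') - (2 * x * D - 2 * a * z + c * (y * D - b * z) + c' * (D - z)) + z * (c + c'),
    D * (c + c') - (2 * x * D - 2 * a * z + c * (y * D - b * z) + c' * (D - z)) - z * (c + c')]

theorem num_rep (c c' D a b x y z : ℤ) (hc : 0 < c + c') (hD : 0 < D) :
    BRep (nf c c' D a b) (fun i => (num c c' D a b x y z i : ℝ) / (2 * D * (c + c'))) ![x, y, z] := by
  have h1 : (c : ℝ) + c' ≠ 0 := by
    have : (0 : ℝ) < c + c' := by exact_mod_cast hc
    exact this.ne'
  have h2 : (D : ℝ) ≠ 0 := by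
    have : (0 : ℝ) < D := by exact_mod_cast hD
    exact this.ne'
  constructor
  · rw [Fin.sum_univ_four]
    simp only [num, Matrix.cons_val]
    push_cast
    field_simp
    ring
  · intro k
    rw [Fin.sum_univ_four]
    fin_cases k <;> simp only [num, nf, Matrix.cons_val, Fin.zero_eta, Fin.mk_one, Fin.reduceFinMk]
      <;> push_cast <;> field_simp <;> ring

theorem GoodTet.nf_int {c c' D a b : ℤ} (h : GoodTet (nf c c' D a b) ![0, 0, 0] ![1, 0, 0])
    (hc : 0 < c + c') (hD : 0 < D) (x y z : ℤ) (hpos : ∀ i, 0 < num c c' D a b x y z i) :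
    y = 0 ∧ z = 0 := by
  have h1 : (0 : ℝ) < c + c' := by exact_mod_cast hc
  have h2 : (0 : ℝ) < D := by exact_mod_cast hD
  have := h.int _ _ (num_rep c c' D a b x y z hc hD) (fun i => by
    have : (0 : ℝ) < num c c' D a b x y z i := by exact_mod_cast hpos i
    positivity)
  rcases this with e | e
  · exact ⟨by simpa using congrFun e 1, by simpa using congrFun e 2⟩
  · exact ⟨by simpa using congrFun e 1, by simpa using congrFun e 2⟩

theorem GoodTet.nf_min {c c' D a b : ℤ} (h : GoodTet (nf c c' D a b) ![0, 0, 0] ![1, 0, 0])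
    (hc : 0 < c + c') (hD : 0 < D) (i : Fin 4) (x y z : ℤ)
    (h0 : ∀ j, 0 ≤ num c c' D a b x y z j) (hi : 0 < num c c' D a b x y z i)
    (hj : ∃ j, j ≠ i ∧ 0 < num c c' D a b x y z j)
    (hxi : 0 < num c c' D a b 1 0 0 i)
    (hlt : ∀ j, j ≠ i → num c c' D a b 1 0 0 i * num c c' D a b x y z j <
      num c c' D a b 1 0 0 j * num c c' D a b x y z i) : False := by
  have h1 : (0 : ℝ) < c + c' := by exact_mod_cast hc
  have h2 : (0 : ℝ) < D := by exact_mod_cast hD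
  have hden : (0 : ℝ) < 2 * D * (c + c') := by positivity
  refine h.min i _ _ _ _ (num_rep c c' D a b x y z hc hD) (num_rep c c' D a b 1 0 0 hc hD)
    ?_ ?_ ?_ ?_ ?_
  · intro j
    have : (0 : ℝ) ≤ num c c' D a b x y z j := by exact_mod_cast h0 j
    positivity
  · have : (0 : ℝ) < num c c' D a b x y z i := by exact_mod_cast hi
    positivity
  · obtain ⟨j, hji, hj⟩ := hj
    have : (0 : ℝ) < num c c' D a b x y z j := by exact_mod_cast hj
    exact ⟨j, hji, by positivity⟩
  · have : (0 : ℝ) < num c c' D a b 1 0 0 i := by exact_mod_cast hxi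
    positivity
  · intro j hji
    have : (num c c' D a b 1 0 0 i : ℝ) * num c c' D a b x y z j <
      num c c' D a b 1 0 0 j * num c c' D a b x y z i := by exact_mod_cast hlt j hji
    rw [div_mul_div_comm, div_mul_div_comm]
    gcongr

theorem exists_mult (D lo : ℤ) (hD : 0 < D) : ∃ x : ℤ, lo < 2 * x * D ∧ 2 * x * D ≤ lo + 2 * D := by
  refine ⟨lo / (2 * D) + 1, ?_, ?_⟩
  · have := Int.lt_ediv_add_one_mul_self lo (show 0 < 2 * D by omega)
    linarith
  · have := Int.ediv_mul_le lo (show (2 * D) ≠ 0 by omega)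
    linarith

theorem GoodTet.nf_bound {c c' D a b : ℤ} (h : GoodTet (nf c c' D a b) ![0, 0, 0] ![1, 0, 0])
    (hc : c = 3 ∨ c = 4) (hc' : c' = 1 ∨ c' = 2) (hD : 0 < D)
    (hb0 : 0 ≤ b) (hb1 : b < D) : D ≤ 12 := by
  by_contra hcon
  have hs : 4 ≤ c + c' := by omega
  -- it is enough to find a good pair `(y, z)`
  have key : ∀ y z G : ℤ, 0 < z → y * D - b * z ≤ G → -(y * D - b * z) ≤ G →
      2 * z + 2 * G < D → False := by
    intro y z G hz hG1 hG2 hlt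
    set Γ := y * D - b * z with hΓ
    have hG0 : 0 ≤ G := by omega
    obtain ⟨x, hx1, hx2⟩ := exists_mult D (G * (c + c') - (- 2 * a * z + c * Γ + c' * (D - z))) hD
    have g1 : Γ * (c + c') ≤ G * (c + c') := mul_le_mul_of_nonneg_right hG1 (by omega)
    have g2 : -Γ * (c + c') ≤ G * (c + c') := mul_le_mul_of_nonneg_right hG2 (by omega)
    have g3 : 4 * (D - z - G) ≤ (c + c') * (D - z - G) :=
      mul_le_mul_of_nonneg_right hs (by omega)
    have g4 : 0 < z * (c + c') := mul_pos hz (by omega)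
    have := h.nf_int (by omega) hD x y z (by
      intro i
      fin_cases i <;> simp only [num, Matrix.cons_val, Fin.zero_eta, Fin.mk_one, Fin.reduceFinMk,
        ← hΓ] <;> linarith)
    omega
  by_cases h1 : 3 * b ≤ D
  · exact key 0 1 b (by omega) (by omega) (by omega) (by omega)
  · by_cases h2 : 2 * D ≤ 3 * b
    · exact key 1 1 (D - b) (by omega) (by omega) (by omega) (by omega)
    · exact key 1 2 (max (D - 2 * b) (2 * b - D)) (by omega) (by omega) (by omega) (by omega)

/-- candidate extra interior lattice points -/
def candPts : List (ℤ × ℤ × ℤ) :=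
  [(1, 1, 1), (2, 0, 1), (1, 0, 1), (0, 1, 1), (1, 1, 2), (0, 0, 1), (1, 1, 3), (1, 2, 3),
    (0, 0, -1), (1, -1, -1), (-1, 0, -1), (0, -1, -1)]

/-- candidate witnesses against minimality -/
def candMin : List (Fin 4 × ℤ × ℤ × ℤ) :=
  [(3, 1, -1, -1), (3, -1, 0, -1), (3, 0, 0, -1), (3, 0, -1, -1), (2, 2, 0, 1), (3, 0, -1, -2)]

/-- an extra interior lattice point exists -/
def chkInt (c c' D a b : ℤ) : Bool :=
  candPts.any fun m => decide (∀ i, 0 < num c c' D a b m.1 m.2.1 m.2.2 i)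

/-- a witness against minimality exists -/
def chkMin (c c' D a b : ℤ) : Bool :=
  candMin.any fun m => decide ((∀ j, 0 ≤ num c c' D a b m.2.1 m.2.2.1 m.2.2.2 j) ∧
    0 < num c c' D a b m.2.1 m.2.2.1 m.2.2.2 m.1 ∧
    (∃ j, j ≠ m.1 ∧ 0 < num c c' D a b m.2.1 m.2.2.1 m.2.2.2 j) ∧
    0 < num c c' D a b 1 0 0 m.1 ∧
    ∀ j, j ≠ m.1 → num c c' D a b 1 0 0 m.1 * num c c' D a b m.2.1 m.2.2.1 m.2.2.2 j <
      num c c' D a b 1 0 0 j * num c c' D a b m.2.1 m.2.2.1 m.2.2.2 m.1)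

/-- the surviving parameters -/
def survivors : List (ℤ × ℤ × ℤ × ℤ × ℤ) :=
  [(3, 1, 1, 0, 0), (3, 1, 3, 1, 1), (3, 1, 3, 1, 2), (3, 2, 1, 0, 0), (4, 1, 1, 0, 0),
    (4, 2, 1, 0, 0), (4, 2, 2, 1, 1)]

theorem check_all : ∀ D' ∈ List.range 12, ∀ a ∈ List.range (D' + 1), ∀ b ∈ List.range (D' + 1),
    ∀ c ∈ [(3 : ℤ), 4], ∀ c' ∈ [(1 : ℤ), 2],
    (chkInt c c' (D' + 1 : ℕ) a b || (chkMin c c' (D' + 1 : ℕ) a b ||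
      decide ((c, c', ((D' + 1 : ℕ) : ℤ), (a : ℤ), (b : ℤ)) ∈ survivors))) = true := by
  decide +kernel

theorem candPts_ne : ∀ m ∈ candPts, ¬ (m.2.1 = 0 ∧ m.2.2 = 0) := by decide

theorem GoodTet.nf_survivor {c c' D a b : ℤ}
    (h : GoodTet (nf c c' D a b) ![0, 0, 0] ![1, 0, 0])
    (hc : c = 3 ∨ c = 4) (hc' : c' = 1 ∨ c' = 2) (hD : 0 < D)
    (ha0 : 0 ≤ a) (ha1 : a < D) (hb0 : 0 ≤ b) (hb1 : b < D) :
    (c, c', D, a, b) ∈ survivors := by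
  have hD12 := h.nf_bound hc hc' hD hb0 hb1
  have hcc : 0 < c + c' := by omega
  have := check_all (D - 1).toNat (by rw [List.mem_range]; omega) a.toNat
    (by rw [List.mem_range]; omega) b.toNat (by rw [List.mem_range]; omega) c (by simpa using hc)
    c' (by simpa using hc')
  have e1 : (((D - 1).toNat + 1 : ℕ) : ℤ) = D := by omega
  rw [e1, Int.toNat_of_nonneg ha0, Int.toNat_of_nonneg hb0] at this
  rw [Bool.or_eq_true, Bool.or_eq_true] at this
  rcases this with h1 | h1 | h1
  · exfalso
    rw [chkInt, List.any_eq_true] at h1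
    obtain ⟨m, hm, h2⟩ := h1
    exact candPts_ne m hm (h.nf_int hcc hD _ _ _ (of_decide_eq_true h2))
  · exfalso
    rw [chkMin, List.any_eq_true] at h1
    obtain ⟨m, hm, h2⟩ := h1
    obtain ⟨k0, k1, k2, k3, k4⟩ := of_decide_eq_true h2
    exact h.nf_min hcc hD m.1 _ _ _ k0 k1 k2 k3 k4
  · exact of_decide_eq_true h1


/-- the real affine map attached to an integral matrix and translation -/
def rmap (A : Matrix (Fin 3) (Fin 3) ℤ) (b : Fin 3 → ℤ) (x : Fin 3 → ℝ) : Fin 3 → ℝ :=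
  (A.map (Int.cast : ℤ → ℝ)).mulVec x + castPt b

theorem rmap_castPt (A : Matrix (Fin 3) (Fin 3) ℤ) (b x : Fin 3 → ℤ) :
    rmap A b (castPt x) = castPt (A.mulVec x + b) := by
  funext i
  simp [rmap, castPt, Matrix.mulVec, dotProduct]

theorem rmap_comp (A B : Matrix (Fin 3) (Fin 3) ℤ) (a b : Fin 3 → ℤ) (x : Fin 3 → ℝ) :
    rmap B b (rmap A a x) = rmap (B * A) (B.mulVec a + b) x := by
  have h := rmap_castPt B b a
  have e : (B * A).map (Int.cast : ℤ → ℝ) = B.map (Int.cast : ℤ → ℝ) * A.map (Int.cast : ℤ → ℝ) :=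
    Matrix.map_mul (f := Int.castRingHom ℝ)
  rw [rmap, rmap, rmap, ← h, e, ← Matrix.mulVec_mulVec, Matrix.mulVec_add, rmap, add_assoc]

theorem rmap_one (x : Fin 3 → ℝ) : rmap 1 0 x = x := by
  funext i
  simp [rmap, castPt]

theorem rmap_inv (A : Matrix (Fin 3) (Fin 3) ℤ) (hA : IsUnit A.det) (b : Fin 3 → ℤ)
    (x : Fin 3 → ℝ) : rmap A⁻¹ (-A⁻¹.mulVec b) (rmap A b x) = x := by
  rw [rmap_comp, Matrix.nonsing_inv_mul _ hA, add_neg_cancel, rmap_one]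

theorem UnimodEquiv.symmU {P Q : Set (Fin 3 → ℝ)} (h : UnimodEquiv P Q) : UnimodEquiv Q P := by
  obtain ⟨A, b, hA, h⟩ := h
  refine ⟨A⁻¹, -A⁻¹.mulVec b, ?_, ?_⟩
  · exact Matrix.isUnit_nonsing_inv_det _ hA
  · rw [← h, Set.image_image]
    have := rmap_inv A hA b
    unfold rmap at this
    simp only [this, Set.image_id']

theorem UnimodEquiv.transU {P Q R : Set (Fin 3 → ℝ)} (h : UnimodEquiv P Q)
    (h' : UnimodEquiv Q R) : UnimodEquiv P R := by
  obtain ⟨A, a, hA, h⟩ := h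
  obtain ⟨B, b, hB, h'⟩ := h'
  refine ⟨B * A, B.mulVec a + b, ?_, ?_⟩
  · rw [Matrix.det_mul]; exact hB.mul hA
  · rw [← h', ← h, Set.image_image]
    have := rmap_comp A B a b
    unfold rmap at this
    simp only [this]

theorem unimod_hull (v w : Fin 4 → Fin 3 → ℤ) (A : Matrix (Fin 3) (Fin 3) ℤ) (b : Fin 3 → ℤ)
    (hA : IsUnit A.det) (σ : Fin 4 → Fin 4) (hσ : Function.Surjective σ)
    (h : ∀ i, A.mulVec (v (σ i)) + b = w i) :
    UnimodEquiv (convexHull ℝ (Set.range fun i => castPt (v i)))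
      (convexHull ℝ (Set.range fun i => castPt (w i))) := by
  refine ⟨A, b, hA, ?_⟩
  let f : (Fin 3 → ℝ) →ᵃ[ℝ] (Fin 3 → ℝ) :=
    (Matrix.mulVecLin (A.map (Int.cast : ℤ → ℝ))).toAffineMap + AffineMap.const ℝ _ (castPt b)
  have hf : (fun x : Fin 3 → ℝ => (A.map (Int.cast : ℤ → ℝ)).mulVec x + castPt b) = f := by
    funext x
    simp [f]
  rw [hf, AffineMap.image_convexHull]
  congr 1
  rw [← hf]
  ext y
  constructor
  · rintro ⟨_, ⟨i, rfl⟩, rfl⟩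
    obtain ⟨j, rfl⟩ := hσ i
    refine ⟨j, ?_⟩
    simp only
    rw [← h j, ← rmap_castPt]; rfl
  · rintro ⟨i, rfl⟩
    refine ⟨castPt (v (σ i)), ⟨σ i, rfl⟩, ?_⟩
    simp only
    rw [← h i, ← rmap_castPt]; rfl

theorem unimod_lattice {P Q : Set (Fin 3 → ℝ)} (h : UnimodEquiv P Q) :
    ∃ (A : Matrix (Fin 3) (Fin 3) ℤ) (b : Fin 3 → ℤ), IsUnit A.det ∧
      ∀ x ∈ latticePts P, A.mulVec x + b ∈ latticePts Q := by
  obtain ⟨A, b, hA, h⟩ := h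
  refine ⟨A, b, hA, ?_⟩
  intro x hx
  change castPt _ ∈ Q
  rw [← rmap_castPt, ← h]
  exact ⟨castPt x, hx, rfl⟩

theorem unimod_ncard_le {P Q : Set (Fin 3 → ℝ)} (h : UnimodEquiv P Q)
    (hQ : (latticePts Q).Finite) : (latticePts P).ncard ≤ (latticePts Q).ncard := by
  obtain ⟨A, b, hA, h⟩ := unimod_lattice h
  refine Set.ncard_le_ncard_of_injOn (fun x => A.mulVec x + b) h ?_ hQ
  intro x _ y _ hxy
  have h1 := unmap_pt A hA b x
  have h2 := unmap_pt A hA b y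
  simp only at hxy
  rw [hxy] at h1
  exact h1.symm.trans h2

theorem unimod_frame {P Q : Set (Fin 3 → ℝ)} (h : UnimodEquiv P Q) (n : ℤ) (hn : 1 < n)
    (h0 : ![0,0,0] ∈ latticePts P) (h1 : ![1,0,0] ∈ latticePts P)
    (h2 : ![0,1,0] ∈ latticePts P) (h3 : ![1,1,1] ∈ latticePts P)
    (hQ : ∀ x ∈ latticePts Q, n ∣ x 2) : False := by
  obtain ⟨A, b, hA, h⟩ := unimod_lattice h
  have g0 := hQ _ (h _ h0)
  have g1 := hQ _ (h _ h1)
  have g2 := hQ _ (h _ h2)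
  have g3 := hQ _ (h _ h3)
  simp [Matrix.mulVec, dotProduct, Fin.sum_univ_three] at g0 g1 g2 g3
  obtain ⟨a0, e0⟩ := (dvd_add_left g0).1 g1
  obtain ⟨a1, e1⟩ := (dvd_add_left g0).1 g2
  have g4 := (dvd_add_left g0).1 g3
  obtain ⟨a2, e2⟩ := g4
  have e2' : A 2 2 = n * (a2 - a0 - a1) := by linear_combination e2 - e0 - e1
  have hd : n ∣ A.det := by
    rw [Matrix.det_fin_three, e0, e1, e2']
    refine ⟨A 0 0 * A 1 1 * (a2 - a0 - a1) - A 0 0 * A 1 2 * a1 - A 0 1 * A 1 0 * (a2 - a0 - a1)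
      + A 0 1 * A 1 2 * a0 + A 0 2 * A 1 0 * a1 - A 0 2 * A 1 1 * a0, by ring⟩
  have := isUnit_of_dvd_unit hd hA
  rcases Int.isUnit_iff.1 this with h | h <;> omega

theorem hollow_cert (S : Set (Fin 3 → ℤ)) (f : (Fin 3 → ℝ) →ᵃ[ℝ] ℝ)
    (hf : ∀ s ∈ S, 0 ≤ f (castPt s)) (x : Fin 3 → ℝ) (hx : f x ≤ 0)
    (y : Fin 3 → ℤ) (hy : y ∈ S) (hy' : 0 < f (castPt y)) :
    x ∉ intrinsicInterior ℝ (convexHull ℝ (castPt '' S)) := by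
  intro hxi
  set Q := convexHull ℝ (castPt '' S) with hQ
  have hyQ : castPt y ∈ Q := subset_convexHull ℝ _ ⟨y, hy, rfl⟩
  have hfQ : ∀ z ∈ Q, 0 ≤ f z := by
    intro z hz
    have hc : Convex ℝ (f ⁻¹' Set.Ici 0) := (convex_Ici (0 : ℝ)).affine_preimage f
    refine convexHull_min ?_ hc hz
    rintro _ ⟨s, hs, rfl⟩
    exact hf s hs
  rw [mem_intrinsicInterior] at hxi
  obtain ⟨x', hx', rfl⟩ := hxi
  let g : ℝ → affineSpan ℝ Q := fun t =>
    ⟨AffineMap.lineMap (castPt y) (x' : Fin 3 → ℝ) t,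
      AffineMap.lineMap_mem t (subset_affineSpan ℝ _ hyQ) x'.2⟩
  have hg : Continuous g := by
    refine Continuous.subtype_mk ?_ _
    exact AffineMap.lineMap_continuous
  have hg1 : g 1 = x' := by
    apply Subtype.ext
    simp [g]
  have hnb : ∀ᶠ t in nhds (1 : ℝ), g t ∈ ((↑) ⁻¹' Q : Set (affineSpan ℝ Q)) := by
    apply hg.continuousAt.eventually_mem
    rw [hg1]
    exact mem_interior_iff_mem_nhds.1 hx'
  obtain ⟨t, ht, ht1⟩ := ((hnb.filter_mono nhdsWithin_le_nhds).and
    (self_mem_nhdsWithin : Set.Ioi (1 : ℝ) ∈ nhdsWithin 1 (Set.Ioi 1))).exists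
  have h2 := hfQ _ ht
  simp only [g, AffineMap.apply_lineMap] at h2
  rw [AffineMap.lineMap_apply_module] at h2
  simp only [smul_eq_mul] at h2
  have ht1 : 1 < t := ht1
  nlinarith

/-- the tetrahedra of the list -/
def tet (k A B C : ℤ) : Fin 4 → Fin 3 → ℤ := ![![0,0,0],![1,0,0],![0,k,0],![A,B,C]]

/-- barycentric numerators -/
def bnum (k A B C : ℤ) (x : Fin 3 → ℤ) : Fin 4 → ℤ :=
  ![k * C - k * (C * x 0 - A * x 2) - (C * x 1 - B * x 2) - k * x 2,
    k * (C * x 0 - A * x 2), C * x 1 - B * x 2, k * x 2]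

theorem tet_indep (k A B C : ℤ) (hk : 0 < k) (hC : 0 < C) :
    AffineIndependent ℝ (fun i => castPt (tet k A B C i)) := by
  apply affineIndependent_of_ind
  intro c hc hx
  have h0 := hx 0
  have h1 := hx 1
  have h2 := hx 2
  simp [tet, castPt, Fin.sum_univ_four] at h0 h1 h2 hc
  have c3 : c 3 = 0 := h2.resolve_right hC.ne'
  simp [c3, hk.ne'] at h0 h1
  simp [c3, h0, h1] at hc
  funext i
  fin_cases i <;> simp [c3, h0, h1, hc]

theorem tet_coord (k A B C : ℤ) (hk : 0 < k) (hC : 0 < C) (x : Fin 3 → ℤ) (i : Fin 4) :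
    (mkBasis _ (tet_indep k A B C hk hC)).coord i (castPt x) =
      (bnum k A B C x i : ℝ) / ((k : ℝ) * C) := by
  have hk' : (k : ℝ) ≠ 0 := by exact_mod_cast hk.ne'
  have hC' : (C : ℝ) ≠ 0 := by exact_mod_cast hC.ne'
  refine coord_of_comb _ (fun i => (bnum k A B C x i : ℝ) / ((k : ℝ) * C)) _ ?_ ?_ i
  · simp [bnum, Fin.sum_univ_four]
    field_simp
    ring
  · intro j
    rw [mkBasis_coe]
    fin_cases j
    · simp [bnum, tet, castPt, Fin.sum_univ_four]
      field_simp
      ring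
    · simp [bnum, tet, castPt, Fin.sum_univ_four]
      field_simp
      ring
    · simp [bnum, tet, castPt, Fin.sum_univ_four]
      field_simp

/-- hull -/
def tetHull (k A B C : ℤ) : Set (Fin 3 → ℝ) :=
  convexHull ℝ (Set.range fun i => castPt (tet k A B C i))

theorem dnn_iff {a b : ℝ} (hb : 0 < b) : 0 ≤ a / b ↔ 0 ≤ a := by
  rw [le_div_iff₀ hb, zero_mul]

theorem tet_mem (k A B C : ℤ) (hk : 0 < k) (hC : 0 < C) (x : Fin 3 → ℤ) :
    x ∈ latticePts (tetHull k A B C) ↔ ∀ i, 0 ≤ bnum k A B C x i := by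
  have := mem_hull_iff (mkBasis _ (tet_indep k A B C hk hC)) (castPt x)
  rw [mkBasis_coe] at this
  change castPt x ∈ tetHull k A B C ↔ _
  rw [tetHull, this]
  refine forall_congr' fun i => ?_
  have hkC : (0 : ℝ) < (k : ℝ) * C := by exact_mod_cast mul_pos hk hC
  rw [tet_coord k A B C hk hC, dnn_iff hkC]
  exact_mod_cast Iff.rfl

theorem tet_int (k A B C : ℤ) (hk : 0 < k) (hC : 0 < C) (x : Fin 3 → ℤ) :
    x ∈ intLatPts (tetHull k A B C) ↔ ∀ i, 0 < bnum k A B C x i := by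
  have := mem_interior_iff (mkBasis _ (tet_indep k A B C hk hC)) (castPt x)
  rw [mkBasis_coe] at this
  change castPt x ∈ interior (tetHull k A B C) ↔ _
  rw [tetHull, this]
  refine forall_congr' fun i => ?_
  have hkC : (0 : ℝ) < (k : ℝ) * C := by exact_mod_cast mul_pos hk hC
  rw [tet_coord k A B C hk hC, div_pos_iff_of_pos_right hkC]
  exact_mod_cast Iff.rfl

/-- certificate for hollowness after removing vertex `i`, at the point `x` -/
def Cert (L : List (Fin 3 → ℤ)) (v : Fin 3 → ℤ) (l : (Fin 3 → ℤ) → ℤ) (x : Fin 3 → ℤ) : Prop :=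
  (∀ s ∈ L, s ≠ v → 0 ≤ l s) ∧ l x ≤ 0 ∧ ∃ y ∈ L, y ≠ v ∧ 0 < l y

instance (L : List (Fin 3 → ℤ)) (v : Fin 3 → ℤ) (l : (Fin 3 → ℤ) → ℤ) (x : Fin 3 → ℤ) :
    Decidable (Cert L v l x) := by
  unfold Cert; infer_instance

theorem tet_minimal (k A B C : ℤ) (hk : 0 < k) (hC : 0 < C) (L : List (Fin 3 → ℤ))
    (hL : ∀ x, x ∈ latticePts (tetHull k A B C) ↔ x ∈ L)
    (p : Fin 3 → ℤ) (hp : ∀ i, 0 < bnum k A B C p i)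
    (hcert : ∀ i : Fin 4, ∀ x ∈ L,
      (∃ j : Fin 4, Cert L (tet k A B C i) (fun s => bnum k A B C s j - bnum k A B C s i) x) ∨
      Cert L (tet k A B C i) (fun s => bnum k A B C s i) x) :
    IsMinimalPolytope (tetHull k A B C) := by
  have hkC : (0 : ℝ) < (k : ℝ) * C := by exact_mod_cast mul_pos hk hC
  refine ⟨⟨p, ?_⟩, ?_⟩
  · have := (tet_int k A B C hk hC p).2 hp
    exact interior_subset_intrinsicInterior this
  · intro v hv
    have hv' := extremePoints_convexHull_subset hv
    obtain ⟨i, hi⟩ := hv'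
    have hi := castPt_inj hi
    subst hi
    rw [Set.eq_empty_iff_forall_notMem]
    intro x hx
    have hxL : x ∈ L := by
      rw [← hL]
      have h1 := intrinsicInterior_subset hx
      refine convexHull_min ?_ (convex_convexHull ℝ _) h1
      rintro _ ⟨s, hs, rfl⟩
      exact hs.1
    have key : ∀ (l : (Fin 3 → ℤ) → ℤ) (f : (Fin 3 → ℝ) →ᵃ[ℝ] ℝ),
        (∀ s, f (castPt s) = (l s : ℝ) / ((k : ℝ) * C)) → ¬ Cert L (tet k A B C i) l x := by
      rintro l f hfl ⟨hc1, hc2, y, hyL, hy1, hy2⟩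
      refine hollow_cert (latticePts (tetHull k A B C) \ {tet k A B C i}) f ?_ (castPt x) ?_ y
        ⟨(hL y).2 hyL, hy1⟩ ?_ hx
      · rintro s ⟨hs, hs'⟩
        rw [hfl, dnn_iff hkC]
        exact_mod_cast hc1 s ((hL s).1 hs) hs'
      · rw [hfl]
        exact div_nonpos_of_nonpos_of_nonneg (by exact_mod_cast hc2) hkC.le
      · rw [hfl, div_pos_iff_of_pos_right hkC]
        exact_mod_cast hy2
    rcases hcert i x hxL with ⟨j, hj⟩ | hi
    · refine key _ ((mkBasis _ (tet_indep k A B C hk hC)).coord j -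
        (mkBasis _ (tet_indep k A B C hk hC)).coord i) ?_ hj
      intro s
      have h1 := tet_coord k A B C hk hC s j
      have h2 := tet_coord k A B C hk hC s i
      rw [AffineMap.coe_sub, Pi.sub_apply, h1, h2]
      push_cast
      ring
    · exact key _ ((mkBasis _ (tet_indep k A B C hk hC)).coord i)
        (fun s => tet_coord k A B C hk hC s i) hi

/-- everything about one tetrahedron of the list, from finite checks -/
theorem tet_pts (k A B C : ℤ) (hk : 0 < k) (hC : 0 < C) (L : List (Fin 3 → ℤ))
    (hbox : ∀ x : Fin 3 → ℤ, (∀ i, 0 ≤ bnum k A B C x i) →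
      (0 ≤ x 0 ∧ x 0 < 7) ∧ (0 ≤ x 1 ∧ x 1 < 10) ∧ (0 ≤ x 2 ∧ x 2 < 25))
    (hL1 : ∀ x ∈ List.range 7, ∀ y ∈ List.range 10, ∀ z ∈ List.range 25,
      (∀ i, 0 ≤ bnum k A B C ![x, y, z] i) → ![(x : ℤ), y, z] ∈ L)
    (hL2 : ∀ x ∈ L, ∀ i, 0 ≤ bnum k A B C x i) (x : Fin 3 → ℤ) :
    x ∈ latticePts (tetHull k A B C) ↔ x ∈ L := by
  rw [tet_mem k A B C hk hC]
  constructor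
  · intro h
    obtain ⟨⟨h1, h2⟩, ⟨h3, h4⟩, ⟨h5, h6⟩⟩ := hbox x h
    have := hL1 (x 0).toNat (by rw [List.mem_range]; omega) (x 1).toNat
      (by rw [List.mem_range]; omega) (x 2).toNat (by rw [List.mem_range]; omega)
    rw [Int.toNat_of_nonneg h1, Int.toNat_of_nonneg h3, Int.toNat_of_nonneg h5] at this
    have e : (![x 0, x 1, x 2] : Fin 3 → ℤ) = x := by
      funext i; fin_cases i <;> rfl
    rw [e] at this
    exact this h
  · exact fun h => hL2 x h

theorem tet_two (k A B C : ℤ) (hk : 0 < k) (hC : 0 < C) (L : List (Fin 3 → ℤ))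
    (hL : ∀ x, x ∈ latticePts (tetHull k A B C) ↔ x ∈ L) (p q : Fin 3 → ℤ) (hpq : p ≠ q)
    (hp : ∀ i, 0 < bnum k A B C p i) (hq : ∀ i, 0 < bnum k A B C q i)
    (h : ∀ x ∈ L, (∀ i, 0 < bnum k A B C x i) → x = p ∨ x = q) :
    (intLatPts (tetHull k A B C)).ncard = 2 := by
  rw [Set.ncard_eq_two]
  refine ⟨p, q, hpq, ?_⟩
  ext x
  rw [tet_int k A B C hk hC]
  constructor
  · intro hx
    exact h x ((hL x).1 ((tet_mem k A B C hk hC x).2 fun i => (hx i).le)) hx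
  · rintro (rfl | rfl)
    · exact hp
    · exact hq

theorem tet_ncard (k A B C : ℤ) (L : List (Fin 3 → ℤ))
    (hL : ∀ x, x ∈ latticePts (tetHull k A B C) ↔ x ∈ L) (hn : L.Nodup) :
    (latticePts (tetHull k A B C)).ncard = L.length ∧ (latticePts (tetHull k A B C)).Finite := by
  have : latticePts (tetHull k A B C) = (L.toFinset : Set (Fin 3 → ℤ)) := by
    ext x; simp [hL]
  rw [this, Set.ncard_coe_finset, List.toFinset_card_of_nodup hn]
  exact ⟨rfl, Finset.finite_toSet _⟩

/-- parameters of the five tetrahedra -/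
def prm : Fin 5 → ℤ × ℤ × ℤ × ℤ :=
  ![(1, 5, 5, 8), (1, 6, 9, 10), (1, 5, 7, 24), (2, 5, 2, 6), (2, 5, 2, 12)]

/-- the five tetrahedra -/
def TT (i : Fin 5) : Set (Fin 3 → ℝ) := tetHull (prm i).1 (prm i).2.1 (prm i).2.2.1 (prm i).2.2.2

/-- lattice points of the five tetrahedra -/
def LL : Fin 5 → List (Fin 3 → ℤ) :=
  ![[![0,0,0], ![1,0,0], ![0,1,0], ![5,5,8], ![1,1,1], ![2,2,3]],
    [![0,0,0], ![1,0,0], ![0,1,0], ![6,9,10], ![1,1,1], ![2,3,3], ![3,5,5]],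
    [![0,0,0], ![1,0,0], ![0,1,0], ![5,7,24], ![1,1,3], ![2,3,9]],
    [![0,0,0], ![1,0,0], ![0,2,0], ![5,2,6], ![0,1,0], ![1,1,1], ![2,1,2], ![3,1,3]],
    [![0,0,0], ![1,0,0], ![0,2,0], ![5,2,12], ![0,1,0], ![1,1,2], ![2,1,4], ![3,1,6]]]

/-- interior lattice points -/
def PP : Fin 5 → (Fin 3 → ℤ) × (Fin 3 → ℤ) :=
  ![(![1,1,1], ![2,2,3]), (![1,1,1], ![2,3,3]), (![1,1,3], ![2,3,9]), (![1,1,1], ![2,1,2]),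
    (![1,1,2], ![2,1,4])]

theorem prm_pos : ∀ i, 0 < (prm i).1 ∧ 0 < (prm i).2.2.2 := by decide

theorem TT_pts (i : Fin 5) (x : Fin 3 → ℤ) : x ∈ latticePts (TT i) ↔ x ∈ LL i := by
  apply tet_pts _ _ _ _ (prm_pos i).1 (prm_pos i).2
  · clear x
    intro x h
    have h0 := h 0
    have h1 := h 1
    have h2 := h 2
    have h3 := h 3
    fin_cases i <;> simp [bnum, prm] at h0 h1 h2 h3 <;> omega
  · revert i; decide +kernel
  · revert i; decide +kernel

theorem TT_two (i : Fin 5) : (intLatPts (TT i)).ncard = 2 := by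
  apply tet_two _ _ _ _ (prm_pos i).1 (prm_pos i).2 (LL i) (TT_pts i) (PP i).1 (PP i).2
  · revert i; decide +kernel
  · revert i; decide +kernel
  · revert i; decide +kernel
  · revert i; decide +kernel

theorem TT_min (i : Fin 5) : IsMinimalPolytope (TT i) := by
  apply tet_minimal _ _ _ _ (prm_pos i).1 (prm_pos i).2 (LL i) (TT_pts i) (PP i).1
  · revert i; decide +kernel
  · revert i; decide +kernel

theorem TT_ncard (i : Fin 5) :
    (latticePts (TT i)).ncard = (LL i).length ∧ (latticePts (TT i)).Finite := by
  apply tet_ncard _ _ _ _ (LL i) (TT_pts i)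
  revert i; decide +kernel

theorem TT_eq (i : Fin 5) : minimalTwoPointTetrahedra i = TT i := by
  have key : ∀ k A B C : ℤ, tetHull k A B C =
      convexHull ℝ {![0,0,0], ![1,0,0], ![0,(k:ℝ),0], ![(A:ℝ),B,C]} := by
    intro k A B C
    have e : ∀ a b c : ℤ, castPt ![a,b,c] = ![(a:ℝ),b,c] := by
      intro a b c
      funext i; fin_cases i <;> simp [castPt]
    unfold tetHull
    congr 1
    ext x
    simp only [Set.mem_range, Fin.exists_fin_succ, Set.mem_insert_iff, Set.mem_singleton_iff, tet]
    simp [e, eq_comm]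
  fin_cases i <;> simp [minimalTwoPointTetrahedra, TT, prm, key]

theorem TT_tet (i : Fin 5) : IsLatticeTetrahedron (TT i) :=
  ⟨_, tet_indep _ _ _ _ (prm_pos i).1 (prm_pos i).2, rfl⟩

/-- combinatorial obstruction to equivalence -/
def Obst (i j : Fin 5) : Prop :=
  (![0,0,0] ∈ LL i ∧ ![1,0,0] ∈ LL i ∧ ![0,1,0] ∈ LL i ∧ ![1,1,1] ∈ LL i) ∧
    ((∀ x ∈ LL j, (3 : ℤ) ∣ x 2) ∨ (∀ x ∈ LL j, (2 : ℤ) ∣ x 2))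

instance (i j : Fin 5) : Decidable (Obst i j) := by
  unfold Obst; infer_instance

theorem TT_inequiv (i j : Fin 5) (h : UnimodEquiv (TT i) (TT j)) : i = j := by
  have h1 := unimod_ncard_le h (TT_ncard j).2
  have h2 := unimod_ncard_le h.symmU (TT_ncard i).2
  have hlen := le_antisymm h1 h2
  rw [(TT_ncard i).1, (TT_ncard j).1] at hlen
  by_contra hij
  have key : ∀ i j : Fin 5, UnimodEquiv (TT i) (TT j) →
      ¬ Obst i j := by
    rintro i j h ⟨⟨a, b, c, d⟩, hQ⟩
    rw [← TT_pts] at a b c d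
    rcases hQ with hQ | hQ
    · exact unimod_frame h 3 (by norm_num) a b c d fun x hx => hQ x ((TT_pts j x).1 hx)
    · exact unimod_frame h 2 (by norm_num) a b c d fun x hx => hQ x ((TT_pts j x).1 hx)
  have k1 := key i j h
  have k2 := key j i h.symmU
  clear key h h1 h2
  revert i j
  decide +kernel

/-- a normal form is equivalent to one of the five tetrahedra -/
theorem nf_equiv {c c' D a b : ℤ} (h : (c, c', D, a, b) ∈ survivors) :
    ∃ i, UnimodEquiv (convexHull ℝ (Set.range fun i => castPt (nf c c' D a b i))) (TT i) := by
  simp only [survivors, List.mem_cons, List.not_mem_nil, or_false, Prod.mk.injEq] at h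
  rcases h with h | h | h | h | h | h | h <;> obtain ⟨rfl, rfl, rfl, rfl, rfl⟩ := h
  · exact ⟨0, unimod_hull _ _ !![1,-1,0;1,-1,-1;2,-1,-1] ![1,1,1] (by decide +kernel)
      ![0,2,3,1] (by decide) (by decide +kernel)⟩
  · exact ⟨2, unimod_hull _ _ !![-1,-2,2;-2,-3,3;-6,-9,10] ![2,3,9] (by decide +kernel)
      ![0,1,3,2] (by decide) (by decide +kernel)⟩
  · exact ⟨2, unimod_hull _ _ !![-1,-2,1;-2,-3,2;-6,-9,5] ![2,3,9] (by decide +kernel)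
      ![0,1,2,3] (by decide) (by decide +kernel)⟩
  · exact ⟨1, unimod_hull _ _ !![-1,-2,-2;-2,-3,-2;-2,-3,-3] ![2,3,3] (by decide +kernel)
      ![0,1,2,3] (by decide) (by decide +kernel)⟩
  · exact ⟨1, unimod_hull _ _ !![1,-1,-1;2,0,-1;2,-1,-1] ![1,1,1] (by decide +kernel)
      ![2,3,0,1] (by decide) (by decide +kernel)⟩
  · exact ⟨3, unimod_hull _ _ !![-1,-2,-1;0,-1,-1;-1,-2,-2] ![2,1,2] (by decide +kernel)
      ![0,2,1,3] (by decide) (by decide +kernel)⟩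
  · exact ⟨4, unimod_hull _ _ !![-1,-2,1;0,-1,0;-2,-4,1] ![2,1,4] (by decide +kernel)
      ![0,2,1,3] (by decide) (by decide +kernel)⟩

theorem exists_equiv (P : Set (Fin 3 → ℝ)) (ht : IsLatticeTetrahedron P)
    (hm : IsMinimalPolytope P) (hn : (intLatPts P).ncard = 2) : ∃ i, UnimodEquiv P (TT i) := by
  obtain ⟨v, hv, rfl⟩ := ht
  obtain ⟨p, q, hg⟩ := good_of_minimal v hv hm hn
  obtain ⟨σ, A, t, hA, c, c', D, a, b, hc, hc', hD, ha0, ha1, hb0, hb1, hi, hg'⟩ := hg.normal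
  obtain ⟨i, he⟩ := nf_equiv (hg'.nf_survivor hc hc' hD ha0 ha1 hb0 hb1)
  exact ⟨i, (unimod_hull v _ A t hA σ σ.surjective hi).transU he⟩

/-- Up to unimodular equivalence there are exactly five minimal tetrahedra with exactly two
interior lattice points, namely the five listed ones. -/
theorem classification_minimal_two_point_tetrahedra :
    (∀ i : Fin 5, IsLatticeTetrahedron (minimalTwoPointTetrahedra i) ∧
      IsMinimalPolytope (minimalTwoPointTetrahedra i) ∧
      (intLatPts (minimalTwoPointTetrahedra i)).ncard = 2) ∧
    (∀ i j : Fin 5,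
      UnimodEquiv (minimalTwoPointTetrahedra i) (minimalTwoPointTetrahedra j) → i = j) ∧
    (∀ P : Set (Fin 3 → ℝ), IsLatticeTetrahedron P → IsMinimalPolytope P →
      (intLatPts P).ncard = 2 →
      ∃! i : Fin 5, UnimodEquiv P (minimalTwoPointTetrahedra i)) := by
  simp only [TT_eq]
  refine ⟨fun i => ⟨TT_tet i, TT_min i, TT_two i⟩, TT_inequiv, fun P ht hm hn => ?_⟩
  obtain ⟨i, hi⟩ := exists_equiv P ht hm hn
  exact ⟨i, hi, fun j hj => TT_inequiv j i (hj.symmU.transU hi)⟩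
end
end

section
/- For every integer k ≥ 1, the simplex S_k³ = conv{(0,0,0),(2,0,0),(0,3,0),(0,0,6(k+1))} ⊂ ℝ³ has exactly k interior lattice points, normalized volume 36(k+1), and its Ehrhart δ-vector is (1, 16k+19, 19k+16, k); equivalently, for every integer n ≥ 0, |nS_k³ ∩ ℤ³| = C(n+3,3) + (16k+19)·C(n+2,3) + (19k+16)·C(n+1,3) + k·C(n,3), where C(m,3) denotes the binomial coefficient. -/
open Set MeasureTheory Pointwise

noncomputable section

/-- The Zaks–Perles–Wilkes simplex `S_k³ = conv{(0,0,0),(2,0,0),(0,3,0),(0,0,6(k+1))}`. -/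
def ZPWsimplex (k : ℕ) : Set (Fin 3 → ℝ) :=
  convexHull ℝ {![0,0,0], ![2,0,0], ![0,3,0], ![0,0,(6 * (k + 1) : ℝ)]}


/-- Half-space description of the simplex. -/
theorem zpw_mem (k : ℕ) (v : Fin 3 → ℝ) :
    v ∈ ZPWsimplex k ↔ 0 ≤ v 0 ∧ 0 ≤ v 1 ∧ 0 ≤ v 2 ∧
      3 * ((k : ℝ) + 1) * v 0 + 2 * ((k : ℝ) + 1) * v 1 + v 2 ≤ 6 * ((k : ℝ) + 1) := by
  have hm : (0 : ℝ) < (k : ℝ) + 1 := by positivity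
  constructor
  · intro hv
    have hc : Convex ℝ {v : Fin 3 → ℝ | 0 ≤ v 0 ∧ 0 ≤ v 1 ∧ 0 ≤ v 2 ∧
      3 * ((k : ℝ) + 1) * v 0 + 2 * ((k : ℝ) + 1) * v 1 + v 2 ≤ 6 * ((k : ℝ) + 1)} := by
      rintro x ⟨hx0, hx1, hx2, hx⟩ y ⟨hy0, hy1, hy2, hy⟩ a b ha hb hab
      simp only [mem_ofPred_eq, Pi.add_apply, Pi.smul_apply, smul_eq_mul]
      refine ⟨by positivity, by positivity, by positivity, ?_⟩
      have h1 := mul_le_mul_of_nonneg_left hx ha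
      have h2 := mul_le_mul_of_nonneg_left hy hb
      have h3 : a * (6 * ((k : ℝ) + 1)) + b * (6 * ((k : ℝ) + 1)) = 6 * ((k : ℝ) + 1) := by
        rw [← add_mul, hab, one_mul]
      linarith
    refine convexHull_min ?_ hc hv
    intro w hw
    simp only [mem_insert_iff, mem_singleton_iff] at hw
    rcases hw with rfl | rfl | rfl | rfl <;> simp <;> first | positivity | skip
    all_goals linarith
  · rintro ⟨h0, h1, h2, h⟩
    have hc : Convex ℝ (ZPWsimplex k) := convex_convexHull ℝ _
    have hsub : ∀ w ∈ ({![0,0,0], ![2,0,0], ![0,3,0], ![0,0,(6 * (k + 1) : ℝ)]} :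
        Set (Fin 3 → ℝ)), w ∈ ZPWsimplex k := fun w hw => subset_convexHull ℝ _ hw
    let c : Fin 4 → ℝ := ![1 - v 0 / 2 - v 1 / 3 - v 2 / (6 * ((k : ℝ) + 1)), v 0 / 2, v 1 / 3,
      v 2 / (6 * ((k : ℝ) + 1))]
    let z : Fin 4 → Fin 3 → ℝ := ![![0,0,0], ![2,0,0], ![0,3,0], ![0,0,(6 * (k + 1) : ℝ)]]
    have key := hc.sum_mem (t := Finset.univ) (w := c) (z := z) ?_ ?_ ?_
    · convert key using 1
      ext i
      fin_cases i <;> simp [c, z, Fin.sum_univ_four]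
      field_simp
    · intro i _
      fin_cases i
      · have : v 0 / 2 + v 1 / 3 + v 2 / (6 * ((k : ℝ) + 1)) =
          (3 * ((k : ℝ) + 1) * v 0 + 2 * ((k : ℝ) + 1) * v 1 + v 2) / (6 * ((k : ℝ) + 1)) := by
          field_simp
          ring
        have h' : v 0 / 2 + v 1 / 3 + v 2 / (6 * ((k : ℝ) + 1)) ≤ 1 := by
          rw [this, div_le_one (by positivity)]; exact h
        simp [c]; linarith
      · simp [c]; positivity
      · simp [c]; positivity
      · simp [c]; positivity
    · simp [c, Fin.sum_univ_four]
      ring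
    · intro i _
      apply hsub
      fin_cases i <;> simp [z]

/-- Half-space description of the dilates. -/
theorem zpw_mem_smul (k n : ℕ) (v : Fin 3 → ℝ) :
    v ∈ (n : ℝ) • ZPWsimplex k ↔ 0 ≤ v 0 ∧ 0 ≤ v 1 ∧ 0 ≤ v 2 ∧
      3 * ((k : ℝ) + 1) * v 0 + 2 * ((k : ℝ) + 1) * v 1 + v 2 ≤ 6 * ((k : ℝ) + 1) * n := by
  have hm : (0 : ℝ) < (k : ℝ) + 1 := by positivity
  rcases Nat.eq_zero_or_pos n with rfl | hn
  · have hne : (ZPWsimplex k).Nonempty := ⟨![0,0,0], subset_convexHull ℝ _ (by simp)⟩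
    rw [Nat.cast_zero, zero_smul_set hne]
    constructor
    · intro h
      have : v = 0 := h
      subst this
      simp
    · rintro ⟨h0, h1, h2, h⟩
      have a0 : 0 ≤ ((k : ℝ) + 1) * v 0 := by positivity
      have a1 : 0 ≤ ((k : ℝ) + 1) * v 1 := by positivity
      have e0 : ((k : ℝ) + 1) * v 0 = 0 := by linarith
      have e1 : ((k : ℝ) + 1) * v 1 = 0 := by linarith
      have e2 : v 2 = 0 := by linarith
      have e0' := (mul_eq_zero.1 e0).resolve_left hm.ne'
      have e1' := (mul_eq_zero.1 e1).resolve_left hm.ne'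
      show v = 0
      ext i
      fin_cases i <;> simp [*]
  · have hn' : (0 : ℝ) < n := by exact_mod_cast hn
    rw [mem_smul_set_iff_inv_smul_mem₀ hn'.ne', zpw_mem]
    simp only [Pi.smul_apply, smul_eq_mul]
    have e : 3 * ((k : ℝ) + 1) * ((n : ℝ)⁻¹ * v 0) + 2 * ((k : ℝ) + 1) * ((n : ℝ)⁻¹ * v 1)
        + (n : ℝ)⁻¹ * v 2 =
        (3 * ((k : ℝ) + 1) * v 0 + 2 * ((k : ℝ) + 1) * v 1 + v 2) / n := by
      field_simp
    rw [e, div_le_iff₀ hn']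
    have hi : (0 : ℝ) < (n : ℝ)⁻¹ := by positivity
    simp only [mul_nonneg_iff_of_pos_left hi]

/-- Lattice points in the dilates, by integer inequalities. -/
theorem zpw_lat (k n : ℕ) (x : Fin 3 → ℤ) :
    castPt x ∈ (n : ℝ) • ZPWsimplex k ↔ 0 ≤ x 0 ∧ 0 ≤ x 1 ∧ 0 ≤ x 2 ∧
      ((k : ℤ) + 1) * (3 * x 0 + 2 * x 1) + x 2 ≤ ((k : ℤ) + 1) * (6 * n) := by
  rw [zpw_mem_smul]
  simp only [castPt]
  constructor
  · rintro ⟨h0, h1, h2, h⟩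
    refine ⟨by exact_mod_cast h0, by exact_mod_cast h1, by exact_mod_cast h2, ?_⟩
    have : (((k : ℤ) + 1 : ℤ) : ℝ) * (3 * x 0 + 2 * x 1) + x 2 ≤ ((k : ℤ) + 1 : ℤ) * (6 * n) := by
      push_cast; linarith
    exact_mod_cast this
  · rintro ⟨h0, h1, h2, h⟩
    refine ⟨by exact_mod_cast h0, by exact_mod_cast h1, by exact_mod_cast h2, ?_⟩
    have : (((k : ℤ) + 1 : ℤ) : ℝ) * (3 * x 0 + 2 * x 1) + x 2 ≤ ((k : ℤ) + 1 : ℤ) * (6 * n) := by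
      exact_mod_cast h
    push_cast at this; linarith

/-- Indexing set for the lattice points of the dilate. -/
def zpwT (k n : ℕ) : Finset (Σ _ : ℕ, Σ _ : ℕ, ℕ) :=
  (Finset.range (2 * n + 1)).sigma fun u => (Finset.range (3 * u / 2 + 1)).sigma
    fun j => Finset.range ((k + 1) * (2 * j + 3 * u % 2) + 1)

/-- Parametrization of the lattice points of the dilate. -/
def zpwF (n : ℕ) (t : Σ _ : ℕ, Σ _ : ℕ, ℕ) : Fin 3 → ℤ :=
  ![2 * n - t.1, ((3 * t.1 / 2 : ℕ) : ℤ) - t.2.1, t.2.2]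

theorem zpw_image (k n : ℕ) :
    {x : Fin 3 → ℤ | castPt x ∈ (n : ℝ) • ZPWsimplex k} =
      zpwF n '' (zpwT k n : Set (Σ _ : ℕ, Σ _ : ℕ, ℕ)) := by
  ext x
  rw [mem_ofPred_eq, zpw_lat]
  have hm : (0 : ℤ) < (k : ℤ) + 1 := by positivity
  constructor
  · rintro ⟨h0, h1, h2, h⟩
    have hs : 3 * x 0 + 2 * x 1 ≤ 6 * n := by
      by_contra hc
      have : ((k : ℤ) + 1) * (6 * n) < ((k : ℤ) + 1) * (3 * x 0 + 2 * x 1) :=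
        mul_lt_mul_of_pos_left (by omega) hm
      omega
    obtain ⟨u, hu⟩ : ∃ u : ℕ, (u : ℤ) = 2 * n - x 0 := ⟨(2 * n - x 0).toNat, by omega⟩
    obtain ⟨j, hj⟩ : ∃ j : ℕ, (j : ℤ) = ((3 * u / 2 : ℕ) : ℤ) - x 1 :=
      ⟨(((3 * u / 2 : ℕ) : ℤ) - x 1).toNat, by omega⟩
    obtain ⟨z, hz⟩ : ∃ z : ℕ, (z : ℤ) = x 2 := ⟨(x 2).toNat, by omega⟩
    refine ⟨⟨u, j, z⟩, ?_, ?_⟩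
    · simp only [zpwT, Finset.coe_sigma]
      have e : ((2 * j + 3 * u % 2 : ℕ) : ℤ) = 6 * n - (3 * x 0 + 2 * x 1) := by omega
      have h3 : (z : ℤ) ≤ ((k : ℤ) + 1) * ((2 * j + 3 * u % 2 : ℕ) : ℤ) := by
        rw [e, hz]; linarith
      have h4 : z ≤ (k + 1) * (2 * j + 3 * u % 2) := by exact_mod_cast h3
      simp
      refine ⟨by omega, by omega, by omega⟩
    · ext i
      fin_cases i <;> simp [zpwF] <;> omega
  · rintro ⟨⟨u, j, z⟩, ht, rfl⟩
    rw [Finset.mem_coe, zpwT] at ht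
    simp only [Finset.mem_sigma, Finset.mem_range] at ht
    obtain ⟨hu, hj, hz⟩ := ht
    have h4 : z ≤ (k + 1) * (2 * j + 3 * u % 2) := by omega
    have h3 : (z : ℤ) ≤ ((k : ℤ) + 1) * ((2 * j + 3 * u % 2 : ℕ) : ℤ) := by exact_mod_cast h4
    have e : ((2 * j + 3 * u % 2 : ℕ) : ℤ) =
      6 * n - (3 * (2 * n - u) + 2 * (((3 * u / 2 : ℕ) : ℤ) - j)) := by omega
    rw [e] at h3
    have g0 : zpwF n ⟨u, j, z⟩ 0 = 2 * n - u := rfl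
    have g1 : zpwF n ⟨u, j, z⟩ 1 = ((3 * u / 2 : ℕ) : ℤ) - j := rfl
    have g2 : zpwF n ⟨u, j, z⟩ 2 = z := rfl
    rw [g0, g1, g2]
    refine ⟨by omega, by omega, by omega, by linarith⟩

theorem zpwF_inj (n : ℕ) : Function.Injective (zpwF n) := by
  rintro ⟨u, j, z⟩ ⟨u', j', z'⟩ h
  have h0 := congrFun h 0
  have h1 := congrFun h 1
  have h2 := congrFun h 2
  simp [zpwF] at h0 h1 h2
  subst h0
  subst h2
  have : j = j' := by omega
  subst this
  rfl

theorem zpw_ncard (k n : ℕ) :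
    {x : Fin 3 → ℤ | castPt x ∈ (n : ℝ) • ZPWsimplex k}.ncard =
      ∑ u ∈ Finset.range (2 * n + 1), ∑ j ∈ Finset.range (3 * u / 2 + 1),
        ((k + 1) * (2 * j + 3 * u % 2) + 1) := by
  rw [zpw_image, ncard_image_of_injective _ (zpwF_inj n), ncard_coe_finset, zpwT]
  simp only [Finset.card_sigma, Finset.card_range]

theorem zpw_inner (m r N : ℕ) :
    ∑ j ∈ Finset.range (N + 1), (m * (2 * j + r) + 1) = m * (N + 1) * (N + r) + (N + 1) := by
  induction N with
  | zero => simp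
  | succ N ih => rw [Finset.sum_range_succ, ih]; ring

theorem zpw_poly (k n : ℕ) :
    2 * ∑ u ∈ Finset.range (2 * n + 1), ∑ j ∈ Finset.range (3 * u / 2 + 1),
        ((k + 1) * (2 * j + 3 * u % 2) + 1) =
      (k + 1) * (12 * n ^ 3 + 15 * n ^ 2 + 5 * n) + 6 * n ^ 2 + 6 * n + 2 := by
  simp only [zpw_inner]
  induction n with
  | zero => simp
  | succ n ih =>
    rw [show 2 * (n + 1) + 1 = 2 * n + 1 + 1 + 1 by ring, Finset.sum_range_succ,
      Finset.sum_range_succ, mul_add, mul_add, ih]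
    rw [show 3 * (2 * n + 1) / 2 = 3 * n + 1 by omega, show 3 * (2 * n + 1) % 2 = 1 by omega,
      show 3 * (2 * n + 1 + 1) / 2 = 3 * n + 3 by omega,
      show 3 * (2 * n + 1 + 1) % 2 = 0 by omega]
    ring

theorem zpw_choose (n : ℕ) : 6 * Nat.choose (n + 3) 3 = (n + 1) * (n + 2) * (n + 3) := by
  have h := Nat.ascFactorial_eq_factorial_mul_choose' (n + 1) 3
  simp [Nat.ascFactorial, Nat.factorial] at h
  linarith

theorem zpw_count (k n : ℕ) :
    {x : Fin 3 → ℤ | castPt x ∈ (n : ℝ) • ZPWsimplex k}.ncard =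
      Nat.choose (n + 3) 3 + (16 * k + 19) * Nat.choose (n + 2) 3 +
        (19 * k + 16) * Nat.choose (n + 1) 3 + k * Nat.choose n 3 := by
  have h := zpw_poly k n
  rw [← zpw_ncard] at h
  rcases n with _ | _ | _ | n
  · simp [Nat.choose] at h ⊢; omega
  · simp [Nat.choose] at h ⊢; omega
  · simp [Nat.choose] at h ⊢; omega
  · have a0 := zpw_choose n
    have a1 := zpw_choose (n + 1)
    have a2 := zpw_choose (n + 2)
    have a3 := zpw_choose (n + 3)
    simp only [add_assoc, Nat.reduceAdd] at h a0 a1 a2 a3 ⊢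
    set A := (n + 3).choose 3
    set B := (n + 4).choose 3
    set C := (n + 5).choose 3
    set D := (n + 6).choose 3
    have b0 := congrArg (fun t => k * t) a0
    have b1 := congrArg (fun t => (19 * k + 16) * t) a1
    have b2 := congrArg (fun t => (16 * k + 19) * t) a2
    apply Nat.eq_of_mul_eq_mul_left (show 0 < 6 by norm_num)
    nlinarith

theorem zpw_interior (k : ℕ) (v : Fin 3 → ℝ) :
    v ∈ interior (ZPWsimplex k) ↔ 0 < v 0 ∧ 0 < v 1 ∧ 0 < v 2 ∧
      3 * ((k : ℝ) + 1) * v 0 + 2 * ((k : ℝ) + 1) * v 1 + v 2 < 6 * ((k : ℝ) + 1) := by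
  have hm : (0 : ℝ) < (k : ℝ) + 1 := by positivity
  constructor
  · intro hv
    have step : ∀ d : Fin 3 → ℝ, ∃ t : ℝ, 0 < t ∧ v + t • d ∈ ZPWsimplex k := by
      intro d
      have hcont : Continuous fun t : ℝ => v + t • d := by fun_prop
      have hmem : (fun t : ℝ => v + t • d) ⁻¹' (interior (ZPWsimplex k)) ∈ nhds (0 : ℝ) := by
        apply (isOpen_interior.preimage hcont).mem_nhds
        simpa using hv
      obtain ⟨ε, hε, hb⟩ := Metric.mem_nhds_iff.1 hmem
      refine ⟨ε / 2, by positivity, interior_subset (hb ?_)⟩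
      rw [Metric.mem_ball, Real.dist_eq, sub_zero, abs_of_pos (by positivity)]
      linarith
    obtain ⟨t0, p0, q0⟩ := step ![-1, 0, 0]
    obtain ⟨t1, p1, q1⟩ := step ![0, -1, 0]
    obtain ⟨t2, p2, q2⟩ := step ![0, 0, -1]
    obtain ⟨t3, p3, q3⟩ := step ![0, 0, 1]
    rw [zpw_mem] at q0 q1 q2 q3
    simp at q0 q1 q2 q3
    refine ⟨by linarith [q0.1], by linarith [q1.2.1], by linarith [q2.2.2.1],
      by linarith [q3.2.2.2]⟩
  · intro h
    have ho : IsOpen {v : Fin 3 → ℝ | 0 < v 0 ∧ 0 < v 1 ∧ 0 < v 2 ∧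
      3 * ((k : ℝ) + 1) * v 0 + 2 * ((k : ℝ) + 1) * v 1 + v 2 < 6 * ((k : ℝ) + 1)} := by
      have o0 : IsOpen {v : Fin 3 → ℝ | 0 < v 0} := isOpen_lt (by fun_prop) (by fun_prop)
      have o1 : IsOpen {v : Fin 3 → ℝ | 0 < v 1} := isOpen_lt (by fun_prop) (by fun_prop)
      have o2 : IsOpen {v : Fin 3 → ℝ | 0 < v 2} := isOpen_lt (by fun_prop) (by fun_prop)
      have o3 : IsOpen {v : Fin 3 → ℝ | 3 * ((k : ℝ) + 1) * v 0 + 2 * ((k : ℝ) + 1) * v 1 + v 2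
          < 6 * ((k : ℝ) + 1)} := isOpen_lt (by fun_prop) (by fun_prop)
      exact o0.inter (o1.inter (o2.inter o3))
    refine interior_maximal ?_ ho h
    rintro w ⟨h0, h1, h2, h3⟩
    exact (zpw_mem k w).2 ⟨h0.le, h1.le, h2.le, h3.le⟩

theorem zpw_int_ncard (k : ℕ) : (intLatPts (ZPWsimplex k)).ncard = k := by
  have e : intLatPts (ZPWsimplex k) =
      (fun j : ℕ => (![1, 1, (j : ℤ) + 1] : Fin 3 → ℤ)) '' (Finset.range k : Set ℕ) := by
    ext x
    rw [intLatPts, mem_ofPred_eq, zpw_interior]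
    simp only [castPt]
    constructor
    · rintro ⟨h0, h1, h2, h⟩
      have h0' : 0 < x 0 := by exact_mod_cast h0
      have h1' : 0 < x 1 := by exact_mod_cast h1
      have h2' : 0 < x 2 := by exact_mod_cast h2
      have h' : 3 * ((k : ℤ) + 1) * x 0 + 2 * ((k : ℤ) + 1) * x 1 + x 2 < 6 * ((k : ℤ) + 1) := by
        exact_mod_cast h
      have hs : 3 * x 0 + 2 * x 1 < 6 := by
        by_contra hc
        have : ((k : ℤ) + 1) * 6 ≤ ((k : ℤ) + 1) * (3 * x 0 + 2 * x 1) :=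
          mul_le_mul_of_nonneg_left (by omega) (by positivity)
        linarith
      have e0 : x 0 = 1 := by omega
      have e1 : x 1 = 1 := by omega
      rw [e0, e1] at h'
      refine ⟨(x 2 - 1).toNat, ?_, ?_⟩
      · simp only [Finset.coe_range, mem_Iio]; omega
      · ext i
        fin_cases i <;> simp <;> omega
    · rintro ⟨j, hj, rfl⟩
      simp only [Finset.coe_range, mem_Iio] at hj
      have hj' : (j : ℝ) + 1 ≤ k := by exact_mod_cast hj
      simp
      refine ⟨by positivity, by linarith⟩
  rw [e, ncard_image_of_injective, ncard_coe_finset, Finset.card_range]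
  intro a b h
  have := congrFun h 2
  simpa using this

theorem zpw_card (k n : ℕ) (hn : 0 < n) :
    Nat.card ↑(ZPWsimplex k ∩ (n : ℝ)⁻¹ •
      (Submodule.span ℤ (Set.range (Pi.basisFun ℝ (Fin 3))) : Set (Fin 3 → ℝ))) =
    {x : Fin 3 → ℤ | castPt x ∈ (n : ℝ) • ZPWsimplex k}.ncard := by
  have hn' : (0 : ℝ) < n := by exact_mod_cast hn
  have e : ZPWsimplex k ∩ (n : ℝ)⁻¹ •
      (Submodule.span ℤ (Set.range (Pi.basisFun ℝ (Fin 3))) : Set (Fin 3 → ℝ)) =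
      (fun x : Fin 3 → ℤ => (n : ℝ)⁻¹ • castPt x) ''
        {x : Fin 3 → ℤ | castPt x ∈ (n : ℝ) • ZPWsimplex k} := by
    ext v
    constructor
    · rintro ⟨hv, w, hw, rfl⟩
      rw [SetLike.mem_coe, Module.Basis.mem_span_iff_repr_mem] at hw
      simp only [Pi.basisFun_repr] at hw
      choose x hx using hw
      have hxw : castPt x = w := by
        ext i
        simpa [castPt] using hx i
      refine ⟨x, ?_, by simp [hxw]⟩
      rw [mem_ofPred_eq, mem_smul_set_iff_inv_smul_mem₀ hn'.ne', hxw]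
      exact hv
    · rintro ⟨x, hx, rfl⟩
      rw [mem_ofPred_eq, mem_smul_set_iff_inv_smul_mem₀ hn'.ne'] at hx
      refine ⟨hx, castPt x, ?_, rfl⟩
      rw [SetLike.mem_coe, Module.Basis.mem_span_iff_repr_mem]
      intro i
      exact ⟨x i, by simp [castPt]⟩
  rw [e, Nat.card_coe_set_eq, ncard_image_of_injective]
  intro x y h
  have h' := smul_right_injective (Fin 3 → ℝ) (inv_pos.2 hn').ne' h
  ext i
  have := congrFun h' i
  simpa [castPt] using this

theorem zpw_volume (k : ℕ) : (volume (ZPWsimplex k)).toReal = 6 * ((k : ℝ) + 1) := by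
  have hcomp : IsCompact (ZPWsimplex k) :=
    Set.Finite.isCompact_convexHull ℝ (Set.toFinite _)
  have hconv : Convex ℝ (ZPWsimplex k) := convex_convexHull ℝ _
  have h := tendsto_card_div_pow_atTop_volume (ZPWsimplex k) hcomp.isBounded
    hcomp.measurableSet (hconv.addHaar_frontier volume)
  have h2 : Filter.Tendsto (fun n : ℕ => 6 * ((k : ℝ) + 1) +
      ((15 * ((k : ℝ) + 1) + 6) / 2) * (n : ℝ)⁻¹ +
      ((5 * ((k : ℝ) + 1) + 6) / 2) * ((n : ℝ)⁻¹) ^ 2 + ((n : ℝ)⁻¹) ^ 3) Filter.atTop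
      (nhds (6 * ((k : ℝ) + 1) + ((15 * ((k : ℝ) + 1) + 6) / 2) * 0 +
      ((5 * ((k : ℝ) + 1) + 6) / 2) * 0 ^ 2 + 0 ^ 3)) := by
    have hi : Filter.Tendsto (fun n : ℕ => (n : ℝ)⁻¹) Filter.atTop (nhds 0) :=
      tendsto_inv_atTop_nhds_zero_nat
    exact ((tendsto_const_nhds.add (hi.const_mul _)).add ((hi.pow 2).const_mul _)).add (hi.pow 3)
  have h3 := tendsto_nhds_unique (h.congr' ?_) h2
  · rw [measureReal_def] at h3
    rw [h3]; ring
  · filter_upwards [Filter.eventually_gt_atTop 0] with n hn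
    have hn' : (0 : ℝ) < n := by exact_mod_cast hn
    have hp := zpw_poly k n
    rw [← zpw_ncard, ← zpw_card k n hn] at hp
    have hp' := congrArg (fun t : ℕ => (t : ℝ)) hp
    push_cast at hp'
    rw [Fintype.card_fin, div_eq_iff (by positivity)]
    generalize (Nat.card ↑(ZPWsimplex k ∩ (n : ℝ)⁻¹ •
      (Submodule.span ℤ (Set.range (Pi.basisFun ℝ (Fin 3))) : Set (Fin 3 → ℝ))) : ℝ) = N at hp' ⊢
    field_simp
    linarith

/-- For every `k ≥ 1`, the simplex `S_k³` has exactly `k` interior lattice points,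
normalised volume `36(k+1)`, and Ehrhart `δ`-vector `(1, 16k+19, 19k+16, k)`: for all
`n ≥ 0` one has
`|nS_k³ ∩ ℤ³| = C(n+3,3) + (16k+19)C(n+2,3) + (19k+16)C(n+1,3) + k C(n,3)`. -/
theorem ZPW_simplex_delta_vector (k : ℕ) (hk : 1 ≤ k) :
    (intLatPts (ZPWsimplex k)).ncard = k ∧
    6 * (volume (ZPWsimplex k)).toReal = 36 * (k + 1) ∧
    ∀ n : ℕ, {x : Fin 3 → ℤ | castPt x ∈ (n : ℝ) • ZPWsimplex k}.ncard =
      Nat.choose (n + 3) 3 + (16 * k + 19) * Nat.choose (n + 2) 3 +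
        (19 * k + 16) * Nat.choose (n + 1) 3 + k * Nat.choose n 3 := by
  exact ⟨zpw_int_ncard k, by rw [zpw_volume]; ring, fun n => zpw_count k n⟩
end
end

section
/- For every integer m ≥ 1, the tetrahedron P_m = conv{(−1,−1,−1),(1,0,0),(0,1,0),(0,0,m)} ⊂ ℝ³ has Ehrhart δ-vector (1, m, m, m); equivalently, for every integer n ≥ 0, |nP_m ∩ ℤ³| = C(n+3,3) + m·(C(n+2,3) + C(n+1,3) + C(n,3)), where C(m,3) denotes the binomial coefficient. In particular P_m has exactly m interior lattice points and normalized volume 3m+1, so the inequalities δ₃ ≤ δ₁ ≤ δ₂ are sharp in dimension three. -/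
open Set MeasureTheory Pointwise

noncomputable section

/-- The tetrahedron `P_m = conv{(−1,−1,−1),(1,0,0),(0,1,0),(0,0,m)}`. -/
def Pm (m : ℕ) : Set (Fin 3 → ℝ) :=
  convexHull ℝ {![-1,-1,-1], ![1,0,0], ![0,1,0], ![0,0,(m : ℝ)]}

lemma tri_sum (k : ℕ) : ∑ v ∈ Finset.range k, (k - v) = Nat.choose (k + 1) 2 := by
  induction k with
  | zero => simp
  | succ k ih =>
    rw [Finset.sum_range_succ', Nat.choose_succ_succ' (k + 1) 1, ← ih]
    simp [add_comm]

lemma tet_sum (k : ℕ) :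
    ∑ q ∈ Finset.range k, ∑ v ∈ Finset.range (k - q), (k - q - v) = Nat.choose (k + 2) 3 := by
  simp_rw [tri_sum]
  induction k with
  | zero => simp
  | succ k ih =>
    rw [Finset.sum_range_succ', Nat.choose_succ_succ' (k + 2) 2, ← ih]
    simp [add_comm _ ((k + 2).choose 2)]

/-- The height shift attached to a residue `r`: the ceiling of `3r / (3m+1)`. -/
def shiftC (m r : ℕ) : ℕ := (3 * r + 3 * m) / (3 * m + 1)

/-- Index set for the lattice points of `n P_m`. -/
def idx (m n : ℕ) : Finset (Σ _ : ℕ, Σ _ : ℕ, Σ _ : ℕ, ℕ) :=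
  (Finset.range (3 * m + 1)).sigma fun r => (Finset.range (n + 1 - shiftC m r)).sigma fun q =>
    (Finset.range (n + 1 - shiftC m r - q)).sigma fun v =>
      Finset.range (n + 1 - shiftC m r - q - v)

lemma shiftC_le (m r k : ℕ) : shiftC m r ≤ k ↔ 3 * r ≤ (3 * m + 1) * k := by
  unfold shiftC
  rw [← Nat.lt_succ_iff, Nat.div_lt_iff_lt_mul (by omega), Nat.succ_eq_add_one, add_mul, mul_comm k]
  omega

lemma shiftC_eq (m r k : ℕ) (h1 : 3 * r ≤ (3 * m + 1) * (k + 1)) (h2 : (3 * m + 1) * k < 3 * r) :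
    shiftC m r = k + 1 :=
  le_antisymm ((shiftC_le _ _ _).2 h1) (by
    by_contra h
    have := (shiftC_le m r k).1 (by omega)
    omega)

lemma card_idx (m n : ℕ) : (idx m n).card = Nat.choose (n + 3) 3 +
        m * (Nat.choose (n + 2) 3 + Nat.choose (n + 1) 3 + Nat.choose n 3) := by
  have h0 : shiftC m 0 = 0 := by
    have := (shiftC_le m 0 0).2 (by simp)
    omega
  simp only [idx, Finset.card_sigma, Finset.card_range, tet_sum]
  rw [Finset.sum_range_succ', h0, show 3 * m = m + m + m by ring, Finset.sum_range_add,
    Finset.sum_range_add]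
  have e1 : ∀ i ∈ Finset.range m, (n + 1 - shiftC m (i + 1) + 2).choose 3 = (n + 2).choose 3 := by
    intro i hi
    rw [Finset.mem_range] at hi
    rw [shiftC_eq m (i + 1) 0 (by omega) (by omega)]
    rfl
  have e2 : ∀ i ∈ Finset.range m,
      (n + 1 - shiftC m (m + i + 1) + 2).choose 3 = (n + 1).choose 3 := by
    intro i hi
    rw [Finset.mem_range] at hi
    rw [shiftC_eq m (m + i + 1) 1 (by omega) (by omega)]
    rcases n with _ | n <;> rfl
  have e3 : ∀ i ∈ Finset.range m,
      (n + 1 - shiftC m (m + m + i + 1) + 2).choose 3 = n.choose 3 := by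
    intro i hi
    rw [Finset.mem_range] at hi
    rw [shiftC_eq m (m + m + i + 1) 2 (by omega) (by omega)]
    rcases n with _ | _ | n <;> rfl
  rw [Finset.sum_congr rfl e1, Finset.sum_congr rfl e2, Finset.sum_congr rfl e3]
  simp only [Finset.sum_const, Finset.card_range, smul_eq_mul]
  simp only [Nat.sub_zero]
  ring

/-- The four (scaled) barycentric inequalities of `t P_m`. -/
def Ineq (m : ℕ) (t x y z : ℝ) : Prop :=
  0 ≤ m * (t - x - y) - z ∧ 0 ≤ m * (t - x - y) - z + (3 * m + 1) * x ∧
  0 ≤ m * (t - x - y) - z + (3 * m + 1) * y ∧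
  0 ≤ (3 * m + 1) * (t - x - y) - 3 * (m * (t - x - y) - z)

lemma mem_Pm (m : ℕ) (x : Fin 3 → ℝ) : x ∈ Pm m ↔ Ineq m 1 (x 0) (x 1) (x 2) := by
  have hN : (0 : ℝ) < 3 * m + 1 := by positivity
  constructor
  · intro hx
    have hc : Convex ℝ {x : Fin 3 → ℝ | Ineq m 1 (x 0) (x 1) (x 2)} := by
      rintro p ⟨hp1, hp2, hp3, hp4⟩ q ⟨hq1, hq2, hq3, hq4⟩ a b ha hb hab
      obtain rfl : b = 1 - a := by linarith
      simp only [mem_setOf_eq, Ineq, Pi.add_apply, Pi.smul_apply, smul_eq_mul]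
      refine ⟨?_, ?_, ?_, ?_⟩
      · linarith [mul_nonneg ha hp1, mul_nonneg hb hq1]
      · linarith [mul_nonneg ha hp2, mul_nonneg hb hq2]
      · linarith [mul_nonneg ha hp3, mul_nonneg hb hq3]
      · linarith [mul_nonneg ha hp4, mul_nonneg hb hq4]
    refine convexHull_min ?_ hc hx
    have hm : (0 : ℝ) ≤ m := by positivity
    intro y hy
    simp only [mem_insert_iff, mem_singleton_iff] at hy
    rcases hy with rfl | rfl | rfl | rfl <;>
      simp only [mem_setOf_eq, Ineq, Matrix.cons_val] <;>
      refine ⟨?_, ?_, ?_, ?_⟩ <;> nlinarith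
  · rintro ⟨h1, h2, h3, h4⟩
    set A : ℝ := m * (1 - x 0 - x 1) - x 2 with hA
    set N : ℝ := 3 * m + 1 with hNd
    have key := (convex_convexHull ℝ ({![-1,-1,-1], ![1,0,0], ![0,1,0], ![0,0,(m : ℝ)]} :
      Set (Fin 3 → ℝ))).sum_mem (t := Finset.univ)
      (w := ![A / N, (A + N * x 0) / N, (A + N * x 1) / N, (N * (1 - x 0 - x 1) - 3 * A) / N])
      (z := ![![-1,-1,-1], ![1,0,0], ![0,1,0], ![0,0,(m : ℝ)]])
      (by
        intro i _
        fin_cases i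
        · exact div_nonneg h1 hN.le
        · exact div_nonneg h2 hN.le
        · exact div_nonneg h3 hN.le
        · exact div_nonneg h4 hN.le)
      (by
        simp [Fin.sum_univ_four]
        field_simp
        ring)
      (by
        intro i _
        apply subset_convexHull
        fin_cases i <;> simp)
    unfold Pm
    convert key using 1
    ext i
    fin_cases i <;> simp [Fin.sum_univ_four] <;> field_simp <;> simp only [hA, hNd] <;> ring

lemma mem_smul_Pm (m n : ℕ) (x : Fin 3 → ℝ) :
    x ∈ (n : ℝ) • Pm m ↔ Ineq m n (x 0) (x 1) (x 2) := by
  rcases Nat.eq_zero_or_pos n with rfl | hn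
  · have hne : (Pm m).Nonempty := ⟨_, subset_convexHull _ _ (mem_insert _ _)⟩
    rw [Nat.cast_zero, zero_smul_set hne, Set.mem_zero]
    constructor
    · rintro rfl
      simp [Ineq]
    · rintro ⟨h1, h2, h3, h4⟩
      have hN : (0 : ℝ) < 3 * m + 1 := by positivity
      have a1 : (m : ℝ) * (0 - x 0 - x 1) - x 2 = 0 := by linarith
      have a2 : (3 * m + 1) * x 0 = 0 := by linarith
      have a3 : (3 * m + 1) * x 1 = 0 := by linarith
      have b2 : x 0 = 0 := by simpa [hN.ne'] using a2
      have b3 : x 1 = 0 := by simpa [hN.ne'] using a3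
      have b4 : x 2 = 0 := by rw [b2, b3] at a1; linarith
      ext i
      fin_cases i <;> simp [*]
  · have hn' : (0 : ℝ) < n := by exact_mod_cast hn
    have hi : (0 : ℝ) < (n : ℝ)⁻¹ := by positivity
    rw [mem_smul_set_iff_inv_smul_mem₀ hn'.ne', mem_Pm]
    simp only [Ineq, Pi.smul_apply, smul_eq_mul]
    have e : (n : ℝ)⁻¹ * n = 1 := inv_mul_cancel₀ hn'.ne'
    refine and_congr ?_ (and_congr ?_ (and_congr ?_ ?_))
    all_goals
      rw [← e]
      refine Iff.trans (iff_of_eq (congrArg _ ?_)) (mul_nonneg_iff_of_pos_left hi)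
      ring

/-- Parametrisation of the lattice points. -/
def par (m n : ℕ) (s : Σ _ : ℕ, Σ _ : ℕ, Σ _ : ℕ, ℕ) : Fin 3 → ℤ :=
  ![s.2.2.2 - s.2.1, s.2.2.1 - s.2.1,
    m * (n - (s.2.2.2 - s.2.1) - (s.2.2.1 - s.2.1)) - ((3 * m + 1) * s.2.1 + s.1)]

lemma mem_idx (m n r q v u : ℕ) : (⟨r, q, v, u⟩ : Σ _ : ℕ, Σ _ : ℕ, Σ _ : ℕ, ℕ) ∈ idx m n ↔
    r < 3 * m + 1 ∧ u + v + q ≤ n ∧ 3 * r ≤ (3 * m + 1) * (n - u - v - q) := by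
  simp only [idx, Finset.mem_sigma, Finset.mem_range]
  rw [← shiftC_le]
  omega

lemma par_inj (m n : ℕ) : Set.InjOn (par m n) (idx m n) := by
  rintro ⟨r, q, v, u⟩ h ⟨r', q', v', u'⟩ h' e
  rw [Finset.mem_coe, mem_idx] at h h'
  have e0 := congrFun e 0
  have e1 := congrFun e 1
  have e2 := congrFun e 2
  simp only [par, Matrix.cons_val] at e0 e1 e2
  rw [e0, e1] at e2
  have e3 : (3 * (m : ℤ) + 1) * q + r = (3 * m + 1) * q' + r' := by linarith
  have e4 : (3 * m + 1) * q + r = (3 * m + 1) * q' + r' := by exact_mod_cast e3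
  have hq : q = q' := by
    have a := congrArg (· / (3 * m + 1)) e4
    simpa [Nat.mul_add_div, Nat.div_eq_of_lt h.1, Nat.div_eq_of_lt h'.1] using a
  subst hq
  have hr : r = r' := by omega
  have hv : v = v' := by omega
  have hu : u = u' := by omega
  subst hr hv hu
  rfl

lemma lat_iff (m n : ℕ) (x : Fin 3 → ℤ) : castPt x ∈ (n : ℝ) • Pm m ↔
    0 ≤ m * (n - x 0 - x 1) - x 2 ∧ 0 ≤ m * (n - x 0 - x 1) - x 2 + (3 * m + 1) * x 0 ∧
    0 ≤ m * (n - x 0 - x 1) - x 2 + (3 * m + 1) * x 1 ∧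
    0 ≤ (3 * m + 1) * (n - x 0 - x 1) - 3 * (m * (n - x 0 - x 1) - x 2) := by
  rw [mem_smul_Pm]
  simp only [Ineq, castPt]
  norm_cast

lemma lat_eq (m n : ℕ) : {x : Fin 3 → ℤ | castPt x ∈ (n : ℝ) • Pm m} =
    ((idx m n).image (par m n) : Finset (Fin 3 → ℤ)) := by
  ext x
  rw [mem_setOf_eq, lat_iff, Finset.mem_coe, Finset.mem_image]
  have hN : (0 : ℤ) < 3 * m + 1 := by positivity
  constructor
  · rintro ⟨h1, h2, h3, h4⟩
    obtain ⟨A, hA⟩ := Int.eq_ofNat_of_zero_le h1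
    rw [hA] at h2 h3 h4
    obtain ⟨q, hq⟩ : ∃ q, q = A / (3 * m + 1) := ⟨_, rfl⟩
    obtain ⟨r, hr⟩ : ∃ r, r = A % (3 * m + 1) := ⟨_, rfl⟩
    have hrN : r < 3 * m + 1 := hr ▸ Nat.mod_lt _ (by omega)
    have hdiv : A = (3 * m + 1) * q + r := by rw [hq, hr, Nat.div_add_mod]
    have hdivZ : (A : ℤ) = (3 * m + 1) * q + r := by exact_mod_cast hdiv
    have hrZ : (r : ℤ) < 3 * m + 1 := by exact_mod_cast hrN
    have hu : 0 ≤ x 0 + q := by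
      by_contra h
      nlinarith [mul_nonneg hN.le (show (0 : ℤ) ≤ -1 - (x 0 + q) by omega)]
    have hv : 0 ≤ x 1 + q := by
      by_contra h
      nlinarith [mul_nonneg hN.le (show (0 : ℤ) ≤ -1 - (x 1 + q) by omega)]
    obtain ⟨u, hu⟩ := Int.eq_ofNat_of_zero_le hu
    obtain ⟨v, hv⟩ := Int.eq_ofNat_of_zero_le hv
    obtain hx0 : x 0 = u - q := by linarith
    obtain hx1 : x 1 = v - q := by linarith
    have h5 : (3 * r : ℤ) ≤ (3 * m + 1) * (n - u - v - q) := by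
      rw [hx0, hx1, hdivZ] at h4
      linarith
    have h6 : u + v + q ≤ n := by
      by_contra h
      have : (0 : ℤ) ≤ u + v + q - n - 1 := by omega
      nlinarith [mul_nonneg hN.le this]
    refine ⟨⟨r, q, v, u⟩, (mem_idx ..).2 ⟨hrN, h6, ?_⟩, ?_⟩
    · have : ((n - u - v - q : ℕ) : ℤ) = n - u - v - q := by omega
      zify
      rw [this]
      exact h5
    · ext i
      fin_cases i
      · simp [par, hx0]
      · simp [par, hx1]
      · simp only [par, Fin.reduceFinMk, Matrix.cons_val]
        rw [← hx0, ← hx1, ← hdivZ]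
        linarith
  · rintro ⟨⟨r, q, v, u⟩, hs, rfl⟩
    rw [mem_idx] at hs
    obtain ⟨h1, h2, h3⟩ := hs
    have : ((n - u - v - q : ℕ) : ℤ) = n - u - v - q := by omega
    zify at h3
    rw [this] at h3
    simp only [par, Matrix.cons_val]
    have hu : (0 : ℤ) ≤ (3 * m + 1) * u := by positivity
    have hv : (0 : ℤ) ≤ (3 * m + 1) * v := by positivity
    have hq : (0 : ℤ) ≤ (3 * m + 1) * q := by positivity
    refine ⟨?_, ?_, ?_, ?_⟩ <;> linarith

lemma count (m n : ℕ) : {x : Fin 3 → ℤ | castPt x ∈ (n : ℝ) • Pm m}.ncard =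
      Nat.choose (n + 3) 3 +
        m * (Nat.choose (n + 2) 3 + Nat.choose (n + 1) 3 + Nat.choose n 3) := by
  rw [lat_eq, Set.ncard_coe_finset, Finset.card_image_of_injOn (par_inj m n), card_idx]

lemma int_pos {S : Set (Fin 3 → ℝ)} (L : (Fin 3 → ℝ) → ℝ) (v : Fin 3 → ℝ) (c : ℝ) (hc : 0 < c)
    (hL : ∀ x t, L (x + t • v) = L x - t * c) (hS : ∀ x ∈ S, 0 ≤ L x) (x : Fin 3 → ℝ)
    (hx : x ∈ interior S) : 0 < L x := by
  have hcont : Filter.Tendsto (fun t : ℝ => x + t • v) (nhdsWithin 0 (Ioi 0)) (nhds x) := by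
    have : Continuous (fun t : ℝ => x + t • v) := by fun_prop
    have h := this.tendsto 0
    simp only [zero_smul, add_zero] at h
    exact h.mono_left nhdsWithin_le_nhds
  have h1 := hcont.eventually (mem_interior_iff_mem_nhds.1 hx)
  obtain ⟨t, ht, ht0⟩ := (h1.and self_mem_nhdsWithin).exists
  have h2 := hS _ ht
  rw [hL] at h2
  have : 0 < t * c := mul_pos ht0 hc
  linarith

lemma mem_int (m : ℕ) (x : Fin 3 → ℝ) : x ∈ interior (Pm m) ↔
    0 < m * (1 - x 0 - x 1) - x 2 ∧ 0 < m * (1 - x 0 - x 1) - x 2 + (3 * m + 1) * x 0 ∧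
    0 < m * (1 - x 0 - x 1) - x 2 + (3 * m + 1) * x 1 ∧
    0 < (3 * m + 1) * (1 - x 0 - x 1) - 3 * (m * (1 - x 0 - x 1) - x 2) := by
  constructor
  · intro hx
    refine ⟨?_, ?_, ?_, ?_⟩
    · refine int_pos (fun x => m * (1 - x 0 - x 1) - x 2) ![0,0,1] 1 one_pos ?_ ?_ x hx
      · intro x t; simp; ring
      · intro x hx; exact ((mem_Pm m x).1 hx).1
    · refine int_pos (fun x => m * (1 - x 0 - x 1) - x 2 + (3 * m + 1) * x 0) ![0,0,1] 1 one_pos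
        ?_ ?_ x hx
      · intro x t; simp; ring
      · intro x hx; exact ((mem_Pm m x).1 hx).2.1
    · refine int_pos (fun x => m * (1 - x 0 - x 1) - x 2 + (3 * m + 1) * x 1) ![0,0,1] 1 one_pos
        ?_ ?_ x hx
      · intro x t; simp; ring
      · intro x hx; exact ((mem_Pm m x).1 hx).2.2.1
    · refine int_pos (fun x => (3 * m + 1) * (1 - x 0 - x 1) - 3 * (m * (1 - x 0 - x 1) - x 2))
        ![0,0,-1] 3 (by norm_num) ?_ ?_ x hx
      · intro x t; simp; ring
      · intro x hx; exact ((mem_Pm m x).1 hx).2.2.2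
  · intro h
    refine mem_interior.2 ⟨{x : Fin 3 → ℝ | 0 < m * (1 - x 0 - x 1) - x 2 ∧
      0 < m * (1 - x 0 - x 1) - x 2 + (3 * m + 1) * x 0 ∧
      0 < m * (1 - x 0 - x 1) - x 2 + (3 * m + 1) * x 1 ∧
      0 < (3 * m + 1) * (1 - x 0 - x 1) - 3 * (m * (1 - x 0 - x 1) - x 2)}, ?_, ?_, h⟩
    · rintro y ⟨h1, h2, h3, h4⟩
      exact (mem_Pm m y).2 ⟨h1.le, h2.le, h3.le, h4.le⟩
    · refine IsOpen.and ?_ (IsOpen.and ?_ (IsOpen.and ?_ ?_)) <;>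
        exact isOpen_lt continuous_const (by fun_prop)

lemma int_count (m : ℕ) : (intLatPts (Pm m)).ncard = m := by
  have : intLatPts (Pm m) =
      ((Finset.range m).image (fun k : ℕ => (![0, 0, (k : ℤ)] : Fin 3 → ℤ)) :
        Finset (Fin 3 → ℤ)) := by
    ext x
    simp only [intLatPts, mem_setOf_eq, mem_int, Finset.mem_coe, Finset.mem_image, Finset.mem_range]
    simp only [castPt]
    norm_cast
    constructor
    · rintro ⟨h1, h2, h3, h4⟩
      push_cast at h1 h2 h3 h4
      have hN : (0 : ℤ) < 3 * m + 1 := by positivity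
      obtain ⟨A, hA⟩ : ∃ A : ℤ, A = m * (1 - x 0 - x 1) - x 2 := ⟨_, rfl⟩
      rw [← hA] at h1 h2 h3 h4
      have hAN : A < 3 * m + 1 := by linarith
      have hx : 0 ≤ x 0 := by
        by_contra h
        nlinarith [mul_nonneg hN.le (show (0 : ℤ) ≤ -1 - x 0 by omega)]
      have hy : 0 ≤ x 1 := by
        by_contra h
        nlinarith [mul_nonneg hN.le (show (0 : ℤ) ≤ -1 - x 1 by omega)]
      have hxy : x 0 + x 1 < 1 := by
        by_contra h
        nlinarith [mul_nonneg hN.le (show (0 : ℤ) ≤ x 0 + x 1 - 1 by omega)]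
      have e0 : x 0 = 0 := by omega
      have e1 : x 1 = 0 := by omega
      rw [e0, e1] at hA h4
      refine ⟨(x 2).toNat, by omega, ?_⟩
      ext i
      fin_cases i
      · simp [e0]
      · simp [e1]
      · simp; omega
    · rintro ⟨k, hk, rfl⟩
      simp only [Matrix.cons_val]
      push_cast
      omega
  rw [this, Set.ncard_coe_finset, Finset.card_image_of_injective, Finset.card_range]
  intro a b h
  have := congrFun h 2
  simpa using this

lemma card_eq (m n : ℕ) (hn : n ≠ 0) :
    Nat.card ↑(Pm m ∩ (n : ℝ)⁻¹ • (Submodule.span ℤ (Set.range (Pi.basisFun ℝ (Fin 3))) :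
      Set (Fin 3 → ℝ))) = {x : Fin 3 → ℤ | castPt x ∈ (n : ℝ) • Pm m}.ncard := by
  have hn' : (n : ℝ) ≠ 0 := by exact_mod_cast hn
  rw [Nat.card_coe_set_eq]
  have : (Pm m ∩ (n : ℝ)⁻¹ • (Submodule.span ℤ (Set.range (Pi.basisFun ℝ (Fin 3))) :
      Set (Fin 3 → ℝ))) =
      (fun x : Fin 3 → ℤ => (n : ℝ)⁻¹ • castPt x) '' {x | castPt x ∈ (n : ℝ) • Pm m} := by
    ext y
    constructor
    · rintro ⟨h1, z, hz, rfl⟩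
      rw [SetLike.mem_coe, Module.Basis.mem_span_iff_repr_mem] at hz
      choose w hw using hz
      have : z = castPt w := by
        ext i
        have := hw i
        simp at this
        exact this.symm
      subst this
      exact ⟨w, (mem_smul_set_iff_inv_smul_mem₀ hn' _ _).2 h1, rfl⟩
    · rintro ⟨w, hw, rfl⟩
      refine ⟨(mem_smul_set_iff_inv_smul_mem₀ hn' _ _).1 hw, smul_mem_smul_set ?_⟩
      rw [SetLike.mem_coe, Module.Basis.mem_span_iff_repr_mem]
      intro i
      exact ⟨w i, by simp [castPt]⟩
  rw [this, Set.ncard_image_of_injective]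
  intro a b h
  have h2 := smul_right_injective _ (inv_ne_zero hn') h
  ext i
  have := congrFun h2 i
  simpa [castPt] using this

lemma choose3 (k : ℕ) : (((k + 2).choose 3 : ℕ) : ℝ) = (k + 2) * (k + 1) * k / 6 := by
  rw [Nat.cast_choose_eq_ascPochhammer_div]
  simp [ascPochhammer, Nat.factorial]
  ring

lemma vol (m : ℕ) : 6 * (volume (Pm m)).toReal = 3 * m + 1 := by
  have hfin : ({![-1,-1,-1], ![1,0,0], ![0,1,0], ![0,0,(m : ℝ)]} : Set (Fin 3 → ℝ)).Finite := by
    simp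
  have hcomp : IsCompact (Pm m) := hfin.isCompact_convexHull (𝕜 := ℝ)
  have h := tendsto_card_div_pow_atTop_volume (Pm m) hcomp.isBounded hcomp.measurableSet
    ((convex_convexHull ℝ _).addHaar_frontier volume)
  have h2 : Filter.Tendsto (fun n : ℕ => ((1 + 3 * (n : ℝ)⁻¹) * (1 + 2 * (n : ℝ)⁻¹) *
      (1 + (n : ℝ)⁻¹) + m * ((1 + 2 * (n : ℝ)⁻¹) * (1 + (n : ℝ)⁻¹) + 
      (1 + (n : ℝ)⁻¹) * (1 - (n : ℝ)⁻¹) + (1 - (n : ℝ)⁻¹) * (1 - 2 * (n : ℝ)⁻¹))) / 6)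
      Filter.atTop (nhds ((3 * m + 1) / 6)) := by
    have hc : Continuous (fun s : ℝ => ((1 + 3 * s) * (1 + 2 * s) * (1 + s) +
      m * ((1 + 2 * s) * (1 + s) + (1 + s) * (1 - s) + (1 - s) * (1 - 2 * s))) / 6) := by
      fun_prop
    have := (hc.tendsto 0).comp (tendsto_inv_atTop_nhds_zero_nat (𝕜 := ℝ))
    convert this using 2
    congr 1
    ring
  have h3 := h2.congr' (f₂ := fun n : ℕ => (Nat.card ↑(Pm m ∩ (n : ℝ)⁻¹ •
    (Submodule.span ℤ (Set.range (Pi.basisFun ℝ (Fin 3))) : Set (Fin 3 → ℝ))) : ℝ) /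
      (n : ℝ) ^ Fintype.card (Fin 3)) (by
    filter_upwards [Filter.eventually_ge_atTop 2] with n hn
    obtain ⟨k, rfl⟩ := Nat.exists_eq_add_of_le' hn
    rw [card_eq m _ (by omega), count]
    push_cast
    rw [show k + 2 + 3 = (k + 3) + 2 by ring, show k + 2 + 1 = (k + 1) + 2 by ring,
      choose3, choose3, choose3, choose3]
    push_cast
    have : (k : ℝ) + 2 ≠ 0 := by positivity
    rw [Fintype.card_fin]
    field_simp
    ring)
  have h4 := tendsto_nhds_unique h h3
  rw [measureReal_def] at h4
  rw [h4]
  ring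

/-- For every `m ≥ 1`, the tetrahedron `P_m = conv{(−1,−1,−1),(1,0,0),(0,1,0),(0,0,m)}`
has Ehrhart `δ`-vector `(1, m, m, m)`: for all `n ≥ 0`,
`|nP_m ∩ ℤ³| = C(n+3,3) + m(C(n+2,3) + C(n+1,3) + C(n,3))`. In particular `P_m` has
exactly `m` interior lattice points and normalised volume `3m+1`, so the inequalities
`δ₃ ≤ δ₁ ≤ δ₂` are sharp in dimension three. -/
theorem Pm_delta_vector (m : ℕ) (hm : 1 ≤ m) :
    (∀ n : ℕ, {x : Fin 3 → ℤ | castPt x ∈ (n : ℝ) • Pm m}.ncard =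
      Nat.choose (n + 3) 3 +
        m * (Nat.choose (n + 2) 3 + Nat.choose (n + 1) 3 + Nat.choose n 3)) ∧
    (intLatPts (Pm m)).ncard = m ∧
    6 * (volume (Pm m)).toReal = 3 * m + 1 := by
  exact ⟨count m, int_count m, vol m⟩
end
end
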